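/- For every n ≥ 3, the braid group B_n, given by the Artin presentation ⟨σ₁,…,σ_{n−1} | σᵢσⱼ = σⱼσᵢ whenever |i−j| > 1, and σᵢσ_{i+1}σᵢ = σ_{i+1}σᵢσ_{i+1} for 1 ≤ i ≤ n−2⟩, satisfies the strong generic free group property with respect to every finite generating set. -/

import Mathlib

open Filter Set

/-- The ball of radius `m` in a group with respect to a set `S`: the elements expressible as
a product of at most `m` elements of `S ∪ S⁻¹`. -/
def wordBall {G : Type*} [Group G] (S : Set G) (m : ℕ) : Set G :=
  {g | ∃ l : List G, l.length ≤ m ∧ (∀ x ∈ l, x ∈ S ∨ x⁻¹ ∈ S) ∧ l.prod = g}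

/-- A tuple `(g₁, …, gₙ)` is a free basis tuple if the induced homomorphism from the free
group of rank `n` sending the `i`-th free generator to `gᵢ` is injective. -/
def IsFreeBasisTuple {G : Type*} [Group G] {n : ℕ} (x : Fin n → G) : Prop :=
  Function.Injective (FreeGroup.lift x)

/-- A group has the strong generic free group property with respect to a generating set `S`
if for every `n ≥ 1` the proportion of free basis `n`-tuples in the ball of radius `m`
tends to `1` as `m → ∞`. -/
def StrongGenericFreeGroupProperty {G : Type*} [Group G] (S : Set G) : Prop :=
  ∀ n : ℕ, 1 ≤ n →
    Filter.Tendsto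
      (fun m : ℕ =>
        ({x : Fin n → G | (∀ i, x i ∈ wordBall S m) ∧ IsFreeBasisTuple x}.ncard : ℝ) /
          ((wordBall S m).ncard : ℝ) ^ n)
      Filter.atTop (nhds 1)

/-- A group has the strong generic free group property with respect to every finite
generating set. -/
def HasStrongGenericFreeGroupProperty (G : Type*) [Group G] : Prop :=
  ∀ S : Set G, S.Finite → Subgroup.closure S = ⊤ → StrongGenericFreeGroupProperty S

/-- The Artin relators of the braid group on `n` strands: `σᵢσⱼσⱼ⁻¹σᵢ⁻¹`-type relators
`σᵢσⱼ(σⱼσᵢ)⁻¹` for `|i - j| > 1`, and `σᵢσ_{i+1}σᵢ(σ_{i+1}σᵢσ_{i+1})⁻¹`. -/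
def braidRels (n : ℕ) : Set (FreeGroup (Fin (n - 1))) :=
  {r | (∃ i j : Fin (n - 1), 1 < ((i : ℤ) - (j : ℤ)).natAbs ∧
          r = FreeGroup.of i * FreeGroup.of j * (FreeGroup.of j * FreeGroup.of i)⁻¹) ∨
       (∃ i j : Fin (n - 1), (j : ℕ) = (i : ℕ) + 1 ∧
          r = FreeGroup.of i * FreeGroup.of j * FreeGroup.of i *
            (FreeGroup.of j * FreeGroup.of i * FreeGroup.of j)⁻¹)}

/-- The braid group on `n` strands, given by the Artin presentation
`⟨σ₁,…,σ_{n−1} | σᵢσⱼ = σⱼσᵢ for |i−j| > 1, σᵢσ_{i+1}σᵢ = σ_{i+1}σᵢσ_{i+1}⟩`. -/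
def BraidGroup (n : ℕ) : Type :=
  PresentedGroup (braidRels n)

instance (n : ℕ) : Group (BraidGroup n) := by
  unfold BraidGroup; infer_instance

/-- A left-invariant system of barriers on a group `G`.  The element `s` carries a wall;
`Behind s w` says that `w` lies behind the wall of `s` and `Behind (s * flip) w` that it lies in
front of it. -/
structure BarrierSystem (G : Type*) [Group G] where
  Behind : G → G → Prop
  Between : G → G → G → Prop
  flip : G
  shift : G
  selector : Fin 3 → G
  weight : G →* Multiplicative ℤ
  flip_sq_comm : ∀ g, flip * flip * g = g * (flip * flip)
  weight_flip_sq : weight (flip * flip) ≠ 1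
  behind_mul_left : ∀ {g s w}, Behind (g * s) (g * w) ↔ Behind s w
  behind_flip_sq : ∀ {s w}, Behind (s * (flip * flip)) w ↔ Behind s w
  behind_self : ∀ s, Behind s s
  not_front : ∀ {s w}, Behind s w → ¬ Behind (s * flip) w
  between_of_separates : ∀ {s y z}, Behind s y → Behind (s * flip) z → Between y s z
  between_symm : ∀ {y s z}, Between y s z → Between z s y
  front_of_between : ∀ {s y p z}, Behind s y → Behind (s * flip) p → Between y p z →
    Behind (s * flip) z
  front_or_behind_shift : ∀ s w, Behind (s * flip) w ∨ Behind (s * shift) w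
  behind_of_front : ∀ {r s p p'}, Behind r p → Behind s r → Behind (s * flip) p →
    Behind (s * flip) p' → Behind r p'
  behind_selector : ∀ {i j}, i ≠ j → ∀ s w, Behind (s * selector i) w ∨ Behind (s * selector j) w
  finite_separating : ∀ g, {q : G ⧸ Subgroup.zpowers (flip * flip) |
    ∃ s : G, (s : G ⧸ Subgroup.zpowers (flip * flip)) = q ∧ Behind s 1 ∧
      Behind (s * flip) g}.Finite
  finite_crossing : ∀ k : ℕ, ∃ N : Set (G ⧸ Subgroup.zpowers (flip * flip)), N.Finite ∧
    ∀ s s' y z, Behind s y → Behind s' y → Behind (s * shift ^ k * flip) z →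
      Behind (s' * shift ^ k * flip) z →
      (Behind (s * shift ^ k * flip) s' ∧ Behind s' s) ∨
      (Behind (s' * shift ^ k * flip) s ∧ Behind s s') ∨
      ((s⁻¹ * s' : G) : G ⧸ Subgroup.zpowers (flip * flip)) ∈ N
  exists_not_behind : ∃ w, ¬ Behind 1 w ∧ ¬ Behind flip w

namespace BarrierSystem

variable {G : Type*} [Group G] (b : BarrierSystem G)

/-- The central cyclic subgroup generated by the square of the flip. -/
abbrev center : Subgroup G := Subgroup.zpowers (b.flip * b.flip)

/-- The class of an element modulo the central subgroup. -/
abbrev cls (s : G) : G ⧸ b.center := (s : G ⧸ b.center)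

/-- `w` lies in front of the wall of `s`. -/
def Front (s w : G) : Prop := b.Behind (s * b.flip) w

/-- The two walls are nested: everything lies in front of `s` or behind `s'`. -/
def Lt (s s' : G) : Prop := ∀ w, b.Front s w ∨ b.Behind s' w

variable {b}

lemma front_mul_left {g s w : G} : b.Front (g * s) (g * w) ↔ b.Front s w := by
  simp only [Front, mul_assoc, b.behind_mul_left]

lemma behind_zpow {s w : G} (i : ℤ) : b.Behind (s * (b.flip * b.flip) ^ i) w ↔ b.Behind s w := by
  induction i generalizing s with
  | zero => simp
  | succ i ih => rw [zpow_add_one, ← mul_assoc, b.behind_flip_sq, ih]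
  | pred i ih => rw [← b.behind_flip_sq, zpow_sub_one, mul_assoc, inv_mul_cancel_right, ih]

lemma flip_sq_zpow_comm (i : ℤ) (g : G) :
    (b.flip * b.flip) ^ i * g = g * (b.flip * b.flip) ^ i :=
  (Commute.zpow_left (b.flip_sq_comm g) i)

lemma cls_eq {s t : G} : b.cls s = b.cls t ↔ ∃ i : ℤ, t = s * (b.flip * b.flip) ^ i := by
  rw [QuotientGroup.eq, Subgroup.mem_zpowers_iff]
  constructor
  · rintro ⟨i, hi⟩; exact ⟨i, by rw [hi]; group⟩
  · rintro ⟨i, rfl⟩; exact ⟨i, by group⟩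

lemma behind_congr {s t w : G} (h : b.cls s = b.cls t) : b.Behind s w ↔ b.Behind t w := by
  obtain ⟨i, rfl⟩ := cls_eq.1 h
  rw [behind_zpow]

lemma cls_mul_right {s t : G} (h : b.cls s = b.cls t) (x : G) : b.cls (s * x) = b.cls (t * x) := by
  obtain ⟨i, rfl⟩ := cls_eq.1 h
  exact cls_eq.2 ⟨i, by rw [mul_assoc, flip_sq_zpow_comm, mul_assoc]⟩

lemma cls_mul_left {s t : G} (h : b.cls s = b.cls t) (x : G) : b.cls (x * s) = b.cls (x * t) := by
  obtain ⟨i, rfl⟩ := cls_eq.1 h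
  exact cls_eq.2 ⟨i, by rw [mul_assoc]⟩

lemma cls_inv {s t : G} (h : b.cls s = b.cls t) : b.cls s⁻¹ = b.cls t⁻¹ := by
  obtain ⟨i, rfl⟩ := cls_eq.1 h
  exact cls_eq.2 ⟨-i, by rw [mul_inv_rev, ← zpow_neg, flip_sq_zpow_comm]⟩

lemma front_congr {s t w : G} (h : b.cls s = b.cls t) : b.Front s w ↔ b.Front t w :=
  behind_congr (cls_mul_right h _)

lemma front_flip {s w : G} : b.Front (s * b.flip) w ↔ b.Behind s w := by
  simp only [Front, mul_assoc, b.behind_flip_sq]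

lemma not_front_self (s : G) : ¬ b.Front s s := b.not_front (b.behind_self s)

lemma behind_congr_right {s w w' : G} (h : b.cls w = b.cls w') :
    b.Behind s w ↔ b.Behind s w' := by
  obtain ⟨i, rfl⟩ := cls_eq.1 h
  have := b.behind_mul_left (g := (b.flip * b.flip) ^ i) (s := s) (w := w)
  rw [flip_sq_zpow_comm, flip_sq_zpow_comm, behind_zpow] at this
  exact this.symm

lemma Lt.front {s s' w : G} (h : b.Lt s s') (hw : b.Front s' w) : b.Front s w :=
  (h w).resolve_right fun h' => b.not_front h' hw

lemma Lt.behind {s s' w : G} (h : b.Lt s s') (hw : b.Behind s w) : b.Behind s' w :=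
  (h w).resolve_left fun h' => b.not_front hw h'

lemma Lt.trans {s s' s'' : G} (h : b.Lt s s') (h' : b.Lt s' s'') : b.Lt s s'' := fun w =>
  (h w).imp_right fun hw => h'.behind hw

lemma Lt.flip {s s' : G} (h : b.Lt s s') : b.Lt (s' * b.flip) (s * b.flip) := fun w => by
  rw [front_flip]; exact (h w).symm

lemma lt_mul_left {g s s' : G} : b.Lt (g * s) (g * s') ↔ b.Lt s s' := by
  constructor
  · intro h w
    simpa only [front_mul_left, b.behind_mul_left] using h (g * w)
  · intro h w
    have := h (g⁻¹ * w)
    rwa [← front_mul_left (g := g), ← b.behind_mul_left (g := g), mul_inv_cancel_left] at this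

lemma lt_congr {s s' t t' : G} (h : b.cls s = b.cls t) (h' : b.cls s' = b.cls t') :
    b.Lt s s' ↔ b.Lt t t' := by
  simp only [Lt, front_congr h, behind_congr h']

lemma lt_shift (s : G) : b.Lt s (s * b.shift) := b.front_or_behind_shift s

lemma lt_shift_pow (s : G) {i j : ℕ} (h : i < j) :
    b.Lt (s * b.shift ^ i) (s * b.shift ^ j) := by
  induction j, h using Nat.le_induction with
  | base => rw [pow_succ, ← mul_assoc]; exact lt_shift _
  | succ j _ ih => refine ih.trans ?_; rw [pow_succ, ← mul_assoc]; exact lt_shift _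

lemma not_lt_self (s : G) : ¬ b.Lt s s := by
  intro h
  obtain ⟨w, h1, h2⟩ := b.exists_not_behind
  rcases h (s * w) with h | h
  · exact h2 (by simpa [Front, b.behind_mul_left, mul_assoc] using h)
  · exact h1 (by rwa [← mul_one s, mul_assoc, b.behind_mul_left, one_mul] at h)

lemma Lt.cls_ne {s s' : G} (h : b.Lt s s') : b.cls s ≠ b.cls s' := fun h' =>
  not_lt_self s ((lt_congr rfl h'.symm).1 h)

/-! ### Chains of nested walls -/

variable (b) in
/-- The first `k` walls of `σ` are nested and separate `y` from `z`. -/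
def IsChain (k : ℕ) (σ : ℕ → G) (y z : G) : Prop :=
  (∀ i < k, b.Behind (σ i) y ∧ b.Front (σ i) z) ∧ ∀ i j, i < j → j < k → b.Lt (σ i) (σ j)

variable (b) in
/-- There are `k` nested walls separating `y` from `z`. -/
def Sep (k : ℕ) (y z : G) : Prop := ∃ σ, b.IsChain k σ y z

variable (b) in
/-- The maximal number of nested walls separating `y` from `z`. -/
noncomputable def dist (y z : G) : ℕ := sSup {k | b.Sep k y z}

lemma IsChain.reindex {k l : ℕ} {σ : ℕ → G} {y z : G} (h : b.IsChain k σ y z) (φ : ℕ → ℕ)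
    (hφ : ∀ i < l, φ i < k) (hm : ∀ i j, i < j → j < l → φ i < φ j) :
    b.IsChain l (fun i => σ (φ i)) y z :=
  ⟨fun i hi => h.1 _ (hφ i hi), fun i j hij hj => h.2 _ _ (hm i j hij hj) (hφ j hj)⟩

lemma IsChain.mono {k l : ℕ} {σ : ℕ → G} {y z : G} (h : b.IsChain k σ y z) (hl : l ≤ k) :
    b.IsChain l σ y z :=
  h.reindex id (fun _ hi => hi.trans_le hl) fun _ _ hij _ => hij

lemma IsChain.append {k l : ℕ} {σ τ : ℕ → G} {y z : G} (h : b.IsChain k σ y z)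
    (h' : b.IsChain l τ y z) (hlt : ∀ i < k, ∀ j < l, b.Lt (σ i) (τ j)) :
    b.IsChain (k + l) (fun i => if i < k then σ i else τ (i - k)) y z := by
  constructor
  · intro i hi
    by_cases hik : i < k
    · simpa [hik] using h.1 i hik
    · simpa [hik] using h'.1 (i - k) (by omega)
  · intro i j hij hj
    by_cases hik : i < k <;> by_cases hjk : j < k
    · simpa [hik, hjk] using h.2 i j hij hjk
    · simpa [hik, hjk] using hlt i hik (j - k) (by omega)
    · omega
    · simpa [hik, hjk] using h'.2 (i - k) (j - k) (by omega) (by omega)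

lemma IsChain.flip {k : ℕ} {σ : ℕ → G} {y z : G} (h : b.IsChain k σ y z) :
    b.IsChain k (fun i => σ (k - 1 - i) * b.flip) z y := by
  constructor
  · intro i hi
    have := h.1 (k - 1 - i) (by omega)
    exact ⟨this.2, front_flip.2 this.1⟩
  · intro i j hij hj
    exact (h.2 (k - 1 - j) (k - 1 - i) (by omega) (by omega)).flip

lemma IsChain.mul_left {k : ℕ} {σ : ℕ → G} {y z : G} (h : b.IsChain k σ y z) (g : G) :
    b.IsChain k (fun i => g * σ i) (g * y) (g * z) :=
  ⟨fun i hi => ⟨b.behind_mul_left.2 (h.1 i hi).1, front_mul_left.2 (h.1 i hi).2⟩,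
    fun i j hij hj => lt_mul_left.2 (h.2 i j hij hj)⟩

lemma IsChain.front_of_le {k : ℕ} {σ : ℕ → G} {y z w : G} (h : b.IsChain k σ y z) {i j : ℕ}
    (hij : i ≤ j) (hj : j < k) (hw : b.Front (σ j) w) : b.Front (σ i) w := by
  rcases hij.eq_or_lt with rfl | hij
  · exact hw
  · exact (h.2 i j hij hj).front hw

lemma IsChain.behind_of_le {k : ℕ} {σ : ℕ → G} {y z w : G} (h : b.IsChain k σ y z) {i j : ℕ}
    (hij : i ≤ j) (hj : j < k) (hw : b.Behind (σ i) w) : b.Behind (σ j) w := by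
  rcases hij.eq_or_lt with rfl | hij
  · exact hw
  · exact (h.2 i j hij hj).behind hw

lemma IsChain.cls_injOn {k : ℕ} {σ : ℕ → G} {y z : G} (h : b.IsChain k σ y z) {i j : ℕ}
    (hi : i < k) (hj : j < k) (he : b.cls (σ i) = b.cls (σ j)) : i = j := by
  rcases lt_trichotomy i j with hij | hij | hij
  · exact absurd he (h.2 i j hij hj).cls_ne
  · exact hij
  · exact absurd he.symm (h.2 j i hij hi).cls_ne

lemma Sep.symm {k : ℕ} {y z : G} (h : b.Sep k y z) : b.Sep k z y :=
  let ⟨_, h⟩ := h; ⟨_, h.flip⟩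

lemma Sep.mul_left {k : ℕ} {y z : G} (h : b.Sep k y z) (g : G) : b.Sep k (g * y) (g * z) :=
  let ⟨_, h⟩ := h; ⟨_, h.mul_left g⟩

lemma bddAbove_sep (y z : G) : BddAbove {k | b.Sep k y z} := by
  have hfin := b.finite_separating (y⁻¹ * z)
  refine ⟨hfin.toFinset.card, ?_⟩
  rintro k hk
  obtain ⟨σ, hσ⟩ : b.Sep k 1 (y⁻¹ * z) := by simpa using Sep.mul_left hk y⁻¹
  have : (Finset.range k).card ≤ hfin.toFinset.card := by
    refine Finset.card_le_card_of_injOn (fun i => b.cls (σ i)) ?_ ?_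
    · intro i hi
      have := hσ.1 i (by simpa using hi)
      simpa using ⟨σ i, rfl, this⟩
    · intro i hi j hj he
      exact hσ.cls_injOn (by simpa using hi) (by simpa using hj) he
  simpa using this

lemma sep_zero (y z : G) : b.Sep 0 y z := ⟨fun _ => 1, by simp [IsChain]⟩

lemma sep_dist (y z : G) : b.Sep (b.dist y z) y z :=
  Nat.sSup_mem ⟨0, sep_zero y z⟩ (bddAbove_sep y z)

lemma sep_iff {k : ℕ} {y z : G} : b.Sep k y z ↔ k ≤ b.dist y z :=
  ⟨fun h => le_csSup (bddAbove_sep y z) h, fun h =>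
    let ⟨σ, hσ⟩ := sep_dist (b := b) y z; ⟨σ, hσ.mono h⟩⟩

lemma IsChain.le_dist {k : ℕ} {σ : ℕ → G} {y z : G} (h : b.IsChain k σ y z) :
    k ≤ b.dist y z := sep_iff.1 ⟨σ, h⟩

lemma dist_comm (y z : G) : b.dist y z = b.dist z y :=
  le_antisymm (sep_iff.1 (sep_dist y z).symm) (sep_iff.1 (sep_dist z y).symm)

lemma dist_mul_left (g y z : G) : b.dist (g * y) (g * z) = b.dist y z := by
  refine le_antisymm (sep_iff.1 ?_) (sep_iff.1 ((sep_dist y z).mul_left g))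
  simpa using (sep_dist (b := b) (g * y) (g * z)).mul_left g⁻¹

lemma dist_congr_left {y y' : G} (h : b.cls y = b.cls y') (z : G) : b.dist y z = b.dist y' z := by
  simp only [dist, Sep, IsChain, behind_congr_right h]

lemma dist_triangle (y w z : G) : b.dist y z ≤ b.dist y w + b.dist w z + 1 := by
  classical
  obtain ⟨σ, hσ⟩ := sep_dist (b := b) y z
  set k := b.dist y z with hk
  have hex : ∃ a, a = k ∨ ¬ b.Front (σ a) w := ⟨k, Or.inl rfl⟩
  set a := Nat.find hex with ha
  have hak : a ≤ k := Nat.find_min' hex (Or.inl rfl)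
  have h1 : b.IsChain a σ y w := by
    refine ⟨fun i hi => ⟨(hσ.1 i (by omega)).1, ?_⟩, fun i j hij hj => hσ.2 i j hij (by omega)⟩
    have := Nat.find_min hex hi
    tauto
  rcases Nat.find_spec hex with h | h
  · have := h1.le_dist; omega
  · have h2 : b.IsChain (k - a - 1) (fun i => σ (a + 1 + i)) w z := by
      refine ⟨fun i hi => ⟨?_, (hσ.1 _ (by omega)).2⟩,
        fun i j hij hj => hσ.2 _ _ (by omega) (by omega)⟩
      exact (hσ.2 a (a + 1 + i) (by omega) (by omega) w).resolve_left h
    have := h1.le_dist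
    have := h2.le_dist
    omega

lemma front_shift_of_le {s w : G} {i k : ℕ} (h : i ≤ k) (hw : b.Front (s * b.shift ^ k) w) :
    b.Front (s * b.shift ^ i) w := by
  rcases h.eq_or_lt with rfl | h
  · exact hw
  · exact (lt_shift_pow s h).front hw

lemma front_of_front_shift {s w : G} {k : ℕ} (hw : b.Front (s * b.shift ^ k) w) :
    b.Front s w := by simpa using front_shift_of_le (Nat.zero_le k) hw

lemma behind_shift {s w : G} (k : ℕ) (hw : b.Behind s w) : b.Behind (s * b.shift ^ k) w := by
  rcases Nat.eq_zero_or_pos k with rfl | h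
  · simpa
  · simpa using (lt_shift_pow s h).behind (w := w) (by simpa using hw)

lemma IsChain.lt_shift {k : ℕ} {σ : ℕ → G} {y s : G} (h : b.IsChain k σ y s) (hs : b.Behind s y)
    {i : ℕ} (hi : i < k) {j : ℕ} (hj : 0 < j) : b.Lt (σ i) (s * b.shift ^ j) := by
  have key : b.Lt (σ i) (s * b.shift) := by
    intro w
    refine (b.front_or_behind_shift s w).imp_left fun hw => ?_
    exact b.front_of_between (h.1 i hi).1 (h.1 i hi).2 (b.between_of_separates hs hw)
  rcases (Nat.succ_le_of_lt hj).eq_or_lt with rfl | hj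
  · simpa using key
  · exact key.trans (by simpa using lt_shift_pow s hj)

lemma isChain_shift {k : ℕ} {s y z : G} (hs : b.Behind s y) (hz : b.Front (s * b.shift ^ k) z) :
    b.IsChain k (fun i => s * b.shift ^ (i + 1)) y z :=
  ⟨fun i hi => ⟨behind_shift _ hs, front_shift_of_le (by omega) hz⟩,
    fun i j hij _ => lt_shift_pow s (by omega)⟩

lemma dist_add_le {k : ℕ} {s y s' : G} (hs : b.Behind s y)
    (hs' : b.Front (s * b.shift ^ k) s') : b.dist y s + k ≤ b.dist y s' := by
  obtain ⟨σ, hσ⟩ := sep_dist (b := b) y s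
  have hf : b.Front s s' := front_of_front_shift hs'
  have hσ' : b.IsChain (b.dist y s) σ y s' :=
    ⟨fun i hi => ⟨(hσ.1 i hi).1, b.front_of_between (hσ.1 i hi).1 (hσ.1 i hi).2
      (b.between_of_separates hs hf)⟩, hσ.2⟩
  exact (hσ'.append (isChain_shift hs hs') fun i hi j _ => hσ.lt_shift hs hi (by omega)).le_dist

lemma dist_le_of_between {s s' g : G} (hs : b.Behind s' s) (hg : b.Front s' g) :
    b.dist s' g ≤ b.dist s g := by
  obtain ⟨σ, hσ⟩ := sep_dist (b := b) s' g
  refine IsChain.le_dist (σ := σ) ⟨fun i hi => ⟨?_, (hσ.1 i hi).2⟩, hσ.2⟩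
  have h1 : b.Behind (σ i * b.flip) g := (hσ.1 i hi).2
  have h2 : b.Front (σ i * b.flip) s' := front_flip.2 (hσ.1 i hi).1
  exact front_flip.1 (b.front_of_between h1 h2 (b.between_symm (b.between_of_separates hs hg)))

end BarrierSystem

section WordBall

variable {G : Type*} [Group G] {S : Set G}

lemma one_mem_wordBall (m : ℕ) : (1 : G) ∈ wordBall S m := ⟨[], by simp, by simp, rfl⟩

lemma wordBall_mono {m n : ℕ} (h : m ≤ n) : wordBall S m ⊆ wordBall S n :=
  fun _ ⟨l, hl, h1, h2⟩ => ⟨l, hl.trans h, h1, h2⟩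

lemma mul_mem_wordBall {m n : ℕ} {g h : G} (hg : g ∈ wordBall S m) (hh : h ∈ wordBall S n) :
    g * h ∈ wordBall S (m + n) := by
  obtain ⟨l, hl, h1, rfl⟩ := hg
  obtain ⟨l', hl', h1', rfl⟩ := hh
  refine ⟨l ++ l', by simp; omega, ?_, by simp⟩
  intro x hx
  rcases List.mem_append.1 hx with hx | hx
  exacts [h1 x hx, h1' x hx]

lemma inv_mem_wordBall {m : ℕ} {g : G} (hg : g ∈ wordBall S m) : g⁻¹ ∈ wordBall S m := by
  obtain ⟨l, hl, h1, rfl⟩ := hg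
  refine ⟨(l.map fun x => x⁻¹).reverse, by simpa using hl, ?_, by rw [List.prod_inv_reverse]⟩
  intro x hx
  simp only [List.mem_reverse, List.mem_map] at hx
  obtain ⟨y, hy, rfl⟩ := hx
  simpa using (h1 y hy).symm

lemma pow_mem_wordBall {m : ℕ} {g : G} (hg : g ∈ wordBall S m) (i : ℕ) :
    g ^ i ∈ wordBall S (i * m) := by
  induction i with
  | zero => simpa using one_mem_wordBall 0
  | succ i ih => rw [pow_succ, Nat.succ_mul]; exact mul_mem_wordBall ih hg

open scoped Pointwise in
lemma finite_wordBall (hS : S.Finite) (m : ℕ) : (wordBall S m).Finite := by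
  have hS' : (S ∪ S⁻¹).Finite := hS.union hS.inv
  induction m with
  | zero =>
    refine (finite_singleton (1 : G)).subset ?_
    rintro g ⟨l, hl, -, rfl⟩
    simp [List.length_eq_zero_iff.1 (Nat.le_zero.1 hl)]
  | succ m ih =>
    refine ((finite_singleton (1 : G)).union (hS'.mul ih)).subset ?_
    rintro g ⟨l, hl, h1, rfl⟩
    cases l with
    | nil => simp
    | cons s l =>
      refine Or.inr ⟨s, by simpa using h1 s (by simp), l.prod, ⟨l, by simpa using hl,
        fun x hx => h1 x (by simp [hx]), rfl⟩, by simp⟩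

lemma exists_mem_wordBall (hS : Subgroup.closure S = ⊤) (g : G) : ∃ m, g ∈ wordBall S m := by
  have hg : g ∈ Subgroup.closure S := hS ▸ Subgroup.mem_top g
  induction hg using Subgroup.closure_induction with
  | mem x hx => exact ⟨1, [x], by simp, by simpa using Or.inl hx, by simp⟩
  | one => exact ⟨0, one_mem_wordBall 0⟩
  | mul x y _ _ hx hy =>
    obtain ⟨m, hm⟩ := hx
    obtain ⟨n, hn⟩ := hy
    exact ⟨_, mul_mem_wordBall hm hn⟩
  | inv x _ hx => exact ⟨_, inv_mem_wordBall hx.choose_spec⟩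

lemma exists_forall_mem_wordBall (hS : Subgroup.closure S = ⊤) {ι : Type*} [Finite ι]
    (e : ι → G) : ∃ m, ∀ i, e i ∈ wordBall S m := by
  choose m hm using fun i => exists_mem_wordBall hS (e i)
  obtain ⟨M, hM⟩ := (Set.finite_range m).bddAbove
  exact ⟨M, fun i => wordBall_mono (hM ⟨i, rfl⟩) (hm i)⟩

open scoped Pointwise in
lemma ncard_wordBall_add_le (hS : S.Finite) (m n : ℕ) :
    (wordBall S (m + n)).ncard ≤ (wordBall S m).ncard * (wordBall S n).ncard := by
  have h1 := finite_wordBall hS m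
  have h2 := finite_wordBall hS n
  refine (ncard_le_ncard (t := wordBall S m * wordBall S n) ?_ (h1.mul h2)).trans ?_
  · rintro g ⟨l, hl, hmem, rfl⟩
    refine ⟨(l.take m).prod, ⟨_, by simp, fun x hx => hmem x (List.mem_of_mem_take hx), rfl⟩,
      (l.drop m).prod, ⟨_, by simp; omega, fun x hx => hmem x (List.mem_of_mem_drop hx), rfl⟩, ?_⟩
    simp [← List.prod_append]
  · simpa only [_root_.Nat.card_coe_set_eq] using Set.natCard_mul_le (s := wordBall S m) (t := wordBall S n)

lemma ncard_wordBall_pos (hS : S.Finite) (m : ℕ) : 0 < (wordBall S m).ncard :=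
  (ncard_pos (finite_wordBall hS m)).2 ⟨1, one_mem_wordBall m⟩

end WordBall

namespace BarrierSystem

variable {G : Type*} [Group G] {b : BarrierSystem G}

lemma exists_prefix_dist_le {C : ℕ} {r : G} (l : List G) (hC : ∀ s ∈ l, b.dist 1 s ≤ C)
    (p : G) (hp : b.Behind r p) (hg : b.Front r (p * l.prod)) :
    ∃ l₁ l₂, l = l₁ ++ l₂ ∧ b.dist r (p * l₁.prod) ≤ C + 1 := by
  induction l generalizing p with
  | nil => exact absurd (show b.Front r p by simpa using hg) (b.not_front hp)
  | cons s l ih =>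
    by_cases h1 : b.dist r p ≤ C + 1
    · exact ⟨[], s :: l, rfl, by simpa using h1⟩
    push Not at h1
    have hs : b.dist p (p * s) ≤ C := by
      have := b.dist_mul_left p 1 s
      rw [mul_one] at this
      rw [this]; exact hC s (by simp)
    have hp' : b.Behind r (p * s) := by
      obtain ⟨σ, hσ⟩ := sep_dist (b := b) r p
      have h0 := hσ.1 0 (by omega)
      refine b.behind_of_front hp h0.1 h0.2 ?_
      by_contra hne
      have : b.IsChain (b.dist r p - 1) (fun i => σ (i + 1)) (p * s) p :=
        ⟨fun i hi => ⟨(hσ.2 0 (i + 1) (by omega) (by omega) _).resolve_left hne,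
          (hσ.1 (i + 1) (by omega)).2⟩, fun i j hij hj => hσ.2 _ _ (by omega) (by omega)⟩
      have := this.le_dist
      rw [dist_comm r p] at h1
      rw [dist_comm (p * s) p, dist_comm r p] at this
      omega
    obtain ⟨l₁, l₂, rfl, hl⟩ := ih (fun x hx => hC x (by simp [hx])) (p * s) hp'
      (by simpa [mul_assoc] using hg)
    exact ⟨s :: l₁, l₂, rfl, by simpa [mul_assoc] using hl⟩

lemma exists_generator_dist_le {S : Set G} (hS : S.Finite) (b : BarrierSystem G) :
    ∃ C, ∀ s, (s ∈ S ∨ s⁻¹ ∈ S) → b.dist 1 s ≤ C := by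
  obtain ⟨C, hC⟩ := ((hS.union hS.inv).image (b.dist 1)).bddAbove
  exact ⟨C, fun s hs => hC ⟨s, by simpa using hs, rfl⟩⟩

lemma exists_forall_le {ι : Type*} [Finite ι] (f : ι → ℕ) : ∃ C, ∀ i, f i ≤ C := by
  obtain ⟨C, hC⟩ := (Set.finite_range f).bddAbove
  exact ⟨C, fun i => hC ⟨i, rfl⟩⟩

variable (b) in
/-- The element inserted into a product to create a prescribed separating wall. -/
def spacer (k : ℕ) (i j : Fin 3) : G := b.selector i * b.shift ^ k * b.flip * (b.selector j)⁻¹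

lemma exists_insertion (b : BarrierSystem G) (k : ℕ) (p q y z : G) : ∃ i j : Fin 3,
    b.Behind (p * b.selector i) y ∧ b.Behind (p * b.selector i) z ∧
    b.Front (p * b.selector i * b.shift ^ k) (p * b.spacer k i j * q) := by
  have h1 : ∃ i, b.Behind (p * b.selector i) y ∧ b.Behind (p * b.selector i) z := by
    have hy := fun i j (h : i ≠ j) => b.behind_selector h p y
    have hz := fun i j (h : i ≠ j) => b.behind_selector h p z
    have y01 := hy 0 1 (by decide)
    have y02 := hy 0 2 (by decide)
    have y12 := hy 1 2 (by decide)
    have z01 := hz 0 1 (by decide)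
    have z02 := hz 0 2 (by decide)
    have z12 := hz 1 2 (by decide)
    by_contra h
    push Not at h
    have h0 := h 0
    have h1 := h 1
    have h2 := h 2
    tauto
  obtain ⟨i, hi⟩ := h1
  obtain ⟨j, hj⟩ : ∃ j, b.Behind (b.selector j) q := by
    rcases b.behind_selector (show (0 : Fin 3) ≠ 1 by decide) 1 q with h | h
    exacts [⟨0, by simpa using h⟩, ⟨1, by simpa using h⟩]
  refine ⟨i, j, hi.1, hi.2, ?_⟩
  have : b.Behind (p * b.selector i * b.shift ^ k * b.flip * (b.selector j)⁻¹ * b.selector j)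
      (p * b.selector i * b.shift ^ k * b.flip * (b.selector j)⁻¹ * q) :=
    b.behind_mul_left.2 hj
  simpa [Front, spacer, mul_assoc] using this

lemma conj_eq_of_cls_eq {s t : G} (h : b.cls s = b.cls t) (d : G) :
    s * d * s⁻¹ = t * d * t⁻¹ := by
  obtain ⟨n, rfl⟩ := cls_eq.1 h
  have := flip_sq_zpow_comm (b := b) n d
  rw [mul_assoc s _ d, this]
  group

lemma card_mul_le {E T : Set G} (hE : E.Finite) (hT : T.Finite) {N : Set (G ⧸ b.center)}
    (hN : N.Finite) (J M : ℕ) (d : Fin 3 → Fin 3 → G)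
    (R : G → ℕ → G → Fin 3 → G → ℕ → Prop)
    (hex : ∀ g ∈ E, ∀ j < J, ∃ s i l, ∃ g' ∈ T, ∃ c < M,
      g = s * d i l * s⁻¹ * g' ∧ R g j s i g' c)
    (h1 : ∀ g₁ j₁ s₁ i₁ g₂ j₂ s₂ i₂ g' c, R g₁ j₁ s₁ i₁ g' c → R g₂ j₂ s₂ i₂ g' c →
      b.cls (s₁⁻¹ * s₂) ∈ N)
    (h2 : ∀ g j₁ s₁ i g₁' c₁ j₂ s₂ g₂' c₂, R g j₁ s₁ i g₁' c₁ → R g j₂ s₂ i g₂' c₂ →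
      b.cls s₁ = b.cls s₂ → j₁ = j₂) :
    E.ncard * J ≤ T.ncard * M * 9 * N.ncard := by
  classical
  have hex' : ∀ g j, ∃ s i l g' c, g ∈ E → j < J → g' ∈ T ∧ c < M ∧
      g = s * d i l * s⁻¹ * g' ∧ R g j s i g' c := by
    intro g j
    by_cases hg : g ∈ E ∧ j < J
    · obtain ⟨s, i, l, g', h1, c, h2, h3, h4⟩ := hex g hg.1 j hg.2
      exact ⟨s, i, l, g', c, fun _ _ => ⟨h1, h2, h3, h4⟩⟩
    · exact ⟨1, 0, 0, 1, 0, fun h h' => absurd ⟨h, h'⟩ hg⟩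
  choose s i l g' c h using hex'
  have href : ∀ key : G × ℕ, ∃ r : G, ∀ g ∈ E, ∀ j < J, (g' g j, c g j) = key →
      b.cls (r⁻¹ * s g j) ∈ N := by
    intro key
    by_cases hk : ∃ g ∈ E, ∃ j < J, (g' g j, c g j) = key
    · obtain ⟨g, hg, j, hj, rfl⟩ := hk
      refine ⟨s g j, fun g₂ hg₂ j₂ hj₂ he => ?_⟩
      simp only [Prod.mk.injEq] at he
      have ha := (h g j hg hj).2.2.2
      have hb := (h g₂ j₂ hg₂ hj₂).2.2.2
      rw [he.1, he.2] at hb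
      exact h1 _ _ _ _ _ _ _ _ _ _ ha hb
    · exact ⟨1, fun g hg j hj he => absurd ⟨g, hg, j, hj, he⟩ hk⟩
  choose r hr using href
  set Φ : G × ℕ → ((G × ℕ) × (Fin 3 × Fin 3)) × (G ⧸ b.center) := fun x =>
    (((g' x.1 x.2, c x.1 x.2), (i x.1 x.2, l x.1 x.2)),
      b.cls ((r (g' x.1 x.2, c x.1 x.2))⁻¹ * s x.1 x.2)) with hΦ
  have key := Finset.card_le_card_of_injOn (s := hE.toFinset ×ˢ Finset.range J)
    (t := ((hT.toFinset ×ˢ Finset.range M) ×ˢ (Finset.univ : Finset (Fin 3 × Fin 3))) ×ˢ hN.toFinset)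
    Φ ?_ ?_
  · simpa [Finset.card_product, ← ncard_eq_toFinset_card E hE, ← ncard_eq_toFinset_card T hT,
      ← ncard_eq_toFinset_card N hN] using key
  · rintro ⟨g, j⟩ hx
    simp only [Finset.coe_product, Set.mem_prod, Finset.mem_coe, Set.Finite.mem_toFinset,
      Finset.mem_range] at hx
    have := h g j hx.1 hx.2
    simp only [hΦ, Finset.coe_product, Set.mem_prod, Finset.mem_coe, Set.Finite.mem_toFinset,
      Finset.mem_range, Finset.mem_univ, and_true]
    exact ⟨⟨this.1, this.2.1⟩, hr _ g hx.1 j hx.2 rfl⟩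
  · rintro ⟨g₁, j₁⟩ hx ⟨g₂, j₂⟩ hy he
    simp only [Finset.coe_product, Set.mem_prod, Finset.mem_coe, Set.Finite.mem_toFinset,
      Finset.mem_range] at hx hy
    have hx' := (h g₁ j₁ hx.1 hx.2).2.2
    have hy' := (h g₂ j₂ hy.1 hy.2).2.2
    simp only [hΦ, Prod.mk.injEq] at he
    obtain ⟨⟨⟨e1, e2⟩, e3, e4⟩, e5⟩ := he
    rw [e1, e2] at e5
    have e6 : b.cls (s g₁ j₁) = b.cls (s g₂ j₂) := by
      simpa using cls_mul_left e5 (r (g' g₂ j₂, c g₂ j₂))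
    have e7 : g₁ = g₂ := by
      rw [hx'.1, hy'.1, e1, e3, e4, conj_eq_of_cls_eq e6]
    subst e7
    have e8 : j₁ = j₂ := by
      rw [e3] at hx'
      exact h2 _ _ _ _ _ _ _ _ _ _ hx'.2 hy'.2 e6
    rw [e8]

end BarrierSystem

lemma exists_notMem_of_injOn {α ι : Type*} {N : Set α} (hN : N.Finite) (I : Finset ι) (f : ι → α)
    (hf : Set.InjOn f I) (hc : N.ncard < I.card) : ∃ t ∈ I, f t ∉ N := by
  by_contra h
  push Not at h
  have := Finset.card_le_card_of_injOn (s := I) (t := hN.toFinset) f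
    (fun t ht => by simpa using h t ht) hf
  rw [← ncard_eq_toFinset_card N hN] at this
  omega

lemma mul_mul_mem_wordBall {G : Type*} [Group G] {S : Set G} {l₁ l₂ : List G} {m c : ℕ}
    (hl : (l₁ ++ l₂).length ≤ m) (hS : ∀ x ∈ l₁ ++ l₂, x ∈ S ∨ x⁻¹ ∈ S) {e : G}
    (he : e ∈ wordBall S c) : l₁.prod * e * l₂.prod ∈ wordBall S (m + c) := by
  have h1 : l₁.prod ∈ wordBall S l₁.length := ⟨l₁, le_rfl, fun x hx => hS x (by simp [hx]), rfl⟩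
  have h2 : l₂.prod ∈ wordBall S l₂.length := ⟨l₂, le_rfl, fun x hx => hS x (by simp [hx]), rfl⟩
  refine wordBall_mono ?_ (mul_mem_wordBall (mul_mem_wordBall h1 he) h2)
  simp only [List.length_append] at hl
  omega

namespace BarrierSystem

variable {G : Type*} [Group G] {b : BarrierSystem G}

lemma exists_chain_gap (b : BarrierSystem G) : ∃ κ, ∀ k σ y z, b.IsChain k σ y z →
    ∀ i j, i + κ ≤ j → j < k → b.Front (σ i) (σ j) ∧ b.Behind (σ j) (σ i) := by
  obtain ⟨N, hN, h⟩ := b.finite_crossing 0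
  simp only [pow_zero, mul_one] at h
  refine ⟨N.ncard + 1, fun k σ y z hσ i j hij hj => ?_⟩
  have key : ∀ s t, s < t → t < k → b.cls ((σ s)⁻¹ * σ t) ∉ N →
      b.Front (σ s) (σ t) ∧ b.Behind (σ t) (σ s) := by
    intro s t hst ht hn
    have hs := hσ.1 s (by omega)
    have ht' := hσ.1 t ht
    rcases h (σ s) (σ t) y z hs.1 ht'.1 hs.2 ht'.2 with h | h | h
    · exact h
    · exact absurd ((hσ.2 s t hst ht).front h.1) (not_front_self _)
    · exact absurd h hn
  obtain ⟨t, ht, htN⟩ := exists_notMem_of_injOn hN (Finset.Ioc i j)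
    (fun t => b.cls ((σ i)⁻¹ * σ t)) (by
      intro s hs t ht he
      simp only [Finset.coe_Ioc, Set.mem_Ioc] at hs ht
      refine hσ.cls_injOn (by omega) (by omega) ?_
      simpa using cls_mul_left he (σ i)) (by simp; omega)
  obtain ⟨s, hs, hsN⟩ := exists_notMem_of_injOn hN (Finset.Ico i j)
    (fun s => b.cls ((σ s)⁻¹ * σ j)) (by
      intro s hs t ht he
      simp only [Finset.coe_Ico, Set.mem_Ico] at hs ht
      refine hσ.cls_injOn (by omega) (by omega) ?_
      have := cls_inv (cls_mul_right he (σ j)⁻¹)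
      simpa using this) (by simp; omega)
  simp only [Finset.mem_Ioc, Finset.mem_Ico] at ht hs
  exact ⟨hσ.front_of_le hs.1 (by omega) (key s j hs.2 hj hsN).1,
    hσ.behind_of_le ht.2 hj (key i t ht.1 (by omega) htN).2⟩

lemma IsChain.le_dist_of_gap {κ : ℕ} {k : ℕ} {σ : ℕ → G} {y z : G} (hσ : b.IsChain k σ y z)
    (hκ : ∀ i j, i + κ ≤ j → j < k → b.Front (σ i) (σ j) ∧ b.Behind (σ j) (σ i))
    {i j : ℕ} (hj : j < k) : j ≤ i + b.dist (σ i) (σ j) + 2 * κ := by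
  by_contra hlt
  push Not at hlt
  have : b.IsChain (j - i - 2 * κ) (fun t => σ (i + κ + t)) (σ i) (σ j) :=
    ⟨fun t ht => ⟨(hκ i _ (by omega) (by omega)).2, (hκ _ j (by omega) hj).1⟩,
      fun s t hst ht => hσ.2 _ _ (by omega) (by omega)⟩
  have := this.le_dist
  omega

lemma IsChain.eq_of_dist_le {κ c M : ℕ} {k : ℕ} {σ : ℕ → G} {y z : G} (hσ : b.IsChain k σ y z)
    (hκ : ∀ i j, i + κ ≤ j → j < k → b.Front (σ i) (σ j) ∧ b.Behind (σ j) (σ i))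
    (hM : 2 * c + 1 + 2 * κ < M) {a i j : ℕ} {s : G} (hi : a + M * i < k) (hj : a + M * j < k)
    (h1 : b.dist s (σ (a + M * i)) ≤ c) (h2 : b.dist s (σ (a + M * j)) ≤ c) : i = j := by
  wlog hij : i < j generalizing i j
  · rcases (not_lt.1 hij).eq_or_lt with h | h
    · exact h.symm
    · exact (this hj hi h2 h1 h).symm
  have h3 := hσ.le_dist_of_gap hκ hj (i := a + M * i)
  have h4 := b.dist_triangle (σ (a + M * i)) s (σ (a + M * j))
  rw [dist_comm _ s] at h4
  have : M * (i + 1) ≤ M * j := Nat.mul_le_mul_left _ hij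
  rw [Nat.mul_succ] at this
  omega

lemma dist_mul_right_le (b : BarrierSystem G) (p x r : G) :
    b.dist (p * x) r ≤ b.dist r p + b.dist 1 x + 1 := by
  have h1 := b.dist_triangle r p (p * x)
  have h2 := b.dist_mul_left p 1 x
  rw [mul_one] at h2
  rw [dist_comm, ← h2]
  exact h1

lemma front_of_near {c k : ℕ} (hk : c < k) {s₁ s₂ σ : G} (h : b.Front (s₁ * b.shift ^ k) s₂)
    (hσ : b.dist s₂ σ ≤ c) : b.Front s₁ σ := by
  by_contra hn
  have : b.IsChain k (fun i => s₁ * b.shift ^ (i + 1)) σ s₂ := by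
    refine ⟨fun i hi => ⟨?_, front_shift_of_le (by omega) h⟩,
      fun i j hij _ => lt_shift_pow s₁ (by omega)⟩
    have := lt_shift_pow (b := b) s₁ (show 0 < i + 1 by omega) σ
    rw [pow_zero, mul_one] at this
    exact this.resolve_left hn
  have := this.le_dist
  rw [dist_comm] at this
  omega

lemma cls_mem_of_near {c k : ℕ} (hk : c < k) {N : Set (G ⧸ b.center)}
    (hN : ∀ s s' y z, b.Behind s y → b.Behind s' y → b.Behind (s * b.shift ^ k * b.flip) z →
      b.Behind (s' * b.shift ^ k * b.flip) z →
      (b.Behind (s * b.shift ^ k * b.flip) s' ∧ b.Behind s' s) ∨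
      (b.Behind (s' * b.shift ^ k * b.flip) s ∧ b.Behind s s') ∨
      ((s⁻¹ * s' : G) : G ⧸ b.center) ∈ N)
    {s₁ s₂ σ₁ σ₂ h z : G}
    (h11 : b.Behind s₁ 1) (h12 : b.Behind s₁ h) (h13 : b.Front (s₁ * b.shift ^ k) z)
    (h14 : b.dist s₁ σ₁ ≤ c) (h15 : b.Behind σ₁ 1) (h16 : b.Front σ₁ h)
    (h21 : b.Behind s₂ 1) (h22 : b.Behind s₂ h) (h23 : b.Front (s₂ * b.shift ^ k) z)
    (h24 : b.dist s₂ σ₂ ≤ c) (h25 : b.Behind σ₂ 1) (h26 : b.Front σ₂ h) :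
    b.cls (s₁⁻¹ * s₂) ∈ N := by
  rcases hN s₁ s₂ 1 z h11 h21 h13 h23 with h' | h' | h'
  · exact absurd (b.front_of_between h11 (front_of_near hk h'.1 h24)
      (b.between_of_separates h25 h26)) (b.not_front h12)
  · exact absurd (b.front_of_between h21 (front_of_near hk h'.1 h14)
      (b.between_of_separates h15 h16)) (b.not_front h22)
  · exact h'

lemma card_front_mul_le {S : Set G} (hS : S.Finite) (hgen : Subgroup.closure S = ⊤)
    (b : BarrierSystem G) : ∃ C M, 0 < M ∧ ∀ L ρ h, b.IsChain (L + 1) ρ 1 h → ∀ m,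
      {g | g ∈ wordBall S m ∧ b.Front (ρ L) g}.ncard * (L / M) ≤ C * (wordBall S m).ncard := by
  obtain ⟨CS, hCS⟩ := exists_generator_dist_le hS b
  obtain ⟨Cu, hCu⟩ := exists_forall_le fun i => b.dist 1 (b.selector i)
  obtain ⟨κ, hκ⟩ := exists_chain_gap b
  set c' := CS + Cu + 2 with hc'
  set k := c' + 1 with hk
  obtain ⟨c, hc⟩ := exists_forall_mem_wordBall hgen fun x : Fin 3 × Fin 3 => b.spacer k x.1 x.2
  obtain ⟨N, hN, hcross⟩ := b.finite_crossing k
  refine ⟨(wordBall S c).ncard * 9 * N.ncard, 2 * c' + 2 * κ + 2, by omega, ?_⟩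
  intro L ρ h hρ m
  set M := 2 * c' + 2 * κ + 2 with hM
  have hML : ∀ j < L / M, M * j < L + 1 := by
    intro j hj
    have := Nat.mul_div_le L M
    have := Nat.mul_le_mul_left M hj.le
    omega
  have key := card_mul_le (b := b) (E := {g | g ∈ wordBall S m ∧ b.Front (ρ L) g})
    (T := wordBall S (m + c)) ((finite_wordBall hS m).subset fun g hg => hg.1)
    (finite_wordBall hS _) hN (L / M) 1
    (fun i l => (b.selector i)⁻¹ * b.selector l * b.flip⁻¹ * (b.shift ^ k)⁻¹)
    (fun g j s i g' c => b.Behind s 1 ∧ b.Front (s * b.shift ^ k) g' ∧ b.Behind s h ∧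
      M * j < L + 1 ∧ b.dist s (ρ (0 + M * j)) ≤ c') ?_ ?_ ?_
  · refine key.trans ?_
    have := ncard_wordBall_add_le hS m c
    calc _ ≤ ((wordBall S m).ncard * (wordBall S c).ncard) * 1 * 9 * N.ncard := by gcongr
      _ = _ := by ring
  · rintro g ⟨⟨w, hw, hwS, rfl⟩, hg⟩ j hj
    have hj' := hML j hj
    have hr := hρ.1 (M * j) hj'
    obtain ⟨l₁, l₂, rfl, hl⟩ := exists_prefix_dist_le (b := b) w (fun s hs => hCS s (hwS s hs)) 1
      hr.1 (by simpa using hρ.front_of_le (by omega) (by omega) hg)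
    rw [one_mul] at hl
    obtain ⟨i, l, h1, h2, h3⟩ := b.exists_insertion k l₁.prod l₂.prod 1 h
    refine ⟨l₁.prod * b.selector i, i, l, _, mul_mul_mem_wordBall hw hwS (hc (i, l)), 0, by omega,
      ?_, h1, h3, h2, hj', ?_⟩
    · simp only [spacer, List.prod_append]; group
    · have h4 := b.dist_mul_right_le l₁.prod (b.selector i) (ρ (0 + M * j))
      have h6 := hCu i
      rw [zero_add] at h4 ⊢
      omega
  · rintro g₁ j₁ s₁ i₁ g₂ j₂ s₂ i₂ g' c ⟨h11, h12, h13, h14, h15⟩ ⟨h21, h22, h23, h24, h25⟩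
    rw [zero_add] at h15 h25
    have h1 := hρ.1 _ h14
    have h2 := hρ.1 _ h24
    exact cls_mem_of_near (by omega) hcross h11 h13 h12 h15 h1.1 h1.2 h21 h23 h22 h25 h2.1 h2.2
  · rintro g j₁ s₁ i g₁' c₁ j₂ s₂ g₂' c₂ ⟨h11, h12, h13, h14, h15⟩ ⟨h21, h22, h23, h24, h25⟩ he
    rw [dist_congr_left he] at h15
    exact hρ.eq_of_dist_le (hκ _ _ _ _ hρ) (by omega) (by omega) (by omega) h15 h25

end BarrierSystem

namespace BarrierSystem

variable {G : Type*} [Group G] {b : BarrierSystem G}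

variable (b) in
/-- Word length modulo the central subgroup. -/
noncomputable def clsLength (S : Set G) (p : G) : ℕ :=
  sInf {k | ∃ t ∈ wordBall S k, b.cls t = b.cls p}

lemma clsLength_congr {S : Set G} {p q : G} (h : b.cls p = b.cls q) :
    b.clsLength S p = b.clsLength S q := by
  simp only [clsLength, h]

lemma clsLength_le {S : Set G} {k : ℕ} {p t : G} (ht : t ∈ wordBall S k) (h : b.cls t = b.cls p) :
    b.clsLength S p ≤ k := Nat.sInf_le ⟨t, ht, h⟩

lemma exists_mem_wordBall_clsLength {S : Set G} (hgen : Subgroup.closure S = ⊤) (p : G) :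
    ∃ t ∈ wordBall S (b.clsLength S p), b.cls t = b.cls p :=
  Nat.sInf_mem (s := {k | ∃ t ∈ wordBall S k, b.cls t = b.cls p})
    (let ⟨m, hm⟩ := exists_mem_wordBall hgen p; ⟨m, p, hm, rfl⟩)

lemma clsLength_mul_le {S : Set G} (hgen : Subgroup.closure S = ⊤) {p s : G}
    (hs : s ∈ S ∨ s⁻¹ ∈ S) : b.clsLength S (p * s) ≤ b.clsLength S p + 1 := by
  obtain ⟨t, ht, he⟩ := exists_mem_wordBall_clsLength (b := b) hgen p
  exact clsLength_le (mul_mem_wordBall ht ⟨[s], by simp, by simpa using hs, by simp⟩)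
    (cls_mul_right he s)

lemma exists_prefix_clsLength_eq {S : Set G} (hgen : Subgroup.closure S = ⊤) (w : List G)
    (hw : ∀ x ∈ w, x ∈ S ∨ x⁻¹ ∈ S) {j : ℕ} (hj : j ≤ b.clsLength S w.prod) :
    ∃ l₁ l₂, w = l₁ ++ l₂ ∧ b.clsLength S l₁.prod = j := by
  classical
  have hex : ∃ i, j ≤ b.clsLength S (w.take i).prod := ⟨w.length, by simpa⟩
  refine ⟨w.take (Nat.find hex), w.drop (Nat.find hex), by simp, ?_⟩
  refine le_antisymm ?_ (Nat.find_spec hex)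
  rcases hi : Nat.find hex with _ | i
  · have : b.clsLength S 1 ≤ 0 := clsLength_le (one_mem_wordBall 0) rfl
    simp only [List.take_zero, List.prod_nil]
    omega
  · have h1 := Nat.find_min hex (show i < Nat.find hex by omega)
    by_cases hiw : i < w.length
    · rw [List.take_add_one, List.getElem?_eq_getElem hiw]
      have := clsLength_mul_le (b := b) hgen (p := (w.take i).prod)
        (hw w[i] (List.getElem_mem hiw))
      simp only [Option.toList_some, List.prod_append, List.prod_singleton]
      omega
    · rw [List.take_of_length_le (by omega)] at h1
      omega

lemma card_dist_le_mul_le {S : Set G} (hS : S.Finite) (hgen : Subgroup.closure S = ⊤)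
    (b : BarrierSystem G) (r : ℕ) : ∃ C, ∀ K m,
      {g | g ∈ wordBall S m ∧ b.dist 1 g ≤ r ∧ K ≤ b.clsLength S g}.ncard * K ≤
        C * (wordBall S m).ncard := by
  obtain ⟨Cu, hCu⟩ := exists_forall_le fun i => b.dist 1 (b.selector i)
  obtain ⟨Ce, hCe⟩ := exists_forall_le fun x : Fin 3 × Fin 3 => b.dist 1 (b.spacer 1 x.1 x.2)
  obtain ⟨c, hc⟩ := exists_forall_mem_wordBall hgen fun x : Fin 3 × Fin 3 => b.spacer 1 x.1 x.2
  obtain ⟨N, hN, hcross⟩ := b.finite_crossing 1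
  set X := r + 2 * Cu + Ce + 10 with hX
  refine ⟨(wordBall S c).ncard * (2 * X + 1) * 9 * N.ncard, fun K m => ?_⟩
  have key := card_mul_le (b := b)
    (E := {g | g ∈ wordBall S m ∧ b.dist 1 g ≤ r ∧ K ≤ b.clsLength S g})
    (T := wordBall S (m + c)) ((finite_wordBall hS m).subset fun g hg => hg.1)
    (finite_wordBall hS _) hN K (2 * X + 1)
    (fun i l => (b.selector i)⁻¹ * b.selector l * b.flip⁻¹ * (b.shift ^ 1)⁻¹)
    (fun g j s i g' c => b.Behind s 1 ∧ b.Front (s * b.shift ^ 1) g' ∧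
      c + b.dist s g' = b.dist 1 s + X ∧ b.clsLength S (s * (b.selector i)⁻¹) = j) ?_ ?_ ?_
  · refine key.trans ?_
    have := ncard_wordBall_add_le hS m c
    calc _ ≤ ((wordBall S m).ncard * (wordBall S c).ncard) * (2 * X + 1) * 9 * N.ncard := by gcongr
      _ = _ := by ring
  · rintro g ⟨⟨w, hw, hwS, rfl⟩, hg, hK⟩ j hj
    obtain ⟨l₁, l₂, rfl, hl⟩ := exists_prefix_clsLength_eq (b := b) hgen w hwS (hj.le.trans hK)
    obtain ⟨i, l, h1, -, h3⟩ := b.exists_insertion 1 l₁.prod l₂.prod 1 1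
    rw [List.prod_append] at hg
    have hu := hCu i
    have he := hCe (i, l)
    simp only at he
    set p := l₁.prod with hp
    set q := l₂.prod with hq
    set e := b.spacer 1 i l with he'
    have d1 : b.dist p (p * b.selector i) = b.dist 1 (b.selector i) := by
      simpa using b.dist_mul_left p 1 (b.selector i)
    have d2 : b.dist p (p * q) = b.dist 1 q := by simpa using b.dist_mul_left p 1 q
    have d3 : b.dist p (p * e * q) = b.dist 1 (e * q) := by
      simpa [mul_assoc] using b.dist_mul_left p 1 (e * q)
    have d4 : b.dist e (e * q) = b.dist 1 q := by simpa using b.dist_mul_left e 1 q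
    have t1 := b.dist_triangle (p * b.selector i) p (p * e * q)
    have t2 := b.dist_triangle 1 e (e * q)
    have t3 := b.dist_triangle p 1 (p * q)
    have t4 := b.dist_triangle 1 (p * b.selector i) p
    have t5 := b.dist_triangle 1 p (p * b.selector i)
    have t6 := b.dist_triangle 1 (p * q) p
    have t7 := b.dist_triangle e 1 (e * q)
    have t8 := b.dist_triangle p (p * b.selector i) (p * e * q)
    rw [dist_comm (p * q) p] at t6
    rw [dist_comm e 1] at t7
    rw [dist_comm p 1] at t3
    rw [dist_comm (p * b.selector i) p] at t1 t4
    have hmem : p * e * q ∈ wordBall S (m + c) := mul_mul_mem_wordBall hw hwS (hc (i, l))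
    refine ⟨p * b.selector i, i, l, p * e * q, hmem,
      b.dist 1 (p * b.selector i) + X - b.dist (p * b.selector i) (p * e * q), by omega,
      ?_, h1, h3, by omega, by simpa using hl⟩
    rw [List.prod_append, ← hp, ← hq, he', spacer]; group
  · rintro g₁ j₁ s₁ i₁ g₂ j₂ s₂ i₂ g' c ⟨h11, h12, h13, h14⟩ ⟨h21, h22, h23, h24⟩
    rcases hcross s₁ s₂ 1 g' h11 h21 h12 h22 with h | h | h
    · have h3 := dist_add_le h11 h.1
      have h4 := dist_le_of_between h.2 (front_of_front_shift h22)
      omega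
    · have h3 := dist_add_le h21 h.1
      have h4 := dist_le_of_between h.2 (front_of_front_shift h12)
      omega
    · exact h
  · rintro g j₁ s₁ i g₁' c₁ j₂ s₂ g₂' c₂ ⟨h11, h12, h13, h14⟩ ⟨h21, h22, h23, h24⟩ he
    rw [← h14, ← h24]
    exact clsLength_congr (cls_mul_right he _)

end BarrierSystem

/-- The set `A` has density zero with respect to the balls of the word metric of `S`. -/
def Negligible {G : Type*} [Group G] (S A : Set G) : Prop :=
  ∀ ε : ℝ, 0 < ε → ∀ᶠ m in atTop,
    ({g | g ∈ wordBall S m ∧ g ∈ A}.ncard : ℝ) ≤ ε * (wordBall S m).ncard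

namespace BarrierSystem

variable {G : Type*} [Group G] {b : BarrierSystem G}

lemma weight_natAbs_le {S : Set G} (hS : S.Finite) (b : BarrierSystem G) :
    ∃ C, ∀ m, ∀ g ∈ wordBall S m, (b.weight g).toAdd.natAbs ≤ C * m := by
  obtain ⟨C, hC⟩ := (hS.image fun s => (b.weight s).toAdd.natAbs).bddAbove
  refine ⟨C, ?_⟩
  rintro m _ ⟨l, hl, hmem, rfl⟩
  refine le_trans ?_ (Nat.mul_le_mul_left C hl)
  clear hl
  induction l with
  | nil => simp
  | cons s l ih =>
    have h1 : (b.weight s).toAdd.natAbs ≤ C := by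
      rcases hmem s (by simp) with h | h
      · exact hC ⟨s, h, rfl⟩
      · simpa using hC ⟨s⁻¹, h, rfl⟩
    have h2 := ih fun x hx => hmem x (by simp [hx])
    rw [List.prod_cons, map_mul, toAdd_mul, List.length_cons, Nat.mul_succ]
    have := Int.natAbs_add_le (b.weight s).toAdd (b.weight l.prod).toAdd
    omega

lemma weight_flip_sq_zpow (i : ℤ) : i.natAbs ≤ (b.weight ((b.flip * b.flip) ^ i)).toAdd.natAbs := by
  have h : (b.weight (b.flip * b.flip)).toAdd ≠ 0 := fun h => b.weight_flip_sq (by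
    rw [← ofAdd_toAdd (b.weight _), h, ofAdd_zero])
  rw [map_zpow, toAdd_zpow, smul_eq_mul, Int.natAbs_mul]
  exact Nat.le_mul_of_pos_right _ (Int.natAbs_pos.2 h)

lemma card_clsLength_lt_le {S : Set G} (hS : S.Finite) (hgen : Subgroup.closure S = ⊤)
    (b : BarrierSystem G) : ∃ C, ∀ K m,
      {g | g ∈ wordBall S m ∧ b.clsLength S g < K}.ncard ≤
        (wordBall S K).ncard * (2 * (C * (m + K)) + 1) := by
  classical
  obtain ⟨C, hC⟩ := weight_natAbs_le hS b
  refine ⟨C, fun K m => ?_⟩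
  set X := C * (m + K) with hX
  have hfin := finite_wordBall hS K
  have hsub : {g | g ∈ wordBall S m ∧ b.clsLength S g < K} ⊆
      ((hfin.toFinset ×ˢ Finset.Icc (-(X : ℤ)) X).image
        fun x => x.1 * (b.flip * b.flip) ^ x.2 : Finset G) := by
    rintro g ⟨hg, hK⟩
    obtain ⟨t, ht, he⟩ := exists_mem_wordBall_clsLength (b := b) hgen g
    obtain ⟨i, rfl⟩ := cls_eq.1 he
    have ht' := wordBall_mono hK.le ht
    simp only [Finset.coe_image, Set.mem_image, Finset.mem_coe, Finset.mem_product,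
      Set.Finite.mem_toFinset, Finset.mem_Icc]
    refine ⟨(t, i), ⟨ht', ?_⟩, rfl⟩
    have h1 := hC _ _ hg
    have h2 := hC _ _ ht'
    have h3 := weight_flip_sq_zpow (b := b) i
    rw [map_mul, toAdd_mul] at h1
    rw [mul_add] at hX
    constructor <;> simp only <;> omega
  refine (ncard_le_ncard hsub (Finset.finite_toSet _)).trans ?_
  rw [ncard_coe_finset]
  refine Finset.card_image_le.trans ?_
  rw [Finset.card_product, ← ncard_eq_toFinset_card _ hfin, Int.card_Icc]
  gcongr
  omega

lemma sq_le_card_wordBall {S : Set G} (hS : S.Finite) (hgen : Subgroup.closure S = ⊤)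
    (b : BarrierSystem G) : ∃ c, 0 < c ∧ ∀ m, (m / c + 1) ^ 2 ≤ (wordBall S m).ncard := by
  classical
  obtain ⟨c, hc⟩ := exists_forall_mem_wordBall hgen ![b.shift, b.flip * b.flip]
  have hf : b.shift ∈ wordBall S c := hc 0
  have hz : b.flip * b.flip ∈ wordBall S c := hc 1
  refine ⟨2 * (c + 1), by omega, fun m => ?_⟩
  set a := m / (2 * (c + 1)) with ha
  have ham : a * c + a * c ≤ m := by
    have := Nat.div_mul_le_self m (2 * (c + 1))
    rw [← ha] at this
    nlinarith
  have hfin := finite_wordBall hS m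
  rw [ncard_eq_toFinset_card _ hfin]
  calc (a + 1) ^ 2 = (Finset.range (a + 1) ×ˢ Finset.range (a + 1)).card := by
        rw [Finset.card_product, Finset.card_range, sq]
    _ ≤ _ := by
      refine Finset.card_le_card_of_injOn
        (fun x => b.shift ^ x.1 * (b.flip * b.flip) ^ x.2) ?_ ?_
      · rintro ⟨i, j⟩ hx
        simp only [Finset.coe_product, Set.mem_prod, Finset.mem_coe, Finset.mem_range] at hx
        simp only [Finset.mem_coe, Set.Finite.mem_toFinset]
        refine wordBall_mono ?_ (mul_mem_wordBall (pow_mem_wordBall hf i) (pow_mem_wordBall hz j))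
        have := Nat.mul_le_mul_right c (Nat.lt_succ_iff.1 hx.1)
        have := Nat.mul_le_mul_right c (Nat.lt_succ_iff.1 hx.2)
        omega
      · rintro ⟨i, j⟩ - ⟨i', j'⟩ - he
        simp only at he
        have hcls : b.cls (b.shift ^ i) = b.cls (b.shift ^ i') := by
          have h1 : b.cls (b.shift ^ i) = b.cls (b.shift ^ i * (b.flip * b.flip) ^ j) :=
            cls_eq.2 ⟨j, by simp⟩
          have h2 : b.cls (b.shift ^ i') = b.cls (b.shift ^ i' * (b.flip * b.flip) ^ j') :=
            cls_eq.2 ⟨j', by simp⟩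
          rw [h1, h2, he]
        have hi : i = i' := by
          have key := fun (s t : ℕ) (h : s < t) => (lt_shift_pow (b := b) 1 h).cls_ne
          simp only [one_mul] at key
          rcases lt_trichotomy i i' with h | h | h
          · exact absurd hcls (key _ _ h)
          · exact h
          · exact absurd hcls.symm (key _ _ h)
        subst hi
        have he' := mul_left_cancel he
        have h3 := weight_flip_sq_zpow (b := b) ((j : ℤ) - j')
        rw [zpow_sub, zpow_natCast, zpow_natCast, he', mul_inv_cancel, map_one] at h3
        simp only [toAdd_one, Int.natAbs_zero] at h3
        have : j = j' := by omega
        rw [this]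

lemma negligible_dist_le {S : Set G} (hS : S.Finite) (hgen : Subgroup.closure S = ⊤)
    (b : BarrierSystem G) (r : ℕ) : Negligible S {g | b.dist 1 g ≤ r} := by
  intro ε hε
  obtain ⟨C, hC⟩ := card_dist_le_mul_le hS hgen b r
  obtain ⟨C', hC'⟩ := card_clsLength_lt_le hS hgen b
  obtain ⟨c, hc, hsq⟩ := sq_le_card_wordBall hS hgen b
  obtain ⟨K, hK⟩ := exists_nat_gt (2 * C / ε)
  set A : ℝ := (wordBall S K).ncard * (2 * C' + 2 * C' * K + 1) with hA
  have hA0 : 0 ≤ A := by positivity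
  filter_upwards [eventually_ge_atTop 1, eventually_ge_atTop ⌈2 * A * c ^ 2 / ε⌉₊] with m hm1 hm2
  have hsub : {g | g ∈ wordBall S m ∧ g ∈ {g | b.dist 1 g ≤ r}} ⊆
      {g | g ∈ wordBall S m ∧ b.dist 1 g ≤ r ∧ K ≤ b.clsLength S g} ∪
      {g | g ∈ wordBall S m ∧ b.clsLength S g < K} := by
    rintro g ⟨h1, h2⟩
    rcases le_or_gt K (b.clsLength S g) with h | h
    exacts [Or.inl ⟨h1, h2, h⟩, Or.inr ⟨h1, h⟩]
  have hle := (ncard_le_ncard hsub (((finite_wordBall hS m).subset fun g hg => hg.1).union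
    ((finite_wordBall hS m).subset fun g hg => hg.1))).trans (ncard_union_le _ _)
  have h1 : (({g | g ∈ wordBall S m ∧ b.dist 1 g ≤ r ∧ K ≤ b.clsLength S g}.ncard * K : ℕ) : ℝ)
      ≤ ((C * (wordBall S m).ncard : ℕ) : ℝ) := by exact_mod_cast hC K m
  have h2 : (({g | g ∈ wordBall S m ∧ b.clsLength S g < K}.ncard : ℕ) : ℝ) ≤
      (((wordBall S K).ncard * (2 * (C' * (m + K)) + 1) : ℕ) : ℝ) := by exact_mod_cast hC' K m
  have h3 : (((m / c + 1) ^ 2 : ℕ) : ℝ) ≤ ((wordBall S m).ncard : ℝ) := by exact_mod_cast hsq m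
  have hle' : (({g | g ∈ wordBall S m ∧ g ∈ {g | b.dist 1 g ≤ r}}.ncard : ℕ) : ℝ) ≤
    ((({g | g ∈ wordBall S m ∧ b.dist 1 g ≤ r ∧ K ≤ b.clsLength S g}.ncard +
      {g | g ∈ wordBall S m ∧ b.clsLength S g < K}.ncard) : ℕ) : ℝ) := by exact_mod_cast hle
  push_cast at h1 h2 h3 hle'
  set x : ℝ := ({g | g ∈ wordBall S m ∧ b.dist 1 g ≤ r ∧ K ≤ b.clsLength S g}.ncard : ℝ)
  set y : ℝ := ({g | g ∈ wordBall S m ∧ b.clsLength S g < K}.ncard : ℝ)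
  set B : ℝ := ((wordBall S m).ncard : ℝ)
  have hB : 0 ≤ B := by positivity
  have hx : x ≤ ε / 2 * B := by
    have hK0 : (0 : ℝ) < K := lt_of_le_of_lt (by positivity) hK
    rw [div_lt_iff₀ hε] at hK
    have : x * K ≤ (ε / 2 * B) * K := by nlinarith
    exact le_of_mul_le_mul_right this hK0
  have hm1' : (1 : ℝ) ≤ m := by exact_mod_cast hm1
  have hy : y ≤ ε / 2 * B := by
    have hm2' : 2 * A * c ^ 2 / ε ≤ m := (Nat.le_ceil _).trans (by exact_mod_cast hm2)
    rw [div_le_iff₀ hε] at hm2'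
    have hyA : y ≤ A * m := by
      refine h2.trans ?_
      rw [hA, mul_assoc]
      gcongr
      have : (0 : ℝ) ≤ C' * K * (m - 1) := by
        have : (0 : ℝ) ≤ (m : ℝ) - 1 := by linarith
        positivity
      nlinarith
    have hdiv : (m : ℝ) ≤ c * ((m / c : ℕ) + 1) := by
      have := Nat.lt_mul_div_succ m hc
      have : m ≤ c * (m / c + 1) := this.le
      exact_mod_cast this
    have hcB : (m : ℝ) ^ 2 ≤ c ^ 2 * B := by
      calc (m : ℝ) ^ 2 ≤ ((c : ℝ) * (((m / c : ℕ) : ℝ) + 1)) ^ 2 := by gcongr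
        _ = (c : ℝ) ^ 2 * (((m / c : ℕ) : ℝ) + 1) ^ 2 := by ring
        _ ≤ c ^ 2 * B := by gcongr
    have hc' : (0 : ℝ) < c ^ 2 := by positivity
    have : A * m * c ^ 2 ≤ ε / 2 * B * c ^ 2 := by
      have h5 : 2 * A * c ^ 2 * m ≤ m * ε * m := by gcongr
      nlinarith
    exact hyA.trans (le_of_mul_le_mul_right this hc')
  exact hle'.trans (by linarith)

end BarrierSystem

namespace BarrierSystem

variable {G : Type*} [Group G] {b : BarrierSystem G}

lemma IsChain.dist_le_succ {σ : ℕ → G} {y z : G} (hσ : b.IsChain (b.dist y z) σ y z) {i : ℕ}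
    (hi : i < b.dist y z) : b.dist y (σ i) ≤ i + 1 := by
  obtain ⟨τ, hτ⟩ := sep_dist (b := b) y (σ i)
  have hi' := hσ.1 i hi
  have h1 : b.IsChain (b.dist y (σ i)) τ y z :=
    ⟨fun t ht => ⟨(hτ.1 t ht).1, b.front_of_between (hτ.1 t ht).1 (hτ.1 t ht).2
      (b.between_of_separates hi'.1 hi'.2)⟩, hτ.2⟩
  have h2 : b.IsChain (b.dist y z - (i + 1)) (fun t => σ (i + 1 + t)) y z :=
    ⟨fun t ht => hσ.1 _ (by omega), fun s t hst ht => hσ.2 _ _ (by omega) (by omega)⟩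
  have h3 := (h1.append h2 fun t ht j hj => by
    intro w
    refine (hσ.2 i (i + 1 + j) (by omega) (by omega) w).imp_left fun hw => ?_
    exact b.front_of_between (hτ.1 t ht).1 (hτ.1 t ht).2 (b.between_of_separates hi'.1 hw)).le_dist
  omega

lemma front_of_nested {L : ℕ} {T : ℕ → G} (hT : ∀ i j, i < j → j ≤ L → b.Lt (T i) (T j))
    {x p : G} (hx : ∀ i ≤ L, b.Front (T i) x) {i : ℕ} (hi : i + b.dist x p < L) :
    b.Front (T i) p := by
  by_contra hn
  have : b.IsChain (L - i) (fun t => T (i + 1 + t)) p x :=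
    ⟨fun t ht => ⟨(hT i (i + 1 + t) (by omega) (by omega) p).resolve_left hn, hx _ (by omega)⟩,
      fun s t hst ht => hT _ _ (by omega) (by omega)⟩
  have := this.le_dist
  rw [dist_comm] at this
  omega

lemma exists_front_translate (b : BarrierSystem G) : ∃ X, ∀ L g σ,
    b.IsChain (b.dist 1 g) σ 1 g → 2 * L + X ≤ b.dist 1 g → b.Front (σ L) g⁻¹ →
    ∀ i ≤ L, ∀ j ≤ L, b.Front (g * σ i) (σ j) := by
  obtain ⟨κ, hκ⟩ := exists_chain_gap b
  obtain ⟨N, hN, hcross⟩ := b.finite_crossing 0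
  simp only [pow_zero, mul_one] at hcross
  obtain ⟨CN, hCN⟩ : ∃ C, ∀ ν, b.cls ν ∈ N → b.dist 1 ν ≤ C := by
    classical
    choose r hr using fun q : G ⧸ b.center => QuotientGroup.mk_surjective q
    obtain ⟨C, hC⟩ := (hN.image fun q => b.dist 1 (r q)).bddAbove
    refine ⟨C, fun ν hν => ?_⟩
    rw [dist_comm, dist_congr_left (hr (b.cls ν)).symm, dist_comm]
    exact hC ⟨_, hν, rfl⟩
  refine ⟨CN + b.dist 1 b.flip + κ + 10, fun L g σ hσ hbig hfr i hi j hj => ?_⟩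
  have hi' := hσ.1 i (by omega)
  have hj' := hσ.1 j (by omega)
  have hfi : b.Front (g * σ i) 1 := by
    have := (front_mul_left (g := g)).2 (hσ.front_of_le hi (by omega) hfr)
    simpa using this
  have hbi : b.Front (g * σ i * b.flip) g := by
    have := (b.behind_mul_left (g := g)).2 hi'.1
    rw [mul_one] at this
    exact front_flip.2 this
  have hd : b.dist (g * σ i * b.flip) g ≤ b.dist 1 b.flip + i + 2 := by
    have h1 := b.dist_mul_left g (σ i * b.flip) 1
    rw [mul_one, ← mul_assoc] at h1
    rw [h1]
    have h2 := b.dist_mul_right_le (σ i) b.flip 1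
    have := hσ.dist_le_succ (i := i) (by omega)
    omega
  rcases hcross (g * σ i * b.flip) (σ j) 1 g hfi hj'.1 hbi hj'.2 with h | h | h
  · exfalso
    have h1 := dist_le_of_between h.2 hj'.2
    have h2 : b.IsChain (b.dist 1 g - (j + κ)) (fun t => σ (j + κ + t)) (σ j) g :=
      ⟨fun t ht => ⟨(hκ _ _ _ _ hσ j _ (by omega) (by omega)).2, (hσ.1 _ (by omega)).2⟩,
        fun s t hst ht => hσ.2 _ _ (by omega) (by omega)⟩
    have := h2.le_dist
    omega
  · exact h.2
  · exfalso
    have h1 := hCN _ h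
    have h2 := b.dist_mul_left (g * σ i * b.flip) 1 ((g * σ i * b.flip)⁻¹ * σ j)
    rw [mul_one, mul_inv_cancel_left] at h2
    have h3 := b.dist_triangle 1 (σ j) g
    have h4 := b.dist_triangle (σ j) (g * σ i * b.flip) g
    rw [dist_comm (σ j) (g * σ i * b.flip)] at h4
    have := hσ.dist_le_succ (i := j) (by omega)
    omega

lemma card_front_inv_mul_le {S : Set G} (hS : S.Finite) (hgen : Subgroup.closure S = ⊤)
    (b : BarrierSystem G) : ∃ C M X, 0 < M ∧ ∀ L, ∀ σ : G → ℕ → G,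
      (∀ g, b.IsChain (b.dist 1 g) (σ g) 1 g) → ∀ m,
      {g | g ∈ wordBall S m ∧ 2 * L + X ≤ b.dist 1 g ∧ b.Front (σ g L) g⁻¹}.ncard * ((L - X) / M) ≤
        C * (wordBall S m).ncard := by
  obtain ⟨CS, hCS⟩ := exists_generator_dist_le hS b
  obtain ⟨Cu, hCu⟩ := exists_forall_le fun i => b.dist 1 (b.selector i)
  obtain ⟨κ, hκ⟩ := exists_chain_gap b
  obtain ⟨X₀, hX₀⟩ := exists_front_translate b
  set c' := CS + Cu + 2 with hc'
  set k := c' + 1 with hk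
  obtain ⟨Ce, hCe⟩ := exists_forall_le fun x : Fin 3 × Fin 3 =>
    b.dist (b.spacer k x.1 x.2) (b.selector x.1)
  obtain ⟨c, hc⟩ := exists_forall_mem_wordBall hgen fun x : Fin 3 × Fin 3 => b.spacer k x.1 x.2
  obtain ⟨N, hN, hcross⟩ := b.finite_crossing k
  set X := X₀ + κ + c' + CS + Ce + 10 with hX
  refine ⟨(wordBall S c).ncard * 9 * N.ncard, 2 * c' + 2 * κ + 2, X, by omega, ?_⟩
  intro L σ hσ m
  set M := 2 * c' + 2 * κ + 2 with hM
  have hML : ∀ j < (L - X) / M, M * j + X < L := by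
    intro j hj
    have := Nat.mul_div_le (L - X) M
    have := Nat.mul_le_mul_left M hj
    rw [Nat.mul_succ] at this
    omega
  have key := card_mul_le (b := b)
    (E := {g | g ∈ wordBall S m ∧ 2 * L + X ≤ b.dist 1 g ∧ b.Front (σ g L) g⁻¹})
    (T := wordBall S (m + c)) ((finite_wordBall hS m).subset fun g hg => hg.1)
    (finite_wordBall hS _) hN ((L - X) / M) 1
    (fun i l => (b.selector i)⁻¹ * b.selector l * b.flip⁻¹ * (b.shift ^ k)⁻¹)
    (fun g j s i g' c => b.Behind s 1 ∧ b.Front (s * b.shift ^ k) g' ∧ b.Behind s g'⁻¹ ∧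
      M * j < b.dist 1 g ∧ b.dist s (σ g (0 + M * j)) ≤ c' ∧ b.Behind (σ g (M * j)) 1 ∧
      b.Front (σ g (M * j)) g'⁻¹) ?_ ?_ ?_
  · refine key.trans ?_
    have := ncard_wordBall_add_le hS m c
    calc _ ≤ ((wordBall S m).ncard * (wordBall S c).ncard) * 1 * 9 * N.ncard := by gcongr
      _ = _ := by ring
  · rintro g ⟨⟨w, hw, hwS, hwg⟩, hbig, hg⟩ j hj
    have hj' := hML j hj
    have hch := hσ g
    set ρ := σ g with hρ
    have hr := hch.1 (M * j) (by omega)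
    obtain ⟨l₁, l₂, hw12, hl⟩ := exists_prefix_dist_le (b := b) w (fun s hs => hCS s (hwS s hs)) 1
      hr.1 (by simpa [hwg] using hr.2)
    rw [one_mul] at hl
    obtain ⟨i, l, h1, h2, h3⟩ := b.exists_insertion k l₁.prod l₂.prod 1 g⁻¹
    rw [hw12] at hw hwS
    have hmem := mul_mul_mem_wordBall hw hwS (hc (i, l))
    have hpq : g = l₁.prod * l₂.prod := by rw [← hwg, hw12, List.prod_append]
    simp only at hmem
    have hCeil := hCe (i, l)
    simp only at hCeil
    generalize l₁.prod = p at *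
    generalize l₂.prod = q at *
    have hg' : p * b.spacer k i l * q = (p * b.spacer k i l * p⁻¹) * g := by rw [hpq]; group
    set s := p * b.selector i with hs
    set e := b.spacer k i l with he
    set g' := p * e * q with hgg'
    have hds : b.dist s (ρ (M * j)) ≤ c' := by
      have h4 := b.dist_mul_right_le p (b.selector i) (ρ (M * j))
      have h6 := hCu i
      rw [← hs] at h4
      omega
    have f1 : ∀ t, t + (CS + 1) < L → b.Front (g * ρ t) p := fun t ht =>
      front_of_nested (L := L) (T := fun t => g * ρ t)
        (fun i j hij hj => lt_mul_left.2 (hch.2 i j hij (by omega))) (x := ρ (M * j))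
        (fun i hi => hX₀ L g ρ hch (by omega) hg i hi _ (by omega)) (by omega)
    have f2 : ∀ t, t + (CS + 1) < L → b.Front (g' * ρ t) (p * e) := fun t ht => by
      have := (front_mul_left (g := p * e * p⁻¹)).2 (f1 t ht)
      rw [hg']
      simpa [mul_assoc] using this
    have f3 : ∀ t, t + (CS + 1) + (Ce + 1) < L → b.Front (g' * ρ t) s := fun t ht => by
      have hd : b.dist (p * e) s ≤ Ce := by rw [hs, dist_mul_left]; exact hCeil
      exact front_of_nested (L := L - (CS + 2)) (T := fun t => g' * ρ t)
        (fun i j hij hj => lt_mul_left.2 (hch.2 i j hij (by omega))) (x := p * e)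
        (fun i hi => f2 i (by omega)) (by omega)
    have f4 : ∀ t, t + (CS + 1) + (Ce + 1) < L → b.Front (ρ t) g'⁻¹ := fun t ht => by
      have h4 : b.Behind (g' * ρ t) g' := by
        have := (b.behind_mul_left (g := g')).2 (hch.1 t (by omega)).1
        simpa using this
      have h5 := b.front_of_between h4 (f3 t ht)
        (b.between_symm (b.between_of_separates h1 (front_of_front_shift h3)))
      rw [← front_mul_left (g := g'), mul_inv_cancel]
      exact h5
    have f5 : b.Behind (ρ (M * j + κ + c' + 1)) s := by
      by_contra hn
      have : b.IsChain (c' + 1) (fun t => ρ (M * j + κ + t)) (ρ (M * j)) s :=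
        ⟨fun t ht => ⟨(hκ _ _ _ _ hch (M * j) _ (by omega) (by omega)).2,
          (hch.2 (M * j + κ + t) (M * j + κ + c' + 1) (by omega) (by omega) s).resolve_right hn⟩,
          fun s t hst ht => hch.2 _ _ (by omega) (by omega)⟩
      have := this.le_dist
      rw [dist_comm] at this
      omega
    refine ⟨s, i, l, g', hmem, 0, by omega, ?_, h1, h3, ?_, by omega, by simpa using hds, hr.1,
      f4 _ (by omega)⟩
    · rw [hpq, hs, hgg', he, spacer]; group
    · exact b.behind_of_front h2 f5 (hch.front_of_le (by omega) (by omega) hg) (f4 _ (by omega))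
  · rintro g₁ j₁ s₁ i₁ g₂ j₂ s₂ i₂ g' c ⟨h11, h12, h13, h14, h15, h16, h17⟩
      ⟨h21, h22, h23, h24, h25, h26, h27⟩
    rw [zero_add] at h15 h25
    exact cls_mem_of_near (by omega) hcross h11 h13 h12 h15 h16 h17 h21 h23 h22 h25 h26 h27
  · rintro g j₁ s₁ i g₁' c₁ j₂ s₂ g₂' c₂ ⟨h11, h12, h13, h14, h15, -⟩
      ⟨h21, h22, h23, h24, h25, -⟩ he
    rw [dist_congr_left he] at h15
    exact (hσ g).eq_of_dist_le (hκ _ _ _ _ (hσ g)) (by omega) (by omega) (by omega) h15 h25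

end BarrierSystem

lemma cast_le_mul_of_mul_le {a q C B : ℕ} {ε : ℝ} (hε : 0 < ε) (h : a * q ≤ C * B)
    (hq : C / ε < q) : (a : ℝ) ≤ ε * B := by
  have hq0 : (0 : ℝ) < q := lt_of_le_of_lt (by positivity) hq
  rw [div_lt_iff₀ hε] at hq
  have h' : (a * q : ℝ) ≤ C * B := by exact_mod_cast h
  have hB : (0 : ℝ) ≤ B := by positivity
  exact le_of_mul_le_mul_right (by nlinarith) hq0

lemma exists_forall_lt_sub_div (M X : ℕ) (hM : 0 < M) (r : ℝ) :
    ∃ L₀ : ℕ, ∀ L ≥ L₀, r < ((L - X) / M : ℕ) := by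
  obtain ⟨q, hq⟩ := exists_nat_gt r
  refine ⟨q * M + X, fun L hL => hq.trans_le ?_⟩
  exact_mod_cast (Nat.le_div_iff_mul_le hM).2 (by omega)

lemma FreeGroup.injective_lift_of_subsingleton {G ι : Type*} [Group G] [Subsingleton ι]
    (x : ι → G) (h : ∀ i, ∀ k : ℕ, 0 < k → x i ^ k ≠ 1) :
    Function.Injective (FreeGroup.lift x) := by
  rcases isEmpty_or_nonempty ι with hι | ⟨⟨i⟩⟩
  · exact Function.injective_of_subsingleton _
  rw [injective_iff_map_eq_one]
  intro w hw
  obtain ⟨k, rfl⟩ : ∃ k : ℤ, w = FreeGroup.of i ^ k := by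
    clear hw
    induction w using FreeGroup.induction_on with
    | C1 => exact ⟨0, by simp⟩
    | of j => exact ⟨1, by simp [Subsingleton.elim j i]⟩
    | inv_of j _ => exact ⟨-1, by simp [Subsingleton.elim j i]⟩
    | mul v w hv hw =>
      obtain ⟨k, rfl⟩ := hv
      obtain ⟨l, rfl⟩ := hw
      exact ⟨k + l, by rw [zpow_add]⟩
  rw [map_zpow, FreeGroup.lift_apply_of] at hw
  have hk : k = 0 := by
    by_contra hk
    refine h i k.natAbs (Int.natAbs_pos.2 hk) ?_
    rcases Int.natAbs_eq k with h' | h' <;> rw [h'] at hw <;> simpa using hw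
  simp [hk]

namespace BarrierSystem

variable {G : Type*} [Group G] {b : BarrierSystem G}

lemma exists_front_or_front (b : BarrierSystem G) : ∃ K, ∀ L k k' ρ ρ' h h' w, K ≤ L → L < k →
    L < k' → b.IsChain k ρ 1 h → b.IsChain k' ρ' 1 h' → b.Front (ρ L) w → b.Front (ρ' L) w →
    b.Front (ρ (L - K)) h' ∨ b.Front (ρ' (L - K)) h := by
  obtain ⟨N, hN, hcross⟩ := b.finite_crossing 0
  simp only [pow_zero, mul_one] at hcross
  refine ⟨N.ncard, fun L k k' ρ ρ' h h' w hL hk hk' hρ hρ' hw hw' => ?_⟩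
  obtain ⟨t, ht, htN⟩ := exists_notMem_of_injOn hN (Finset.Icc (L - N.ncard) L)
    (fun t => b.cls ((ρ t)⁻¹ * ρ' L)) (by
      intro s hs t ht he
      simp only [Finset.coe_Icc, Set.mem_Icc] at hs ht
      refine hρ.cls_injOn (by omega) (by omega) ?_
      have := cls_inv (cls_mul_right he (ρ' L)⁻¹)
      simpa using this) (by simp; omega)
  rw [Finset.mem_Icc] at ht
  have h1 := hρ.1 t (by omega)
  have h2 := hρ'.1 L (by omega)
  rcases hcross (ρ t) (ρ' L) 1 w h1.1 h2.1 (hρ.front_of_le ht.2 (by omega) hw) hw' with hc | hc | hc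
  · left
    exact hρ.front_of_le ht.1 (by omega)
      (b.front_of_between h1.1 hc.1 (b.between_of_separates h2.1 h2.2))
  · right
    exact hρ'.front_of_le (Nat.sub_le _ _) (by omega)
      (b.front_of_between h2.1 hc.1 (b.between_of_separates h1.1 h1.2))
  · exact absurd hc htN

/-- The walls of a chain from `1` to `g`, seen from `g` and translated to start at `1`. -/
noncomputable def revRay (b : BarrierSystem G) (σ : G → ℕ → G) (g : G) : ℕ → G :=
  fun i => g * (σ g⁻¹ (b.dist 1 g - 1 - i) * b.flip)

lemma isChain_revRay {σ : G → ℕ → G} (hσ : ∀ g, b.IsChain (b.dist 1 g) (σ g) 1 g) (g : G) :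
    b.IsChain (b.dist 1 g) (b.revRay σ g) 1 g := by
  have hd : b.dist 1 g⁻¹ = b.dist 1 g := by
    have := b.dist_mul_left g 1 g⁻¹
    rw [mul_one, mul_inv_cancel, dist_comm] at this
    exact this.symm
  have := (hσ g⁻¹).flip.mul_left g
  rw [hd] at this
  rw [mul_inv_cancel, mul_one] at this
  exact this

lemma dist_one_inv (g : G) : b.dist 1 g⁻¹ = b.dist 1 g := by
  have := b.dist_mul_left g 1 g⁻¹
  rw [mul_one, mul_inv_cancel, dist_comm] at this
  exact this.symm

/-- A ping-pong criterion for tuples whose rays are far from each other. -/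
lemma exists_isFreeBasisTuple_of_rays {G : Type} [Group G] (b : BarrierSystem G) : ∃ K, ∀ L n (x : Fin n → G)
    (σ : G → ℕ → G), (∀ g, b.IsChain (b.dist 1 g) (σ g) 1 g) →
    (∀ i, 2 * (L + K) + 2 ≤ b.dist 1 (x i)) →
    (∀ i, ¬ b.Front (σ (x i) L) (x i)⁻¹) → (∀ i, ¬ b.Front (b.revRay σ (x i)⁻¹ L) (x i)) →
    (∀ i j, i ≠ j → ¬ b.Front (σ (x i) L) (x j)) →
    (∀ i j, i ≠ j → ¬ b.Front (σ (x i) L) (x j)⁻¹) →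
    (∀ i j, i ≠ j → ¬ b.Front (b.revRay σ (x i)⁻¹ L) (x j)) →
    (∀ i j, i ≠ j → ¬ b.Front (b.revRay σ (x i)⁻¹ L) (x j)⁻¹) →
    IsFreeBasisTuple x := by
  obtain ⟨K, hK⟩ := exists_front_or_front b
  refine ⟨K, fun L n x σ hσ hbig hs1 hs2 h1 h2 h3 h4 => ?_⟩
  set X : Fin n → Set G := fun i => {w | b.Front (σ (x i) (L + K)) w} with hX
  set Y : Fin n → Set G := fun i => {w | b.Front (b.revRay σ (x i)⁻¹ (L + K)) w} with hY
  have hc1 := fun i => hσ (x i)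
  have hc2 : ∀ i, b.IsChain (b.dist 1 (x i)) (b.revRay σ (x i)⁻¹) 1 (x i)⁻¹ := fun i => by
    simpa [dist_one_inv] using isChain_revRay hσ (x i)⁻¹
  have hlt : ∀ i, L + K < b.dist 1 (x i) := fun i => by have := hbig i; omega
  have hnest : ∀ i w, ¬ b.Front (b.revRay σ (x i)⁻¹ (L + K)) w →
      b.Front (σ (x i) (L + K)) (x i * w) := by
    intro i w hw
    have hb := hbig i
    have hn := (hc1 i).2 (L + K) (b.dist 1 (x i) - 1 - (L + K)) (by omega) (by omega)
    refine (hn (x i * w)).resolve_right fun hbeh => hw ?_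
    rw [revRay, dist_one_inv, inv_inv, ← mul_assoc, front_flip]
    simpa using (b.behind_mul_left (g := (x i)⁻¹)).2 hbeh
  have hnest' : ∀ i w, ¬ b.Front (σ (x i) (L + K)) w →
      b.Front (b.revRay σ (x i)⁻¹ (L + K)) ((x i)⁻¹ * w) := by
    intro i w hw
    by_contra hn
    exact hw (by simpa using hnest i _ hn)
  have hXY : ∀ i j, Disjoint (X i) (Y j) := by
    intro i j
    rw [Set.disjoint_left]
    intro w hw hw'
    have := hK (L + K) _ _ _ _ _ _ w (by omega) (hlt i) (hlt j) (hc1 i) (hc2 j) hw hw'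
    rw [Nat.add_sub_cancel] at this
    by_cases hij : i = j
    · subst hij
      exact this.elim (hs1 i) (hs2 i)
    · exact this.elim (h2 i j hij) (h3 j i (Ne.symm hij))
  have hpow : ∀ i, ∀ k : ℕ, 0 < k → x i ^ k ≠ 1 := by
    intro i k hk
    have hmem : ∀ k : ℕ, x i ^ (k + 1) ∈ X i := by
      intro k
      induction k with
      | zero =>
        rw [zero_add, pow_one]
        exact ((hc1 i).1 _ (hlt i)).2
      | succ k ih =>
        rw [pow_succ']
        exact hnest i _ fun hY' => Set.disjoint_left.1 (hXY i i) ih hY'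
    intro he
    have := hmem (k - 1)
    rw [Nat.sub_add_cancel hk, he] at this
    exact b.not_front ((hc1 i).1 _ (hlt i)).1 this
  unfold IsFreeBasisTuple
  rcases subsingleton_or_nontrivial (Fin n) with hn | hn
  · exact FreeGroup.injective_lift_of_subsingleton x hpow
  refine FreeGroup.injective_lift_of_ping_pong (α := G) x X Y ?_ ?_ ?_ hXY ?_ ?_
  · exact fun i => ⟨x i, ((hc1 i).1 _ (hlt i)).2⟩
  · intro i j hij
    rw [Function.onFun, Set.disjoint_left]
    intro w hw hw'
    have := hK (L + K) _ _ _ _ _ _ w (by omega) (hlt i) (hlt j) (hc1 i) (hc1 j) hw hw'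
    rw [Nat.add_sub_cancel] at this
    exact this.elim (h1 i j hij) (h1 j i hij.symm)
  · intro i j hij
    rw [Function.onFun, Set.disjoint_left]
    intro w hw hw'
    have := hK (L + K) _ _ _ _ _ _ w (by omega) (hlt i) (hlt j) (hc2 i) (hc2 j) hw hw'
    rw [Nat.add_sub_cancel] at this
    exact this.elim (h4 i j hij) (h4 j i hij.symm)
  · rintro i _ ⟨w, hw, rfl⟩
    exact hnest i w hw
  · rintro i _ ⟨w, hw, rfl⟩
    exact hnest' i w hw

end BarrierSystem

section Counting

variable {G : Type*} [Group G] {S : Set G}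

lemma ncard_wordBall_union_le (S : Set G) (m : ℕ) (A B : Set G) :
    {g | g ∈ wordBall S m ∧ g ∈ A ∪ B}.ncard ≤
      {g | g ∈ wordBall S m ∧ g ∈ A}.ncard + {g | g ∈ wordBall S m ∧ g ∈ B}.ncard := by
  refine le_trans (le_of_eq ?_) (Set.ncard_union_le _ _)
  congr 1
  ext g
  simp only [Set.mem_ofPred_eq, Set.mem_union]
  tauto

lemma ncard_wordBall_inv_le (hS : S.Finite) (m : ℕ) (A : Set G) :
    {g | g ∈ wordBall S m ∧ g⁻¹ ∈ A}.ncard ≤ {g | g ∈ wordBall S m ∧ g ∈ A}.ncard := by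
  refine Set.ncard_le_ncard_of_injOn (fun g => g⁻¹) (fun g hg => ?_)
    (fun g _ h _ hgh => inv_injective hgh) ((finite_wordBall hS m).subset fun g hg => hg.1)
  exact ⟨inv_mem_wordBall hg.1, hg.2⟩

lemma ncard_wordBall_iUnion_le (S : Set G) (m : ℕ) {k : ℕ} (A : Fin k → Set G) :
    {g | g ∈ wordBall S m ∧ ∃ i, g ∈ A i}.ncard ≤
      ∑ i, {g | g ∈ wordBall S m ∧ g ∈ A i}.ncard := by
  have : {g | g ∈ wordBall S m ∧ ∃ i, g ∈ A i} = ⋃ i, {g | g ∈ wordBall S m ∧ g ∈ A i} := by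
    ext g
    simp
  rw [this]
  exact Set.ncard_iUnion_le_of_fintype _

/-- If each coordinate of a tuple must avoid a small set depending on the others, then few
tuples fail at a given coordinate. -/
lemma card_removeNth_le {α : Type*} {B : Set α} (hB : B.Finite) {k : ℕ} (j : Fin (k + 1))
    (A : (Fin k → α) → Set α) {d : ℕ} (hA : ∀ y, {a | a ∈ B ∧ a ∈ A y}.ncard ≤ d) :
    {x : Fin (k + 1) → α | (∀ i, x i ∈ B) ∧ x j ∈ A (j.removeNth x)}.ncard ≤ d * B.ncard ^ k := by
  classical
  have hfin : {x : Fin (k + 1) → α | (∀ i, x i ∈ B) ∧ x j ∈ A (j.removeNth x)}.Finite :=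
    (Set.Finite.pi' fun _ => hB).subset fun x hx => hx.1
  rw [Set.ncard_eq_toFinset_card _ hfin, Set.ncard_eq_toFinset_card _ hB]
  have hcard : (Fintype.piFinset fun _ : Fin k => hB.toFinset).card = hB.toFinset.card ^ k := by
    simp
  rw [← hcard]
  refine Finset.card_le_mul_card_image_of_maps_to (f := fun x => j.removeNth x) ?_ d ?_
  · intro x hx
    simp only [Set.Finite.mem_toFinset, Set.mem_ofPred_eq] at hx
    simp only [Fintype.mem_piFinset, Set.Finite.mem_toFinset]
    exact fun i => hx.1 _
  · intro y _
    refine le_trans ?_ (hA y)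
    rw [← Set.ncard_coe_finset]
    refine Set.ncard_le_ncard_of_injOn (fun x => x j) (fun x hx => ?_) (fun x hx x' hx' he => ?_)
      (hB.subset fun a ha => ha.1)
    · simp only [Finset.coe_filter, Set.Finite.mem_toFinset, Set.mem_ofPred_eq] at hx
      exact ⟨hx.1.1 j, hx.2 ▸ hx.1.2⟩
    · simp only [Finset.coe_filter, Set.Finite.mem_toFinset, Set.mem_ofPred_eq] at hx hx'
      rw [← Fin.insertNth_self_removeNth j x, ← Fin.insertNth_self_removeNth j x', hx.2, hx'.2]
      simp only at he
      rw [he]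

/-- A criterion for the strong generic free group property in terms of exceptional sets. -/
lemma strongGenericFreeGroupProperty_of_exceptional (hS : S.Finite)
    (h : ∀ ε : ℝ, 0 < ε → ∃ (A : Set G) (P : G → Set G),
      (∀ᶠ m in atTop, ({g | g ∈ wordBall S m ∧ g ∈ A}.ncard : ℝ) ≤ ε * (wordBall S m).ncard) ∧
      (∀ m g, ({h | h ∈ wordBall S m ∧ h ∈ P g}.ncard : ℝ) ≤ ε * (wordBall S m).ncard) ∧
      ∀ n, ∀ x : Fin n → G, (∀ i, x i ∉ A) → (∀ i j, i ≠ j → x j ∉ P (x i)) →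
        IsFreeBasisTuple x) : StrongGenericFreeGroupProperty S := by
  rintro n hn
  obtain ⟨k, rfl⟩ := Nat.exists_eq_add_of_le' hn
  rw [Metric.tendsto_nhds]
  intro δ hδ
  set ε : ℝ := δ / (2 * ((k + 1) * (k + 1))) with hε
  have hεpos : 0 < ε := by positivity
  obtain ⟨A, P, hA, hP, hfree⟩ := h ε hεpos
  filter_upwards [hA] with m hA
  set B := wordBall S m with hBdef
  have hB : B.Finite := finite_wordBall hS m
  have hBpos : (0 : ℝ) < B.ncard := by exact_mod_cast ncard_wordBall_pos hS m
  set d : ℝ := (k + 1) * ε * B.ncard with hd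
  have hdpos : 0 ≤ d := by positivity
  set Bad : Fin (k + 1) → Set (Fin (k + 1) → G) := fun j =>
    {x | (∀ i, x i ∈ B) ∧ x j ∈ A ∪ {g | ∃ i, g ∈ P (j.removeNth x i)}} with hBad
  set Good := {x : Fin (k + 1) → G | (∀ i, x i ∈ B) ∧ IsFreeBasisTuple x} with hGood
  have hbad : ∀ j, ((Bad j).ncard : ℝ) ≤ d * (B.ncard : ℝ) ^ k := by
    intro j
    have := card_removeNth_le hB j (fun y => A ∪ {g | ∃ i, g ∈ P (y i)}) (d := ⌊d⌋₊) (by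
      intro y
      refine Nat.le_floor ?_
      refine le_trans (Nat.cast_le.2 (ncard_wordBall_union_le S m _ _)) ?_
      push_cast
      have h1 : ({g | g ∈ wordBall S m ∧ g ∈ {g | ∃ i, g ∈ P (y i)}}.ncard : ℝ) ≤
          k * (ε * B.ncard) := by
        refine le_trans (Nat.cast_le.2 (ncard_wordBall_iUnion_le S m fun i => P (y i))) ?_
        push_cast
        refine le_trans (Finset.sum_le_sum fun i _ => hP m (y i)) ?_
        simp [hBdef]
      rw [hd]
      nlinarith)
    have h2 : ((Bad j).ncard : ℝ) ≤ (⌊d⌋₊ : ℝ) * (B.ncard : ℝ) ^ k := by exact_mod_cast this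
    exact h2.trans (mul_le_mul_of_nonneg_right (Nat.floor_le hdpos) (by positivity))
  have hpi : ({x : Fin (k + 1) → G | ∀ i, x i ∈ B}).ncard = B.ncard ^ (k + 1) := by
    classical
    have hf : ({x : Fin (k + 1) → G | ∀ i, x i ∈ B}).Finite := Set.Finite.pi' fun _ => hB
    have : ({x : Fin (k + 1) → G | ∀ i, x i ∈ B}) =
        (Fintype.piFinset fun _ : Fin (k + 1) => hB.toFinset : Finset (Fin (k + 1) → G)) := by
      ext x; simp
    rw [this, Set.ncard_coe_finset]
    simp [Set.ncard_eq_toFinset_card _ hB]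
  have hpifin : ({x : Fin (k + 1) → G | ∀ i, x i ∈ B}).Finite := Set.Finite.pi' fun _ => hB
  have hupper : (Good.ncard : ℝ) ≤ (B.ncard : ℝ) ^ (k + 1) := by
    have : Good.ncard ≤ B.ncard ^ (k + 1) := by
      rw [← hpi]
      exact Set.ncard_le_ncard (fun x hx => hx.1) hpifin
    exact_mod_cast this
  have hcover : {x : Fin (k + 1) → G | ∀ i, x i ∈ B} ⊆ Good ∪ ⋃ j, Bad j := by
    intro x hx
    by_cases hf : IsFreeBasisTuple x
    · exact Or.inl ⟨hx, hf⟩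
    right
    by_contra hno
    simp only [hBad, Set.mem_iUnion, Set.mem_ofPred_eq, not_exists, not_and, Set.mem_union,
      not_or] at hno
    refine hf (hfree _ x (fun i => (hno i hx).1) fun i j hij => ?_)
    obtain ⟨l, hl⟩ := Fin.exists_succAbove_eq hij
    have := (hno j hx).2 l
    rwa [Fin.removeNth, hl] at this
  have hgoodfin : Good.Finite := hpifin.subset fun x hx => hx.1
  have hlower : (B.ncard : ℝ) ^ (k + 1) ≤ Good.ncard + (k + 1) * (d * (B.ncard : ℝ) ^ k) := by
    have h1 := Set.ncard_le_ncard hcover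
      (hgoodfin.union (Set.finite_iUnion fun j => hpifin.subset fun x hx => hx.1))
    have h2 := h1.trans (Set.ncard_union_le _ _)
    have h3 := h2.trans (Nat.add_le_add_left (Set.ncard_iUnion_le_of_fintype _) _)
    rw [hpi] at h3
    have h4 : (B.ncard : ℝ) ^ (k + 1) ≤ Good.ncard + ∑ j, ((Bad j).ncard : ℝ) := by
      exact_mod_cast h3
    refine h4.trans (add_le_add_right ?_ _)
    refine (Finset.sum_le_sum fun j _ => hbad j).trans ?_
    simp
  have hpow : (0 : ℝ) < (B.ncard : ℝ) ^ (k + 1) := by positivity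
  have hle : (k + 1) * (d * (B.ncard : ℝ) ^ k) = δ / 2 * (B.ncard : ℝ) ^ (k + 1) := by
    rw [hd, hε, pow_succ]
    field_simp
  rw [hle] at hlower
  rw [Real.dist_eq, abs_lt]
  constructor
  · rw [lt_sub_iff_add_lt, lt_div_iff₀ hpow]
    nlinarith
  · rw [sub_lt_iff_lt_add, div_lt_iff₀ hpow]
    nlinarith

end Counting

namespace BarrierSystem

lemma exists_exceptional {G : Type} [Group G] {S : Set G} (hS : S.Finite)
    (hgen : Subgroup.closure S = ⊤) (b : BarrierSystem G) (ε : ℝ) (hε : 0 < ε) :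
    ∃ (A : Set G) (P : G → Set G),
      (∀ᶠ m in atTop, ({g | g ∈ wordBall S m ∧ g ∈ A}.ncard : ℝ) ≤ ε * (wordBall S m).ncard) ∧
      (∀ m g, ({h | h ∈ wordBall S m ∧ h ∈ P g}.ncard : ℝ) ≤ ε * (wordBall S m).ncard) ∧
      ∀ n, ∀ x : Fin n → G, (∀ i, x i ∉ A) → (∀ i j, i ≠ j → x j ∉ P (x i)) →
        IsFreeBasisTuple x := by
  choose σ hσ using fun g => sep_dist (b := b) 1 g
  have hσ' := isChain_revRay hσ
  obtain ⟨C₁, M₁, hM₁, h₁⟩ := card_front_mul_le hS hgen b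
  obtain ⟨C₂, M₂, X, hM₂, h₂⟩ := card_front_inv_mul_le hS hgen b
  obtain ⟨K, hK⟩ := exists_isFreeBasisTuple_of_rays b
  obtain ⟨L₁, hL₁⟩ := exists_forall_lt_sub_div M₁ 0 hM₁ (C₁ / (ε / 4))
  obtain ⟨L₂, hL₂⟩ := exists_forall_lt_sub_div M₂ X hM₂ (C₂ / (ε / 4))
  set L := max L₁ L₂
  have hL₁ := hL₁ L (le_max_left _ _)
  have hL₂ := hL₂ L (le_max_right _ _)
  rw [Nat.sub_zero] at hL₁
  have hε' : 0 < ε / 4 := by positivity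
  set R := 2 * (L + K) + X + 2
  set A₁ : Set G := {g | b.dist 1 g ≤ R}
  set A₂ : Set G := {g | 2 * L + X ≤ b.dist 1 g ∧ b.Front (σ g L) g⁻¹}
  set A₃ : Set G := {g | 2 * L + X ≤ b.dist 1 g ∧ b.Front (b.revRay σ g L) g⁻¹}
  set Q : (ℕ → G) → Set G := fun ρ => {h | b.Front (ρ L) h}
  have hQ : ∀ (ρ : ℕ → G) (g : G), b.IsChain (b.dist 1 g) ρ 1 g → R < b.dist 1 g → ∀ m,
      ({h | h ∈ wordBall S m ∧ h ∈ Q ρ}.ncard : ℝ) ≤ ε / 4 * (wordBall S m).ncard :=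
    fun ρ g hρ hg m => cast_le_mul_of_mul_le hε' (h₁ L ρ g (hρ.mono (by omega)) m) hL₁
  refine ⟨A₁ ∪ (A₂ ∪ {g | g⁻¹ ∈ A₃}), fun g => {h | R < b.dist 1 g ∧
    h ∈ (Q (σ g) ∪ {h | h⁻¹ ∈ Q (σ g)}) ∪ (Q (b.revRay σ g⁻¹) ∪ {h | h⁻¹ ∈ Q (b.revRay σ g⁻¹)})},
    ?_, ?_, ?_⟩
  · filter_upwards [negligible_dist_le hS hgen b R (ε / 4) hε'] with m hm
    have e2 := cast_le_mul_of_mul_le hε' (h₂ L σ hσ m) hL₂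
    have e3 := cast_le_mul_of_mul_le hε' (h₂ L _ hσ' m) hL₂
    have u1 := ncard_wordBall_union_le S m A₁ (A₂ ∪ {g | g⁻¹ ∈ A₃})
    have u2 := ncard_wordBall_union_le S m A₂ {g | g⁻¹ ∈ A₃}
    have u3 := ncard_wordBall_inv_le hS m A₃
    have u : {g | g ∈ wordBall S m ∧ g ∈ A₁ ∪ (A₂ ∪ {g | g⁻¹ ∈ A₃})}.ncard ≤
        {g | g ∈ wordBall S m ∧ g ∈ A₁}.ncard + ({g | g ∈ wordBall S m ∧ g ∈ A₂}.ncard +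
        {g | g ∈ wordBall S m ∧ g ∈ A₃}.ncard) := by
      refine u1.trans (Nat.add_le_add_left (u2.trans (Nat.add_le_add_left u3 _)) _)
    have u' : ({g | g ∈ wordBall S m ∧ g ∈ A₁ ∪ (A₂ ∪ {g | g⁻¹ ∈ A₃})}.ncard : ℝ) ≤
        {g | g ∈ wordBall S m ∧ g ∈ A₁}.ncard + ({g | g ∈ wordBall S m ∧ g ∈ A₂}.ncard +
        {g | g ∈ wordBall S m ∧ g ∈ A₃}.ncard) := by exact_mod_cast u
    have hBpos : (0 : ℝ) ≤ (wordBall S m).ncard := by positivity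
    have hp : 0 ≤ ε * ((wordBall S m).ncard : ℝ) := by positivity
    have hm' : ({g | g ∈ wordBall S m ∧ g ∈ A₁}.ncard : ℝ) ≤ ε / 4 * (wordBall S m).ncard := hm
    have e2' : ({g | g ∈ wordBall S m ∧ g ∈ A₂}.ncard : ℝ) ≤ ε / 4 * (wordBall S m).ncard := e2
    have e3' : ({g | g ∈ wordBall S m ∧ g ∈ A₃}.ncard : ℝ) ≤ ε / 4 * (wordBall S m).ncard := e3
    linarith
  · intro m g
    by_cases hg : R < b.dist 1 g
    · have hc := isChain_revRay hσ g⁻¹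
      have q1 := hQ (σ g) g (hσ g) hg m
      have q2 := hQ (b.revRay σ g⁻¹) g⁻¹ hc (by rwa [dist_one_inv]) m
      simp only [hg, true_and, Set.ofPred_mem_eq]
      have u1 := ncard_wordBall_union_le S m (Q (σ g) ∪ {h | h⁻¹ ∈ Q (σ g)})
        (Q (b.revRay σ g⁻¹) ∪ {h | h⁻¹ ∈ Q (b.revRay σ g⁻¹)})
      have u2 := ncard_wordBall_union_le S m (Q (σ g)) {h | h⁻¹ ∈ Q (σ g)}
      have u3 := ncard_wordBall_union_le S m (Q (b.revRay σ g⁻¹)) {h | h⁻¹ ∈ Q (b.revRay σ g⁻¹)}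
      have u4 := ncard_wordBall_inv_le hS m (Q (σ g))
      have u5 := ncard_wordBall_inv_le hS m (Q (b.revRay σ g⁻¹))
      have u := u1.trans (Nat.add_le_add (u2.trans (Nat.add_le_add_left u4 _))
        (u3.trans (Nat.add_le_add_left u5 _)))
      refine (Nat.cast_le.2 u).trans ?_
      push_cast
      linarith
    · simp only [hg, false_and, Set.ofPred_false, Set.mem_empty_iff_false, and_false,
        Set.ncard_empty, Nat.cast_zero]
      positivity
  · intro n x hA hP
    have hdist : ∀ i, R < b.dist 1 (x i) := fun i => by
      by_contra hi
      exact hA i (Or.inl (not_lt.1 hi))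
    have hP' : ∀ i j, i ≠ j → x j ∉ (Q (σ (x i)) ∪ {h | h⁻¹ ∈ Q (σ (x i))}) ∪
        (Q (b.revRay σ (x i)⁻¹) ∪ {h | h⁻¹ ∈ Q (b.revRay σ (x i)⁻¹)}) :=
      fun i j hij hm => hP i j hij ⟨hdist i, hm⟩
    refine hK L n x σ hσ (fun i => ?_) (fun i hi => ?_) (fun i hi => ?_)
      (fun i j hij h => hP' i j hij (Or.inl (Or.inl h)))
      (fun i j hij h => hP' i j hij (Or.inl (Or.inr h)))
      (fun i j hij h => hP' i j hij (Or.inr (Or.inl h)))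
      (fun i j hij h => hP' i j hij (Or.inr (Or.inr h)))
    · have := hdist i; omega
    · exact hA i (Or.inr (Or.inl ⟨by have := hdist i; omega, hi⟩))
    · refine hA i (Or.inr (Or.inr ⟨by rw [dist_one_inv]; have := hdist i; omega, ?_⟩))
      rwa [inv_inv]

theorem hasStrongGenericFreeGroupProperty {G : Type} [Group G] (b : BarrierSystem G) :
    HasStrongGenericFreeGroupProperty G := fun _ hS hgen =>
  strongGenericFreeGroupProperty_of_exceptional hS (exists_exceptional hS hgen b)

end BarrierSystem

namespace Braid

/-- The symmetric group on the strands of a braid with `N` elementary crossings. -/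
abbrev Sym (N : ℕ) : Type := Equiv.Perm (Fin (N + 1))

variable {N : ℕ}

/-- The product `u * c` is reduced: no pair of strands is crossed by both `u` and `c`. -/
def Red (u c : Sym N) : Prop := ∀ p q, p < q → u q < u p → c⁻¹ p < c⁻¹ q

/-- The prefix order on permutations. -/
def Pre (u w : Sym N) : Prop := Red u (u⁻¹ * w)

/-- The adjacent transpositions. -/
def s (i : Fin N) : Sym N := Equiv.swap i.castSucc i.succ

/-- Left descents. -/
def LD (i : Fin N) (w : Sym N) : Prop := w⁻¹ i.succ < w⁻¹ i.castSucc

/-- Right descents. -/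
def RD (i : Fin N) (w : Sym N) : Prop := w i.succ < w i.castSucc

/-- The longest permutation. -/
def w0 : Sym N := Fin.revPerm

/-- The right complement in the longest permutation. -/
def star (w : Sym N) : Sym N := w⁻¹ * w0

lemma inv_apply_apply (u : Sym N) (p : Fin (N + 1)) : u⁻¹ (u p) = p := u.symm_apply_apply p

lemma apply_inv_apply (u : Sym N) (p : Fin (N + 1)) : u (u⁻¹ p) = p := u.apply_symm_apply p

lemma lt_of_le_of_ne_perm {u : Sym N} {p q : Fin (N + 1)} (h : ¬ u q < u p) (hpq : p ≠ q) :
    u p < u q := lt_of_le_of_ne (not_lt.1 h) fun h' => hpq (u.injective h')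

lemma red_assoc {u v w : Sym N} : Red u v ∧ Red (u * v) w ↔ Red v w ∧ Red u (v * w) := by
  constructor
  · rintro ⟨h1, h2⟩
    refine ⟨fun p q hpq hv => ?_, fun p q hpq hu => ?_⟩
    · refine h2 p q hpq ?_
      have := h1 _ _ hv
      simp only [inv_apply_apply] at this
      exact lt_of_le_of_ne_perm (fun h => absurd (this h) hpq.le.not_gt)
        (fun h => hpq.ne' h)
    · have h := h1 p q hpq hu
      have := h2 _ _ h (by simpa using hu)
      simpa [mul_inv_rev] using this
  · rintro ⟨h1, h2⟩
    refine ⟨fun p q hpq hu => ?_, fun p q hpq huv => ?_⟩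
    · by_contra hn
      have hlt : v⁻¹ q < v⁻¹ p := lt_of_le_of_ne_perm hn hpq.ne'
      have h3 := h1 _ _ hlt (by simpa using hpq)
      have h4 := h2 p q hpq hu
      simp only [mul_inv_rev, Equiv.Perm.mul_apply] at h4
      exact lt_asymm h3 h4
    · by_cases hv : v q < v p
      · exact h1 p q hpq hv
      · have := h2 _ _ (lt_of_le_of_ne_perm hv hpq.ne) huv
        simpa [mul_inv_rev] using this

lemma red_one_left (w : Sym N) : Red 1 w := fun p q hpq h => by
  simp only [Equiv.Perm.coe_one, id_eq] at h
  exact absurd h hpq.le.not_gt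

lemma red_one_right (w : Sym N) : Red w 1 := fun p q hpq _ => by simpa using hpq

lemma eq_one_of_strictMono {d : Sym N} (h : ∀ p q, p < q → d p < d q) : d = 1 := by
  have h1 : StrictMono d := fun p q => h p q
  have := Subsingleton.elim (h1.orderIsoOfSurjective d d.surjective) (OrderIso.refl _)
  ext x
  have hx := congrArg (fun e : Fin (N + 1) ≃o Fin (N + 1) => e x) this
  simpa using congrArg Fin.val hx

lemma eq_one_of_red_inv {d : Sym N} (h : Red d d⁻¹) : d = 1 := by
  refine eq_one_of_strictMono fun p q hpq => ?_
  by_contra hn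
  have := h p q hpq (lt_of_le_of_ne_perm hn hpq.ne')
  rw [inv_inv] at this
  exact hn this

lemma pre_refl (w : Sym N) : Pre w w := by simpa [Pre] using red_one_right w

lemma one_pre (w : Sym N) : Pre 1 w := red_one_left _

lemma Pre.trans {a b c : Sym N} (h1 : Pre a b) (h2 : Pre b c) : Pre a c := by
  have := (red_assoc (u := a) (v := a⁻¹ * b) (w := b⁻¹ * c)).1
    ⟨h1, by simpa [Pre, ← mul_assoc] using h2⟩
  simpa [Pre, mul_assoc] using this.2

lemma Pre.antisymm {a b : Sym N} (h1 : Pre a b) (h2 : Pre b a) : a = b := by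
  have := (red_assoc (u := a) (v := a⁻¹ * b) (w := b⁻¹ * a)).1
    ⟨h1, by simpa [Pre, ← mul_assoc] using h2⟩
  have h := eq_one_of_red_inv (d := a⁻¹ * b) (by simpa [mul_inv_rev] using this.1)
  exact (inv_mul_eq_one.1 h)

lemma pre_mul_left {v x y : Sym N} (hx : Red v x) (hy : Red v y) :
    Pre (v * x) (v * y) ↔ Pre x y := by
  have := red_assoc (u := v) (v := x) (w := x⁻¹ * y)
  simp only [mul_inv_cancel_left, hx, hy, true_and, and_true] at this
  simpa [Pre, mul_inv_rev, mul_assoc] using this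

lemma pre_mul_right {u c : Sym N} : Pre u (u * c) ↔ Red u c := by simp [Pre]

lemma eq_one_of_pre_one {u : Sym N} (h : Pre u 1) : u = 1 := h.antisymm (one_pre u)

lemma Red.eq_one {u c : Sym N} (h : Red u c) (h1 : u * c = 1) : u = 1 := by
  have := pre_mul_right.2 h
  rw [h1] at this
  exact eq_one_of_pre_one this

lemma w0_lt {p q : Fin (N + 1)} : (w0 : Sym N) p < w0 q ↔ q < p := by simp [w0]

lemma w0_mul_w0 : (w0 * w0 : Sym N) = 1 := by ext x; simp [w0]

lemma w0_inv : (w0 : Sym N)⁻¹ = w0 := inv_eq_of_mul_eq_one_left w0_mul_w0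

lemma red_iff_pre_star {u c : Sym N} : Red u c ↔ Pre c (star u) := by
  have : ∀ p, (c⁻¹ * star u)⁻¹ p = w0 (u (c p)) := fun p => by
    simp [star, mul_inv_rev, w0_inv]
  constructor
  · intro h p q hpq hc
    rw [this, this, w0_lt]
    by_contra hn
    have := h _ _ hc (lt_of_le_of_ne_perm hn fun h' => hpq.ne (c.injective h'))
    simp only [inv_apply_apply] at this
    exact lt_asymm hpq this
  · intro h p q hpq hu
    by_contra hn
    have h1 := h _ _ (lt_of_le_of_ne_perm hn hpq.ne') (by simpa using hpq)
    rw [this, this, w0_lt] at h1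
    simp only [apply_inv_apply] at h1
    exact lt_asymm h1 hu

lemma red_star (u : Sym N) : Red u (star u) := red_iff_pre_star.2 (pre_refl _)

lemma mul_star (u : Sym N) : u * star u = w0 := by simp [star]

lemma pre_w0 (u : Sym N) : Pre u w0 := by
  have := pre_mul_right.2 (red_star u)
  rwa [mul_star] at this

lemma star_w0 : star (w0 : Sym N) = 1 := by simp [star]

lemma s_mul_s (i : Fin N) : s i * s i = 1 := Equiv.swap_mul_self _ _

lemma s_inv (i : Fin N) : (s i)⁻¹ = s i := Equiv.swap_inv _ _

lemma s_castSucc (i : Fin N) : s i i.castSucc = i.succ := Equiv.swap_apply_left _ _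

lemma s_succ (i : Fin N) : s i i.succ = i.castSucc := Equiv.swap_apply_right _ _

lemma eq_of_s_lt {i : Fin N} {p q : Fin (N + 1)} (hpq : p < q) (h : s i q < s i p) :
    p = i.castSucc ∧ q = i.succ := by
  simp only [s, Equiv.swap_apply_def] at h
  rw [Fin.lt_def] at hpq
  split_ifs at h <;> simp only [Fin.lt_def, Fin.ext_iff, Fin.val_castSucc, Fin.val_succ] at * <;>
    omega

lemma pre_s_iff {i : Fin N} {w : Sym N} : Pre (s i) w ↔ LD i w := by
  have hinv : ∀ p, ((s i)⁻¹ * w)⁻¹ p = w⁻¹ (s i p) := fun p => by simp [mul_inv_rev]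
  constructor
  · intro h
    have := h i.castSucc i.succ (Fin.castSucc_lt_succ) (by
      rw [s_castSucc, s_succ]; exact Fin.castSucc_lt_succ)
    rwa [hinv, hinv, s_castSucc, s_succ] at this
  · intro h p q hpq hs
    obtain ⟨rfl, rfl⟩ := eq_of_s_lt hpq hs
    rw [hinv, hinv, s_castSucc, s_succ]
    exact h

lemma red_s_iff {i : Fin N} {w : Sym N} : Red w (s i) ↔ ¬ RD i w := by
  rw [red_iff_pre_star, pre_s_iff, LD, RD]
  simp only [star, mul_inv_rev, inv_inv, Equiv.Perm.mul_apply, w0_inv, w0_lt]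
  constructor
  · exact fun h => h.le.not_gt
  · exact fun h => lt_of_le_of_ne_perm h (Fin.castSucc_lt_succ).ne

lemma ld_mul {i : Fin N} {u c : Sym N} (h : LD i u) (hc : Red u c) : LD i (u * c) :=
  pre_s_iff.1 ((pre_s_iff.2 h).trans (pre_mul_right.2 hc))

lemma red_s_mul {i : Fin N} {w : Sym N} (h : LD i w) : Red (s i) (s i * w) := by
  have := pre_s_iff.2 h
  rwa [Pre, s_inv] at this

lemma exists_ld {w : Sym N} (h : w ≠ 1) : ∃ i, LD i w := by
  by_contra hn
  push Not at hn
  refine h (inv_eq_one.1 (eq_one_of_strictMono fun p q hpq => ?_))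
  have hm : StrictMono (w⁻¹ : Sym N) := Fin.strictMono_iff_lt_succ.2 fun i =>
    lt_of_le_of_ne_perm (hn i) (Fin.castSucc_lt_succ).ne
  exact hm hpq

lemma eq_w0_of_forall_ld {w : Sym N} (h : ∀ i, LD i w) : w = w0 := by
  have h1 : star w⁻¹ = 1 := by
    by_contra hn
    obtain ⟨i, hi⟩ := exists_ld hn
    have := h i
    simp only [LD, star, mul_inv_rev, inv_inv, Equiv.Perm.mul_apply, w0_inv, w0_lt] at hi this
    exact lt_asymm hi this
  simp only [star, inv_inv] at h1
  rw [mul_eq_one_iff_eq_inv, w0_inv] at h1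
  exact h1

/-- Proper suffixes. -/
def Suf (x y : Sym N) : Prop := Red (y * x⁻¹) x ∧ x ≠ y

lemma Suf.trans {x y z : Sym N} (hxy : Suf x y) (hyz : Suf y z) : Suf x z := by
  have := (red_assoc (u := z * y⁻¹) (v := y * x⁻¹) (w := x)).2
    ⟨hxy.1, by simpa using hyz.1⟩
  refine ⟨by simpa [mul_assoc] using this.2, ?_⟩
  rintro rfl
  have h := this.1
  rw [show y * x⁻¹ = (x * y⁻¹)⁻¹ by simp] at h
  exact hyz.2 (mul_inv_eq_one.1 (eq_one_of_red_inv h)).symm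

lemma wellFounded_suf : WellFounded (Suf (N := N)) := by
  have : IsTrans (Sym N) Suf := ⟨fun _ _ _ => Suf.trans⟩
  have : Std.Irrefl (Suf (N := N)) := ⟨fun x hx => hx.2 rfl⟩
  exact Finite.wellFounded_of_trans_of_irrefl _

lemma s_ne_one (i : Fin N) : s i ≠ 1 := by
  intro h
  have := s_castSucc i
  rw [h] at this
  exact (Fin.castSucc_lt_succ).ne this

lemma suf_s_mul {i : Fin N} {w : Sym N} (h : LD i w) : Suf (s i * w) w := by
  refine ⟨?_, fun h' => s_ne_one i (mul_eq_right.1 h')⟩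
  have : w * (s i * w)⁻¹ = s i := by simp [mul_inv_rev, s_inv]
  rw [this]
  exact red_s_mul h

lemma ld_s_mul_of_far {i j : Fin N} (h : (i : ℕ) + 1 < j ∨ (j : ℕ) + 1 < i) {x : Sym N} :
    LD j (s i * x) ↔ LD j x := by
  have h1 : s i j.succ = j.succ := Equiv.swap_apply_of_ne_of_ne
    (by simp [Fin.ext_iff]; omega) (by simp [Fin.ext_iff]; omega)
  have h2 : s i j.castSucc = j.castSucc := Equiv.swap_apply_of_ne_of_ne
    (by simp [Fin.ext_iff]; omega) (by simp [Fin.ext_iff]; omega)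
  simp [LD, mul_inv_rev, s_inv, h1, h2]

lemma s_comm {i j : Fin N} (h : (i : ℕ) + 1 < j ∨ (j : ℕ) + 1 < i) : s i * s j = s j * s i := by
  refine Equiv.Perm.Disjoint.commute ?_
  rw [s, s]
  intro x
  rw [Equiv.swap_apply_def, Equiv.swap_apply_def]
  by_cases h1 : x = i.castSucc ∨ x = i.succ
  · right
    rw [if_neg, if_neg] <;> rcases h1 with rfl | rfl <;> simp [Fin.ext_iff] <;> omega
  · left
    rw [if_neg, if_neg] <;> tauto

section Adjacent

variable {i j : Fin N} (h : (j : ℕ) = i + 1)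

include h

lemma castSucc_of_adj : j.castSucc = i.succ := by simp [Fin.ext_iff, h]

lemma s_succ_of_adj : s i j.succ = j.succ := Equiv.swap_apply_of_ne_of_ne
    (by simp [Fin.ext_iff]; omega) (by simp [Fin.ext_iff]; omega)

lemma s_castSucc_of_adj : s j i.castSucc = i.castSucc := Equiv.swap_apply_of_ne_of_ne
    (by simp [Fin.ext_iff]; omega) (by simp [Fin.ext_iff]; omega)

lemma s_braid : s i * s j * s i = s j * s i * s j := by
  have h1 := castSucc_of_adj h
  have e : s i * s j * (s i)⁻¹ = s j * s i * (s j)⁻¹ := by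
    rw [show s i * s j * (s i)⁻¹ = Equiv.swap (s i j.castSucc) (s i j.succ) from
      (Equiv.swap_apply_apply _ _ _).symm, show s j * s i * (s j)⁻¹ =
      Equiv.swap (s j i.castSucc) (s j i.succ) from (Equiv.swap_apply_apply _ _ _).symm]
    rw [s_succ_of_adj h, s_castSucc_of_adj h, h1, s_succ, ← h1, s_castSucc]
  rwa [s_inv, s_inv] at e

variable {x : Sym N}

lemma ld_right_s_left_mul (hi : LD i x) (hj : LD j x) : LD j (s i * x) := by
  have h1 := castSucc_of_adj h
  rw [LD, h1] at hj
  simp only [LD, mul_inv_rev, s_inv, Equiv.Perm.mul_apply, s_succ_of_adj h, h1, s_succ]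
  exact hj.trans hi

lemma ld_left_s_right_mul (hi : LD i x) (hj : LD j x) : LD i (s j * x) := by
  have h1 := castSucc_of_adj h
  rw [LD, h1] at hj
  simp only [LD, mul_inv_rev, s_inv, Equiv.Perm.mul_apply, s_castSucc_of_adj h, ← h1, s_castSucc]
  rw [LD, ← h1] at hi
  rw [← h1] at hj
  exact hj.trans hi

lemma ld_left_s_s_mul (hj : LD j x) : LD i (s j * (s i * x)) := by
  have h1 := castSucc_of_adj h
  simp only [LD, mul_inv_rev, s_inv, Equiv.Perm.mul_apply, s_castSucc_of_adj h, s_castSucc]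
  rw [← h1, s_castSucc, s_succ_of_adj h]
  exact hj

lemma ld_right_s_s_mul (hi : LD i x) : LD j (s i * (s j * x)) := by
  have h1 := castSucc_of_adj h
  simp only [LD, mul_inv_rev, s_inv, Equiv.Perm.mul_apply, s_succ_of_adj h, s_succ]
  rw [h1, s_succ, s_castSucc_of_adj h]
  exact hi

end Adjacent

lemma pre_s_mul {i : Fin N} {u x : Sym N} (h : LD i x) (hu : Red (s i) u)
    (hp : Pre u (s i * x)) : Pre (s i * u) x := by
  have := (pre_mul_left hu (red_s_mul h)).2 hp
  rwa [← mul_assoc (s i) (s i) x, s_mul_s, one_mul] at this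

lemma red_s_of_pre {i : Fin N} {u x : Sym N} (h : LD i x) (hp : Pre u (s i * x)) : Red (s i) u := by
  rw [red_iff_pre_star]
  exact hp.trans (red_iff_pre_star.1 (red_s_mul h))

lemma pre_s_mul' {i : Fin N} {u x : Sym N} (h : LD i x) (hp : Pre u (s i * x)) :
    Pre (s i * u) x := pre_s_mul h (red_s_of_pre h hp) hp

lemma exists_join_adj {i j : Fin N} (h : (j : ℕ) = i + 1) :
    ∃ v, LD i v ∧ LD j v ∧ ∀ x, LD i x → LD j x → Pre v x := by
  have key : ∀ x, LD i x → LD j x → Pre (s i * (s j * s i)) x := fun x hi hj =>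
    pre_s_mul' hi (pre_s_mul' (ld_right_s_left_mul h hi hj)
      (pre_s_iff.2 (ld_left_s_s_mul h hj)))
  have key' : ∀ x, LD i x → LD j x → Pre (s j * (s i * s j)) x := fun x hi hj =>
    pre_s_mul' hj (pre_s_mul' (ld_left_s_right_mul h hi hj)
      (pre_s_iff.2 (ld_right_s_s_mul h hi)))
  have hi0 : LD i w0 := pre_s_iff.1 (pre_w0 _)
  have hj0 : LD j w0 := pre_s_iff.1 (pre_w0 _)
  refine ⟨s i * (s j * s i), ?_, ?_, key⟩
  · have h1 : Pre (s j * s i) (s i * w0) := pre_s_mul' (ld_right_s_left_mul h hi0 hj0)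
      (pre_s_iff.2 (ld_left_s_s_mul h hj0))
    exact pre_s_iff.1 (pre_mul_right.2 (red_s_of_pre hi0 h1))
  · have h1 : Pre (s i * s j) (s j * w0) := pre_s_mul' (ld_left_s_right_mul h hi0 hj0)
      (pre_s_iff.2 (ld_right_s_s_mul h hi0))
    rw [← mul_assoc, s_braid h, mul_assoc]
    exact pre_s_iff.1 (pre_mul_right.2 (red_s_of_pre hj0 h1))

lemma exists_join (i j : Fin N) : ∃ v, LD i v ∧ LD j v ∧ ∀ x, LD i x → LD j x → Pre v x := by
  have hself : LD i (s i) := pre_s_iff.1 (pre_refl _)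
  rcases lt_trichotomy (i : ℕ) j with hlt | he | hlt
  · rcases Nat.lt_or_ge (i + 1 : ℕ) j with h | h
    · refine ⟨s i * s j, ?_, ?_, fun x hi hj =>
        pre_s_mul' hi (pre_s_iff.2 ((ld_s_mul_of_far (Or.inl h)).2 hj))⟩
      · rw [s_comm (Or.inl h)]
        exact (ld_s_mul_of_far (Or.inr h)).2 hself
      · exact (ld_s_mul_of_far (Or.inl h)).2 (pre_s_iff.1 (pre_refl _))
    · exact exists_join_adj (by omega)
  · obtain rfl := Fin.ext he
    exact ⟨s i, hself, hself, fun x hi _ => pre_s_iff.2 hi⟩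
  · rcases Nat.lt_or_ge (j + 1 : ℕ) i with h | h
    · refine ⟨s i * s j, ?_, ?_, fun x hi hj =>
        pre_s_mul' hi (pre_s_iff.2 ((ld_s_mul_of_far (Or.inr h)).2 hj))⟩
      · rw [s_comm (Or.inr h)]
        exact (ld_s_mul_of_far (Or.inl h)).2 hself
      · exact (ld_s_mul_of_far (Or.inr h)).2 (pre_s_iff.1 (pre_refl _))
    · obtain ⟨v, h1, h2, h3⟩ := exists_join_adj (i := j) (j := i) (by omega)
      exact ⟨v, h2, h1, fun x hi hj => h3 x hj hi⟩

lemma exists_meet (x y : Sym N) : ∃ m, Pre m x ∧ Pre m y ∧ ∀ u, Pre u x → Pre u y → Pre u m := by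
  induction x using wellFounded_suf.induction generalizing y with
  | _ x ih =>
  have hstep : ∀ i, LD i x → LD i y → ∃ m, Pre m x ∧ Pre m y ∧ LD i m ∧
      ∀ u, LD i u → Pre u x → Pre u y → Pre u m := by
    intro i hx hy
    obtain ⟨m, h1, h2, h3⟩ := ih _ (suf_s_mul hx) (s i * y)
    have hr := red_s_of_pre hx h1
    refine ⟨s i * m, pre_s_mul hx hr h1, pre_s_mul hy hr h2, pre_s_iff.1 (pre_mul_right.2 hr), ?_⟩
    intro u hu hux huy
    have hsu : s i * (s i * u) = u := by rw [← mul_assoc, s_mul_s, one_mul]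
    have hs : ∀ z, LD i z → Pre u z → Pre (s i * u) (s i * z) := by
      intro z hz huz
      rw [← pre_mul_left (red_s_mul hu) (red_s_mul hz), hsu, ← mul_assoc, s_mul_s, one_mul]
      exact huz
    have := (pre_mul_left (red_s_mul hu) hr).2 (h3 _ (hs x hx hux) (hs y hy huy))
    rwa [hsu] at this
  by_cases hcom : ∃ i, LD i x ∧ LD i y
  · obtain ⟨i, hix, hiy⟩ := hcom
    obtain ⟨m, hmx, hmy, hmi, hm⟩ := hstep i hix hiy
    refine ⟨m, hmx, hmy, fun u hux huy => ?_⟩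
    by_cases hu : u = 1
    · rw [hu]; exact one_pre m
    obtain ⟨j, hj⟩ := exists_ld hu
    have hjx := pre_s_iff.1 ((pre_s_iff.2 hj).trans hux)
    have hjy := pre_s_iff.1 ((pre_s_iff.2 hj).trans huy)
    obtain ⟨m', hmx', hmy', hmj', hm'⟩ := hstep j hjx hjy
    obtain ⟨v, hvi, hvj, hv⟩ := exists_join i j
    have : LD i m' := pre_s_iff.1 ((pre_s_iff.2 hvi).trans
      (hm' v hvj (hv x hix hjx) (hv y hiy hjy)))
    exact (hm' u hj hux huy).trans (hm m' this hmx' hmy')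
  · refine ⟨1, one_pre _, one_pre _, fun u hux huy => ?_⟩
    by_cases hu : u = 1
    · rw [hu]; exact one_pre 1
    obtain ⟨j, hj⟩ := exists_ld hu
    exact absurd ⟨j, pre_s_iff.1 ((pre_s_iff.2 hj).trans hux),
      pre_s_iff.1 ((pre_s_iff.2 hj).trans huy)⟩ hcom

end Braid

/-- Maps that become invertible after inverting a central injective map act by permutations on
a larger set. -/
theorem exists_perm_extension {X I : Type} (ζ : X → X) (hζ : Function.Injective ζ)
    (a c : I → X → X) (hac : ∀ i x, a i (c i x) = ζ x) (hca : ∀ i x, c i (a i x) = ζ x) :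
    ∃ (Y : Type) (j : X → Y) (e : I → Equiv.Perm Y), Function.Injective j ∧
      (∀ (l : List I) x, (l.map e).prod (j x) = j (l.foldr a x)) ∧
      ∀ l l' : List I, (∀ x, l.foldr a x = l'.foldr a x) → (l.map e).prod = (l'.map e).prod := by
  have ha : ∀ i, Function.Commute (a i) ζ := fun i x => by rw [← hca i x, hac]
  have hc : ∀ i, Function.Commute (c i) ζ := fun i x => by rw [← hac i x, hca]
  let S : Setoid (X × ℕ) :=
    { r := fun p q => ζ^[q.2] p.1 = ζ^[p.2] q.1
      iseqv :=
        { refl := fun p => rfl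
          symm := fun h => h.symm
          trans := by
            rintro ⟨x, m⟩ ⟨y, n⟩ ⟨z, p⟩ h1 h2
            simp only at h1 h2 ⊢
            refine hζ.iterate n ?_
            rw [← Function.iterate_add_apply, ← Function.iterate_add_apply, add_comm,
              Function.iterate_add_apply, h1, ← Function.iterate_add_apply, add_comm n m,
              Function.iterate_add_apply ζ m n, ← h2, ← Function.iterate_add_apply, add_comm] } }
  let e : I → Equiv.Perm (Quotient S) := fun i =>
    { toFun := Quotient.map (fun p => (a i p.1, p.2)) (by
        rintro ⟨x, m⟩ ⟨y, n⟩ (h : ζ^[n] x = ζ^[m] y)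
        change ζ^[n] (a i x) = ζ^[m] (a i y)
        rw [← (ha i).iterate_right n x, h, (ha i).iterate_right m y])
      invFun := Quotient.map (fun p => (c i p.1, p.2 + 1)) (by
        rintro ⟨x, m⟩ ⟨y, n⟩ (h : ζ^[n] x = ζ^[m] y)
        change ζ^[n + 1] (c i x) = ζ^[m + 1] (c i y)
        rw [Function.iterate_succ_apply', Function.iterate_succ_apply',
          ← (hc i).iterate_right n x, h, (hc i).iterate_right m y])
      left_inv := by
        rintro ⟨x, m⟩
        refine Quotient.sound ?_
        change ζ^[m] (c i (a i x)) = ζ^[m + 1] x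
        rw [hca, Function.iterate_succ_apply]
      right_inv := by
        rintro ⟨x, m⟩
        refine Quotient.sound ?_
        change ζ^[m] (a i (c i x)) = ζ^[m + 1] x
        rw [hac, Function.iterate_succ_apply] }
  have he : ∀ (l : List I) x m, (l.map e).prod (Quotient.mk S (x, m)) =
      Quotient.mk S (l.foldr a x, m) := by
    intro l x m
    induction l with
    | nil => rfl
    | cons i l ih =>
      rw [List.map_cons, List.prod_cons, Equiv.Perm.mul_apply, ih]
      rfl
  refine ⟨Quotient S, fun x => Quotient.mk S (x, 0), e, ?_, fun l x => he l x 0, ?_⟩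
  · intro x y h
    exact Quotient.exact h
  · intro l l' h
    ext ⟨x, m⟩
    exact (he l x m).trans ((congrArg _ (by rw [h])).trans (he l' x m).symm)

namespace Braid

variable {N : ℕ}

/-- The largest prefix of `w` that can be appended to `u`. -/
noncomputable def mt (u w : Sym N) : Sym N := (exists_meet w (star u)).choose

lemma mt_pre (u w : Sym N) : Pre (mt u w) w := (exists_meet w (star u)).choose_spec.1

lemma red_mt (u w : Sym N) : Red u (mt u w) :=
  red_iff_pre_star.2 (exists_meet w (star u)).choose_spec.2.1

lemma pre_mt {u w r : Sym N} (h : Pre r w) (hr : Red u r) : Pre r (mt u w) :=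
  (exists_meet w (star u)).choose_spec.2.2 r h (red_iff_pre_star.1 hr)

lemma mt_eq_right {u v : Sym N} (h : Red u v) : mt u v = v :=
  (mt_pre u v).antisymm (pre_mt (pre_refl v) h)

/-- The new first letter when the letter `u` is multiplied to a word starting with `w`. -/
noncomputable def al (u w : Sym N) : Sym N := u * mt u w

/-- The letter carried over when `u` is multiplied to a word starting with `w`. -/
noncomputable def nx (u w : Sym N) : Sym N := (mt u w)⁻¹ * w

/-- The pair `u`, `w` is left weighted: no nontrivial prefix of `w` can be moved to `u`. -/
def Weighted (u w : Sym N) : Prop := mt u w = 1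

lemma weighted_iff {u w : Sym N} : Weighted u w ↔ ∀ i, LD i w → RD i u := by
  constructor
  · intro h i hi
    by_contra hn
    have := pre_mt (pre_s_iff.2 hi) (red_s_iff.2 hn)
    rw [h] at this
    exact s_ne_one i (eq_one_of_pre_one this)
  · intro h
    by_contra hn
    obtain ⟨i, hi⟩ := exists_ld hn
    have hp := pre_s_iff.2 hi
    have h1 := h i (pre_s_iff.1 (hp.trans (mt_pre u w)))
    exact red_s_iff.1 (red_iff_pre_star.2 (hp.trans (red_iff_pre_star.1 (red_mt u w)))) h1

lemma mt_mul {u v w : Sym N} (h : Red u v) : mt u (al v w) = v * mt (u * v) w := by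
  have hvt := red_mt v w
  obtain ⟨h1, h2⟩ := red_assoc.1 ⟨h, red_mt (u * v) w⟩
  refine Pre.antisymm ?_ (pre_mt ((pre_mul_left h1 hvt).2 (pre_mt (mt_pre _ _) h1)) h2)
  have hv : Pre v (mt u (al v w)) := pre_mt (pre_mul_right.2 hvt) h
  obtain ⟨t, ht⟩ : ∃ t, mt u (al v w) = v * t := ⟨v⁻¹ * mt u (al v w), by simp⟩
  rw [ht, pre_mul_right] at hv
  have hp := mt_pre u (al v w)
  have hr := red_mt u (al v w)
  rw [ht] at hp hr ⊢
  rw [al, pre_mul_left hv hvt] at hp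
  obtain ⟨h3, h4⟩ := red_assoc.2 ⟨hv, hr⟩
  exact (pre_mul_left hv h1).2 (pre_mt (hp.trans (mt_pre v w)) h4)

lemma al_al {u v w : Sym N} (h : Red u v) : al u (al v w) = al (u * v) w := by
  rw [al, mt_mul h, al, mul_assoc]

lemma nx_mul_nx {u v w : Sym N} (h : Red u v) : nx u (al v w) * nx v w = nx (u * v) w := by
  rw [nx, mt_mul h, al, nx, nx]
  group

lemma red_of_pre_of_pre {a b c : Sym N} (h1 : Pre a b) (h2 : Pre b c) :
    Red (a⁻¹ * b) (b⁻¹ * c) :=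
  ((red_assoc (u := a) (v := a⁻¹ * b) (w := b⁻¹ * c)).1
    ⟨h1, by simpa [Pre, ← mul_assoc] using h2⟩).1

lemma red_nx_nx {u v w : Sym N} (h : Red u v) : Red (nx u (al v w)) (nx v w) := by
  have hp : Pre (mt (u * v) w) (mt v w) :=
    pre_mt (mt_pre _ _) (red_assoc.1 ⟨h, red_mt (u * v) w⟩).1
  have := red_of_pre_of_pre hp (mt_pre v w)
  rwa [nx, nx, mt_mul h, al, show (v * mt (u * v) w)⁻¹ * (v * mt v w) =
    (mt (u * v) w)⁻¹ * mt v w by group]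

lemma mt_one_right (u : Sym N) : mt u 1 = 1 := eq_one_of_pre_one (mt_pre u 1)

lemma mt_one_left (w : Sym N) : mt 1 w = w := mt_eq_right (red_one_left w)

lemma al_one (u : Sym N) : al u 1 = u := by rw [al, mt_one_right, mul_one]

lemma weighted_one (u : Sym N) : Weighted u 1 := mt_one_right u

lemma Weighted.al {c w w' : Sym N} (h : Weighted w w') :
    Weighted (al c w) (al (nx c w) w') := by
  set t := mt c w with ht
  have htc : Red t (nx c w) := mt_pre c w
  have hw : t * nx c w = w := by simp [nx, ht]
  have h1 : mt t (Braid.al (nx c w) w') = nx c w := by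
    rw [mt_mul htc, hw, h, mul_one]
  set r := mt (Braid.al c w) (Braid.al (nx c w) w') with hr
  obtain ⟨h2, h3⟩ := red_assoc.1 ⟨red_mt c w, red_mt (Braid.al c w) (Braid.al (nx c w) w')⟩
  have h4 : Pre r (nx c w) := h1 ▸ pre_mt (mt_pre _ _) h2
  have h5 : Pre (t * r) w := by
    have := (pre_mul_left h2 htc).2 h4
    rwa [hw] at this
  have h6 : Pre (t * r) (t * 1) := by
    rw [mul_one]
    exact pre_mt h5 h3
  exact eq_one_of_pre_one ((pre_mul_left h2 (red_one_right t)).1 h6)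

lemma al_ne_one {u w : Sym N} (hw : w ≠ 1) : al u w ≠ 1 := by
  intro h
  have h1 := (red_mt u w).eq_one h
  rw [al, h1, mt_one_left, one_mul] at h
  exact hw h

/-- Left weighted words without trivial letters. -/
def WC (l : List (Sym N)) : Prop := l.IsChain Weighted ∧ 1 ∉ l

/-- The first letter of a word, or `1` if there is none. -/
def hd (l : List (Sym N)) : Sym N := l.headD 1

open Classical in
/-- The left weighted form of the word `u :: l`. -/
noncomputable def run : Sym N → List (Sym N) → List (Sym N)
  | u, [] => if u = 1 then [] else [u]
  | u, w :: l => al u w :: run (nx u w) l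

lemma hd_run (u : Sym N) (l : List (Sym N)) : hd (run u l) = al u (hd l) := by
  cases l with
  | nil =>
    by_cases h : u = 1 <;> simp [run, hd, h, al_one]
  | cons w l => rfl

lemma wc_cons {w : Sym N} {l : List (Sym N)} : WC (w :: l) ↔ w ≠ 1 ∧ Weighted w (hd l) ∧ WC l := by
  cases l with
  | nil => simp [WC, hd, weighted_one, eq_comm]
  | cons x l =>
    simp only [WC, List.isChain_cons_cons, List.mem_cons, not_or, hd, List.headD_cons, ne_eq,
      eq_comm (a := (1 : Sym N)) (b := w)]
    tauto

lemma wc_nil : WC ([] : List (Sym N)) := ⟨List.IsChain.nil, by simp⟩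

lemma WC.run {l : List (Sym N)} (h : WC l) (u : Sym N) : WC (run u l) := by
  induction l generalizing u with
  | nil =>
    by_cases hu : u = 1
    · simpa [Braid.run, hu] using wc_nil
    · simp only [Braid.run, hu, if_false]
      exact wc_cons.2 ⟨hu, weighted_one _, wc_nil⟩
  | cons w l ih =>
    obtain ⟨h1, h2, h3⟩ := wc_cons.1 h
    exact wc_cons.2 ⟨al_ne_one h1, by rw [hd_run]; exact h2.al, ih h3 _⟩

lemma run_run {u v : Sym N} (h : Red u v) (l : List (Sym N)) : run u (run v l) = run (u * v) l := by
  induction l generalizing u v with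
  | nil =>
    by_cases hv : v = 1
    · simp [run, hv]
    · have huv : u * v ≠ 1 := fun h1 => hv (by simpa [h.eq_one h1] using h1)
      simp [run, hv, huv, al, nx, mt_eq_right h]
  | cons w l ih =>
    rw [run, run, run, al_al h, ih (red_nx_nx h), nx_mul_nx h]

lemma run_eq_cons {w : Sym N} {l : List (Sym N)} (h : WC (w :: l)) : run w l = w :: l := by
  induction l generalizing w with
  | nil => simp [run, (wc_cons.1 h).1]
  | cons x l ih =>
    obtain ⟨h1, h2, h3⟩ := wc_cons.1 h
    have h2 : mt w x = 1 := h2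
    simp [run, al, nx, h2, ih h3]

lemma foldr_run {l : List (Sym N)} (h : WC l) : l.foldr run [] = l := by
  induction l with
  | nil => rfl
  | cons w l ih => rw [List.foldr_cons, ih (wc_cons.1 h).2.2, run_eq_cons h]

lemma weighted_w0 (w : Sym N) : Weighted w0 w := by
  have := red_iff_pre_star.1 (red_mt w0 w)
  rw [star_w0] at this
  exact eq_one_of_pre_one this

lemma w0_ne_one [NeZero N] : (w0 : Sym N) ≠ 1 := by
  intro h
  have : Pre (s (0 : Fin N)) 1 := h ▸ pre_w0 _
  exact s_ne_one _ (eq_one_of_pre_one this)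

lemma wc_w0_cons [NeZero N] {l : List (Sym N)} (h : WC l) : WC (w0 :: l) :=
  wc_cons.2 ⟨w0_ne_one, weighted_w0 _, h⟩

lemma run_w0 [NeZero N] {l : List (Sym N)} (h : WC l) : run w0 l = w0 :: l :=
  run_eq_cons (wc_w0_cons h)

/-- The conjugation by the longest permutation. -/
def tau (w : Sym N) : Sym N := w0 * w * w0

lemma star_star (w : Sym N) : star (star w) = tau w := by
  simp [star, tau, mul_inv_rev, w0_inv]

lemma al_w0 (u : Sym N) : al u w0 = w0 := by
  have : mt u w0 = star u :=
    (red_iff_pre_star.1 (red_mt u w0)).antisymm (pre_mt (pre_w0 _) (red_star u))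
  rw [al, this, mul_star]

lemma nx_w0 (u : Sym N) : nx u w0 = tau u := by
  have : mt u w0 = star u :=
    (red_iff_pre_star.1 (red_mt u w0)).antisymm (pre_mt (pre_w0 _) (red_star u))
  rw [nx, this, ← star_star]
  rfl

lemma tau_tau (w : Sym N) : tau (tau w) = w := by
  simp only [tau, mul_assoc, w0_mul_w0, mul_one]
  rw [← mul_assoc, w0_mul_w0, one_mul]

lemma tau_star (w : Sym N) : tau (star w) = star (tau w) := by
  rw [← star_star, ← star_star, star_star]

/-- The Artin generators. -/
def sg (i : Fin N) : BraidGroup (N + 1) := (PresentedGroup.of i : PresentedGroup (braidRels (N + 1)))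

lemma sg_comm {i j : Fin N} (h : (i : ℕ) + 1 < j ∨ (j : ℕ) + 1 < i) :
    sg i * sg j = sg j * sg i := by
  have : FreeGroup.of i * FreeGroup.of j * (FreeGroup.of j * FreeGroup.of i)⁻¹ ∈
      braidRels (N + 1) := Or.inl ⟨i, j, by omega, rfl⟩
  exact PresentedGroup.mk_eq_mk_of_mul_inv_mem this

lemma sg_braid {i j : Fin N} (h : (j : ℕ) = i + 1) :
    sg i * sg j * sg i = sg j * sg i * sg j := by
  have : FreeGroup.of i * FreeGroup.of j * FreeGroup.of i *
      (FreeGroup.of j * FreeGroup.of i * FreeGroup.of j)⁻¹ ∈ braidRels (N + 1) :=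
    Or.inr ⟨i, j, h, rfl⟩
  exact PresentedGroup.mk_eq_mk_of_mul_inv_mem this

lemma exists_braid_hom {H : Type} [Group H] (f : Fin N → H)
    (h1 : ∀ i j : Fin N, (i : ℕ) + 1 < j ∨ (j : ℕ) + 1 < i → f i * f j = f j * f i)
    (h2 : ∀ i j : Fin N, (j : ℕ) = i + 1 → f i * f j * f i = f j * f i * f j) :
    ∃ φ : BraidGroup (N + 1) →* H, ∀ i, φ (sg i) = f i := by
  have h : ∀ r ∈ braidRels (N + 1), FreeGroup.lift f r = 1 := by
    rintro r (⟨i, j, hij, rfl⟩ | ⟨i, j, hij, rfl⟩)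
    · have e := h1 i j (by omega)
      simp only [map_mul, map_inv, FreeGroup.lift_apply_of]
      exact mul_inv_eq_one.2 e
    · have e := h2 i j hij
      simp only [map_mul, map_inv, FreeGroup.lift_apply_of]
      exact mul_inv_eq_one.2 e
  exact ⟨PresentedGroup.toGroup h, fun i => PresentedGroup.toGroup.of h⟩

lemma closure_sg : Subgroup.closure (range (sg (N := N))) = ⊤ :=
  PresentedGroup.closure_range_of (braidRels (N + 1))

open Classical in
/-- The positive lift of a permutation to the braid group. -/
noncomputable def lift : Sym N → BraidGroup (N + 1) :=
  wellFounded_suf.fix fun w f => if h : w = 1 then 1 else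
    sg (exists_ld h).choose * f _ (suf_s_mul (exists_ld h).choose_spec)

lemma lift_one : lift (1 : Sym N) = 1 := by
  rw [lift, WellFounded.fix_eq]
  simp

lemma exists_lift_eq {w : Sym N} (h : w ≠ 1) : ∃ i, LD i w ∧ lift w = sg i * lift (s i * w) := by
  refine ⟨_, (exists_ld h).choose_spec, ?_⟩
  rw [lift, WellFounded.fix_eq]
  simp [h]

lemma s_mul_s_mul (i : Fin N) (w : Sym N) : s i * (s i * w) = w := by
  rw [← mul_assoc, s_mul_s, one_mul]

lemma lift_of_ld {w : Sym N} {i : Fin N} (hi : LD i w) : lift w = sg i * lift (s i * w) := by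
  induction w using wellFounded_suf.induction generalizing i with
  | _ w ih =>
  have hne : w ≠ 1 := by
    rintro rfl
    exact s_ne_one i (eq_one_of_pre_one (pre_s_iff.2 hi))
  have adj : ∀ i j : Fin N, (j : ℕ) = i + 1 → LD i w → LD j w →
      sg i * lift (s i * w) = sg j * lift (s j * w) := by
    intro i j h hi hj
    have h1 := ld_right_s_left_mul h hi hj
    have h2 := ld_left_s_right_mul h hi hj
    have k1 := suf_s_mul hi
    have k2 := suf_s_mul hj
    rw [ih _ k1 h1, ih _ ((suf_s_mul h1).trans k1) (ld_left_s_s_mul h hj), ih _ k2 h2,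
      ih _ ((suf_s_mul h2).trans k2) (ld_right_s_s_mul h hi)]
    simp only [← mul_assoc]
    rw [sg_braid h, s_braid h]
  obtain ⟨k, hk, e⟩ := exists_lift_eq hne
  rw [e]
  have far : (i : ℕ) + 1 < k ∨ (k : ℕ) + 1 < i →
      sg k * lift (s k * w) = sg i * lift (s i * w) := by
    intro h
    rw [ih _ (suf_s_mul hk) ((ld_s_mul_of_far h.symm).2 hi),
      ih _ (suf_s_mul hi) ((ld_s_mul_of_far h).2 hk)]
    simp only [← mul_assoc]
    rw [sg_comm h, s_comm h]
  rcases lt_trichotomy (i : ℕ) k with h | h | h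
  · rcases Nat.lt_or_ge (i + 1 : ℕ) k with h' | h'
    · exact far (Or.inl h')
    · exact (adj i k (by omega) hi hk).symm
  · obtain rfl := Fin.ext h
    rfl
  · rcases Nat.lt_or_ge (k + 1 : ℕ) i with h' | h'
    · exact far (Or.inr h')
    · exact adj k i (by omega) hk hi

lemma lift_mul {u v : Sym N} (h : Red u v) : lift (u * v) = lift u * lift v := by
  induction u using wellFounded_suf.induction with
  | _ u ih =>
  by_cases hu : u = 1
  · simp [hu, lift_one]
  obtain ⟨i, hi⟩ := exists_ld hu
  have hr : Red (s i * u) v :=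
    (red_assoc.1 ⟨red_s_mul hi, by rwa [s_mul_s_mul]⟩).1
  rw [lift_of_ld hi, lift_of_ld (ld_mul hi h), ← mul_assoc (s i), ih _ (suf_s_mul hi) hr, mul_assoc]

lemma lift_s (i : Fin N) : lift (s i) = sg i := by
  rw [lift_of_ld (pre_s_iff.1 (pre_refl (s i))), s_mul_s, lift_one, mul_one]

/-- The Garside element. -/
noncomputable def delta : BraidGroup (N + 1) := lift w0

lemma lift_mul_lift_star (w : Sym N) : lift w * lift (star w) = delta := by
  rw [← lift_mul (red_star w), mul_star, delta]

lemma lift_mul_delta (w : Sym N) : lift w * delta = delta * lift (tau w) := by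
  rw [← star_star, ← lift_mul_lift_star w, mul_assoc, lift_mul_lift_star, lift_mul_lift_star]

lemma delta_sq_comm (g : BraidGroup (N + 1)) : delta * delta * g = g * (delta * delta) := by
  have hg : g ∈ Subgroup.closure (range (sg (N := N))) := closure_sg ▸ Subgroup.mem_top g
  have : Subgroup.closure (range (sg (N := N))) ≤
      Subgroup.centralizer {(delta * delta : BraidGroup (N + 1))} := by
    rw [Subgroup.closure_le]
    rintro _ ⟨i, rfl⟩
    rw [SetLike.mem_coe, Subgroup.mem_centralizer_singleton_iff, ← lift_s, ← mul_assoc,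
      lift_mul_delta, mul_assoc, lift_mul_delta, tau_tau, mul_assoc]
  exact (Subgroup.mem_centralizer_singleton_iff.1 (this hg)).symm

lemma exists_weight : ∃ φ : BraidGroup (N + 1) →* Multiplicative ℤ,
    ∀ i, φ (sg i) = Multiplicative.ofAdd 1 :=
  exists_braid_hom _ (fun _ _ _ => rfl) (fun _ _ _ => rfl)

lemma weight_lift {φ : BraidGroup (N + 1) →* Multiplicative ℤ}
    (h : ∀ i, φ (sg i) = Multiplicative.ofAdd 1) (w : Sym N) :
    0 ≤ (φ (lift w)).toAdd ∧ (w ≠ 1 → 0 < (φ (lift w)).toAdd) := by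
  induction w using wellFounded_suf.induction with
  | _ w ih =>
  by_cases hw : w = 1
  · simp [hw, lift_one]
  obtain ⟨i, hi⟩ := exists_ld hw
  have := (ih _ (suf_s_mul hi)).1
  rw [lift_of_ld hi, map_mul, h, toAdd_mul, toAdd_ofAdd]
  exact ⟨by omega, fun _ => by omega⟩

lemma run_one (l : List (Sym N)) : run 1 l = l := by
  induction l with
  | nil => simp [run]
  | cons b l ih => simp [run, al, nx, mt_one_left, ih]

/-- Positive lifts are positive words. -/
lemma exists_word (w : Sym N) : ∃ m : List (Fin N), lift w = (m.map sg).prod ∧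
    ∀ l, run w l = m.foldr (fun i => run (s i)) l := by
  induction w using wellFounded_suf.induction with
  | _ w ih =>
  by_cases hw : w = 1
  · exact ⟨[], by simp [hw, lift_one], fun l => by simp [hw, run_one]⟩
  obtain ⟨i, hi⟩ := exists_ld hw
  obtain ⟨m, h1, h2⟩ := ih _ (suf_s_mul hi)
  refine ⟨i :: m, by rw [lift_of_ld hi, h1]; simp, fun l => ?_⟩
  rw [List.foldr_cons, ← h2 l, run_run (red_s_mul hi), s_mul_s_mul]

/-- The braid represented by a word of permutations. -/
noncomputable def br (l : List (Sym N)) : BraidGroup (N + 1) := (l.map lift).prod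

lemma br_nil : br ([] : List (Sym N)) = 1 := rfl

lemma br_cons (w : Sym N) (l : List (Sym N)) : br (w :: l) = lift w * br l := by simp [br]

lemma br_append (l l' : List (Sym N)) : br (l ++ l') = br l * br l' := by simp [br]

lemma red_s_s {i j : Fin N} (h : i ≠ j) : Red (s i) (s j) :=
  red_s_iff.2 fun hr => h
    (Fin.castSucc_injective _ (eq_of_s_lt Fin.castSucc_lt_succ hr).1).symm

lemma red_s_s_mul_s {i j : Fin N} (h : (j : ℕ) = i + 1) : Red (s i) (s j * s i) := by
  have hne : i ≠ j := fun e => by rw [e] at h; omega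
  have h1 := castSucc_of_adj h
  refine (red_assoc.1 ⟨red_s_s hne, red_s_iff.2 ?_⟩).2
  rw [RD, Equiv.Perm.mul_apply, Equiv.Perm.mul_apply, s_castSucc_of_adj h, ← h1, s_castSucc,
    s_castSucc, s_succ_of_adj h]
  rw [Fin.lt_def]
  simp
  omega

lemma red_s_s_mul_s' {i j : Fin N} (h : (j : ℕ) = i + 1) : Red (s j) (s i * s j) := by
  have hne : j ≠ i := fun e => by rw [e] at h; omega
  have h1 := castSucc_of_adj h
  refine (red_assoc.1 ⟨red_s_s hne, red_s_iff.2 ?_⟩).2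
  rw [RD, Equiv.Perm.mul_apply, Equiv.Perm.mul_apply, s_succ_of_adj h, s_succ, h1, s_succ,
    s_castSucc_of_adj h]
  exact Fin.castSucc_lt_succ.not_gt

lemma red_tau_star (v : Sym N) : Red (tau (star v)) v := by
  rw [red_iff_pre_star, ← tau_star, star_star, tau_tau]
  exact pre_refl v

lemma tau_star_mul (v : Sym N) : tau (star v) * v = w0 := by
  simp [tau, star, mul_assoc, w0_mul_w0]

lemma exists_word_list (l : List (Sym N)) : ∃ m : List (Fin N), br l = (m.map sg).prod ∧
    ∀ x, l.foldr run x = m.foldr (fun i => run (s i)) x := by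
  induction l with
  | nil => exact ⟨[], rfl, fun x => rfl⟩
  | cons w l ih =>
    obtain ⟨m, h1, h2⟩ := ih
    obtain ⟨m', h1', h2'⟩ := exists_word w
    refine ⟨m' ++ m, by rw [br_cons, h1, h1', List.map_append, List.prod_append], fun x => ?_⟩
    rw [List.foldr_cons, h2, h2', List.foldr_append]

lemma foldr_subtype (m : List (Fin N)) (x : {l : List (Sym N) // WC l}) :
    (m.foldr (fun i x => (⟨run (s i) x.1, x.2.run _⟩ : {l : List (Sym N) // WC l})) x).1 =
      m.foldr (fun i => run (s i)) x.1 := by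
  induction m with
  | nil => rfl
  | cons i m ih => rw [List.foldr_cons, List.foldr_cons, ← ih]

theorem eq_of_br_eq [NeZero N] {l l' : List (Sym N)} (hl : WC l) (hl' : WC l')
    (h : br l = br l') : l = l' := by
  let X := {l : List (Sym N) // WC l}
  let a : Fin N → X → X := fun i x => ⟨run (s i) x.1, x.2.run _⟩
  let ζ : X → X := fun x => ⟨w0 :: w0 :: x.1, wc_w0_cons (wc_w0_cons x.2)⟩
  let c : Fin N → X → X := fun i x => ⟨run (star (s i)) (w0 :: x.1), (wc_w0_cons x.2).run _⟩
  obtain ⟨Y, j, e, hj, h1, h2⟩ := exists_perm_extension ζ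
    (fun x y hxy => Subtype.ext (by
      have := congrArg Subtype.val hxy
      simpa [ζ] using this)) a c
    (fun i x => Subtype.ext (by
      simp only [a, c, ζ]
      rw [run_run (red_star _), mul_star, run_w0 (wc_w0_cons x.2)]))
    (fun i x => Subtype.ext (by
      simp only [a, c, ζ]
      rw [run, al_w0, nx_w0, run_run (red_tau_star _), tau_star_mul, run_w0 x.2]))
  obtain ⟨φ, hφ⟩ := exists_braid_hom e
    (fun i j hij => by
      have hne : i ≠ j := fun e => by rw [e] at hij; omega
      have := h2 [i, j] [j, i] fun x => Subtype.ext (by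
        simp only [List.foldr_cons, List.foldr_nil, a]
        rw [run_run (red_s_s hne), run_run (red_s_s hne.symm), s_comm hij])
      simpa using this)
    (fun i j hij => by
      have hne : i ≠ j := fun e => by rw [e] at hij; omega
      have := h2 [i, j, i] [j, i, j] fun x => Subtype.ext (by
        simp only [List.foldr_cons, List.foldr_nil, a]
        rw [run_run (red_s_s hne.symm) x.1, run_run (red_s_s hne) x.1, run_run (red_s_s_mul_s hij),
          run_run (red_s_s_mul_s' hij), ← mul_assoc, ← mul_assoc, s_braid hij])
      simpa [mul_assoc] using this)
  obtain ⟨m, hm1, hm2⟩ := exists_word_list l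
  obtain ⟨m', hm1', hm2'⟩ := exists_word_list l'
  rw [hm1, hm1'] at h
  have hmap : ∀ m : List (Fin N), φ (m.map sg).prod = (m.map e).prod := fun m => by
    rw [map_list_prod, List.map_map]
    congr 2
    funext i
    exact hφ i
  have h3 := congrArg φ h
  rw [hmap, hmap] at h3
  have h4 : j (m.foldr a ⟨[], wc_nil⟩) = j (m'.foldr a ⟨[], wc_nil⟩) := by
    rw [← h1, ← h1, h3]
  have h5 := congrArg Subtype.val (hj h4)
  rw [foldr_subtype, foldr_subtype] at h5
  simp only at h5
  rwa [← hm2, ← hm2', foldr_run hl, foldr_run hl'] at h5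

lemma w0_castSucc (i : Fin N) : (w0 : Sym N) i.castSucc = i.rev.succ := Fin.rev_castSucc i

lemma w0_succ (i : Fin N) : (w0 : Sym N) i.succ = i.rev.castSucc := Fin.rev_succ i

lemma tau_inv (w : Sym N) : (tau w)⁻¹ = tau w⁻¹ := by simp [tau, mul_inv_rev, w0_inv, mul_assoc]

lemma tau_apply (w : Sym N) (p : Fin (N + 1)) : tau w p = w0 (w (w0 p)) := rfl

lemma ld_tau {i : Fin N} {w : Sym N} : LD i (tau w) ↔ LD i.rev w := by
  rw [LD, tau_inv, tau_apply, tau_apply, w0_lt, w0_castSucc, w0_succ, LD]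

lemma rd_tau {i : Fin N} {w : Sym N} : RD i (tau w) ↔ RD i.rev w := by
  rw [RD, tau_apply, tau_apply, w0_lt, w0_castSucc, w0_succ, RD]

lemma ld_star {i : Fin N} {w : Sym N} : LD i (star w) ↔ ¬ RD i w := by
  simp only [LD, RD, star, mul_inv_rev, inv_inv, Equiv.Perm.mul_apply, w0_inv, w0_lt]
  constructor
  · exact fun h => h.not_gt
  · exact fun h => lt_of_le_of_ne_perm h Fin.castSucc_lt_succ.ne

lemma rd_star {i : Fin N} {w : Sym N} : RD i (star w) ↔ ¬ LD i.rev w := by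
  have := ld_star (i := i) (w := star w)
  rw [star_star, ld_tau] at this
  tauto

lemma tau_injective : Function.Injective (tau (N := N)) :=
  Function.LeftInverse.injective tau_tau

lemma tau_one : tau (1 : Sym N) = 1 := by simp [tau, w0_mul_w0]

lemma tau_w0 : tau (w0 : Sym N) = w0 := by simp [tau, w0_mul_w0]

lemma weighted_tau {u w : Sym N} : Weighted (tau u) (tau w) ↔ Weighted u w := by
  simp only [weighted_iff, ld_tau, rd_tau]
  exact ⟨fun h i hi => by simpa using h i.rev (by simpa using hi), fun h i => h _⟩

lemma WC.map_tau {l : List (Sym N)} (h : WC l) : WC (l.map tau) := by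
  refine ⟨?_, ?_⟩
  · rw [List.isChain_map]
    exact h.1.imp fun a b hab => weighted_tau.2 hab
  · rw [← tau_one, List.mem_map_of_injective tau_injective]
    exact h.2

/-- Left weighted words without trivial letters and without the longest permutation. -/
def NF (l : List (Sym N)) : Prop := WC l ∧ w0 ∉ l

lemma nf_nil : NF ([] : List (Sym N)) := ⟨wc_nil, by simp⟩

lemma NF.map_tau {l : List (Sym N)} (h : NF l) : NF (l.map tau) := by
  refine ⟨h.1.map_tau, ?_⟩
  rw [← tau_w0, List.mem_map_of_injective tau_injective]
  exact h.2

lemma star_eq_one {w : Sym N} (h : star w = 1) : w = w0 := by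
  rw [← mul_star w, h, mul_one]

lemma WC.nf_of_hd_ne {l : List (Sym N)} (h : WC l) (hl : hd l ≠ w0) : NF l := by
  refine ⟨h, ?_⟩
  induction l with
  | nil => simp
  | cons w l ih =>
    obtain ⟨h1, h2, h3⟩ := wc_cons.1 h
    rw [List.mem_cons, not_or]
    refine ⟨fun e => hl e.symm, ih h3 fun e => hl ?_⟩
    rw [e] at h2
    have h4 : mt w w0 = star w :=
      (red_iff_pre_star.1 (red_mt w w0)).antisymm (pre_mt (pre_w0 _) (red_star w))
    have h2 : mt w w0 = 1 := h2
    exact star_eq_one (h4 ▸ h2)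

lemma br_mul_delta (l : List (Sym N)) : br l * delta = delta * br (l.map tau) := by
  induction l with
  | nil => simp [br_nil]
  | cons w l ih => rw [br_cons, mul_assoc, ih, ← mul_assoc, lift_mul_delta, List.map_cons, br_cons,
      mul_assoc]

lemma map_tau_tau (l : List (Sym N)) : (l.map tau).map tau = l := by
  rw [List.map_map, show tau ∘ tau = (id : Sym N → Sym N) from funext tau_tau, List.map_id]

lemma delta_mul_br (l : List (Sym N)) : delta * br l = br (l.map tau) * delta := by
  rw [br_mul_delta, map_tau_tau]

lemma delta_inv_mul_br (l : List (Sym N)) : delta⁻¹ * br l = br (l.map tau) * delta⁻¹ := by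
  rw [inv_mul_eq_iff_eq_mul, ← mul_assoc, delta_mul_br, map_tau_tau, mul_inv_cancel_right]

lemma br_run (u : Sym N) (l : List (Sym N)) : br (run u l) = lift u * br l := by
  induction l generalizing u with
  | nil =>
    by_cases hu : u = 1 <;> simp [run, hu, br_nil, br_cons, lift_one]
  | cons w l ih =>
    rw [run, br_cons, br_cons, ih, al, lift_mul (red_mt u w), mul_assoc, ← mul_assoc (lift (mt u w)),
      ← lift_mul (u := mt u w) (v := nx u w) (mt_pre u w), nx, mul_inv_cancel_left]

lemma WC.exists_nf {l : List (Sym N)} (h : WC l) :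
    ∃ l' k, NF l' ∧ br l = br l' * delta ^ (k : ℤ) := by
  induction l with
  | nil => exact ⟨[], 0, nf_nil, by simp⟩
  | cons w l ih =>
    by_cases hw : w = w0
    · obtain ⟨l', k, h1, h2⟩ := ih (wc_cons.1 h).2.2
      refine ⟨l'.map tau, 1 + k, h1.map_tau, ?_⟩
      rw [br_cons, h2, hw, ← mul_assoc, zpow_add, zpow_one, ← mul_assoc, ← delta_mul_br, delta]
    · exact ⟨w :: l, 0, h.nf_of_hd_ne hw, by simp⟩

lemma exists_nf (g : BraidGroup (N + 1)) : ∃ l k, NF l ∧ g = br l * delta ^ (k : ℤ) := by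
  have hl : ∀ (w : Sym N) (x : BraidGroup (N + 1)), (∃ l k, NF l ∧ x = br l * delta ^ (k : ℤ)) →
      ∃ l k, NF l ∧ lift w * x = br l * delta ^ (k : ℤ) := by
    rintro w _ ⟨l, k, hl, rfl⟩
    obtain ⟨l', k', h1, h2⟩ := (hl.1.run w).exists_nf
    exact ⟨l', k' + k, h1, by rw [← mul_assoc, ← br_run, h2, mul_assoc, zpow_add]⟩
  have hg : g ∈ Subgroup.closure (range (sg (N := N))) := closure_sg ▸ Subgroup.mem_top g
  induction hg using Subgroup.closure_induction_left with
  | one => exact ⟨[], 0, nf_nil, by simp [br_nil]⟩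
  | mul_left x hx y _ ih =>
    obtain ⟨i, rfl⟩ := hx
    rw [← lift_s]
    exact hl _ _ ih
  | inv_mul_cancel x hx y _ ih =>
    obtain ⟨i, rfl⟩ := hx
    obtain ⟨l, k, h1, rfl⟩ := ih
    have : (sg i)⁻¹ = lift (star (s i)) * delta⁻¹ := by
      rw [← lift_s, inv_eq_iff_mul_eq_one, ← mul_assoc, lift_mul_lift_star, mul_inv_cancel]
    rw [this, mul_assoc, ← mul_assoc _ (br l), delta_inv_mul_br]
    exact hl _ _ ⟨l.map tau, -1 + k, h1.map_tau, by rw [zpow_add, mul_assoc, zpow_neg_one]⟩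

lemma exists_br_eq_mul_pow [NeZero N] {l : List (Sym N)} (h : WC l) (k : ℕ) :
    ∃ l', WC l' ∧ br l' = br l * delta ^ (k + 1) ∧ w0 ∈ l' := by
  have step : ∀ {l : List (Sym N)}, WC l → ∃ l', WC l' ∧ br l' = br l * delta ∧ w0 ∈ l' :=
    fun {l} hl => ⟨w0 :: l.map tau, wc_w0_cons hl.map_tau, by
      rw [br_mul_delta, br_cons, delta], List.mem_cons_self⟩
  induction k with
  | zero => simpa using step h
  | succ k ih =>
    obtain ⟨l', h1, h2, _⟩ := ih
    obtain ⟨l'', h1', h2', h3'⟩ := step h1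
    exact ⟨l'', h1', by rw [h2', h2, mul_assoc, ← pow_succ], h3'⟩

lemma NF.unique [NeZero N] {l l' : List (Sym N)} (h : NF l) (h' : NF l') {a b : ℤ}
    (e : br l * delta ^ a = br l' * delta ^ b) : l = l' := by
  have key : ∀ {l l' : List (Sym N)}, NF l → NF l' → ∀ k : ℕ, br l = br l' * delta ^ k → l = l' := by
    intro l l' h h' k e
    cases k with
    | zero => exact eq_of_br_eq h.1 h'.1 (by simpa using e)
    | succ k =>
      obtain ⟨m, h1, h2, h3⟩ := exists_br_eq_mul_pow h'.1 k
      have := eq_of_br_eq h.1 h1 (by rw [e, h2])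
      rw [← this] at h3
      exact absurd h3 h.2
  rcases le_total a b with hab | hab
  · obtain ⟨k, rfl⟩ := Int.le.dest hab
    refine key h h' k ?_
    rw [add_comm a, zpow_add, ← mul_assoc] at e
    simpa using mul_right_cancel e
  · obtain ⟨k, rfl⟩ := Int.le.dest hab
    refine (key h' h k ?_).symm
    rw [add_comm b, zpow_add, ← mul_assoc] at e
    simpa using (mul_right_cancel e).symm

/-- The normal form of a braid, up to powers of the Garside element. -/
noncomputable def nf (g : BraidGroup (N + 1)) : List (Sym N) := (exists_nf g).choose

lemma nf_spec (g : BraidGroup (N + 1)) : NF (nf g) ∧ ∃ k : ℤ, g = br (nf g) * delta ^ k := by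
  obtain ⟨k, h1, h2⟩ := (exists_nf g).choose_spec
  exact ⟨h1, k, h2⟩

lemma nf_eq [NeZero N] {l : List (Sym N)} (h : NF l) (k : ℤ) : nf (br l * delta ^ k) = l := by
  obtain ⟨h1, k', h2⟩ := nf_spec (br l * delta ^ k)
  exact (h.unique h1 h2).symm

lemma nf_br [NeZero N] {l : List (Sym N)} (h : NF l) : nf (br l) = l := by
  simpa using nf_eq h 0

lemma nf_mul_zpow [NeZero N] (g : BraidGroup (N + 1)) (k : ℤ) : nf (g * delta ^ k) = nf g := by
  obtain ⟨h1, k', h2⟩ := nf_spec g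
  rw [h2, mul_assoc, ← zpow_add, nf_eq h1, nf_eq h1]

lemma nf_delta_mul [NeZero N] (g : BraidGroup (N + 1)) : nf (delta * g) = (nf g).map tau := by
  obtain ⟨h1, k', h2⟩ := nf_spec g
  conv_lhs => rw [h2]
  rw [← mul_assoc, delta_mul_br, mul_assoc, ← zpow_one_add, nf_eq h1.map_tau]

lemma nf_lift_mul [NeZero N] {u : Sym N} {g : BraidGroup (N + 1)} (h : al u (hd (nf g)) ≠ w0) :
    nf (lift u * g) = run u (nf g) := by
  obtain ⟨h1, k', h2⟩ := nf_spec g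
  conv_lhs => rw [h2]
  rw [← mul_assoc, ← br_run, nf_eq ((h1.1.run u).nf_of_hd_ne (by rwa [hd_run]))]

/-- The first letter of the normal form. -/
noncomputable def fst (g : BraidGroup (N + 1)) : Sym N := hd (nf g)

lemma fst_lift_mul [NeZero N] {u : Sym N} {g : BraidGroup (N + 1)} (h : al u (fst g) ≠ w0) :
    fst (lift u * g) = al u (fst g) := by
  rw [fst, nf_lift_mul h, hd_run, fst]

lemma NF.hd_ne [NeZero N] {l : List (Sym N)} (h : NF l) : hd l ≠ w0 := by
  cases l with
  | nil => exact w0_ne_one.symm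
  | cons w l => exact fun e => h.2 (List.mem_cons.2 (Or.inl e.symm))

lemma fst_ne_w0 [NeZero N] (g : BraidGroup (N + 1)) : fst g ≠ w0 := (nf_spec g).1.hd_ne

lemma fst_eq_one {g : BraidGroup (N + 1)} : fst g = 1 ↔ nf g = [] := by
  have h := (nf_spec g).1.1
  rw [fst]
  cases e : nf g with
  | nil => simp [hd]
  | cons w l =>
    rw [e] at h
    simpa [hd] using (wc_cons.1 h).1

lemma fst_mul_zpow [NeZero N] (g : BraidGroup (N + 1)) (k : ℤ) : fst (g * delta ^ k) = fst g := by
  rw [fst, nf_mul_zpow, fst]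

lemma fst_delta_mul [NeZero N] (g : BraidGroup (N + 1)) : fst (delta * g) = tau (fst g) := by
  rw [fst, nf_delta_mul, fst]
  cases nf g with
  | nil => exact tau_one.symm
  | cons w l => rfl

lemma nf_cons [NeZero N] {w : Sym N} {l : List (Sym N)} :
    NF (w :: l) ↔ w ≠ 1 ∧ w ≠ w0 ∧ Weighted w (hd l) ∧ NF l := by
  rw [NF, wc_cons, List.mem_cons, not_or, NF, ne_comm (a := w) (b := w0)]
  tauto

lemma weighted_iff_star {u w : Sym N} :
    Weighted u w ↔ ∀ i, LD i (star u) → ¬ LD i w := by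
  simp only [weighted_iff, ld_star]
  exact forall_congr' fun i => by tauto

lemma weighted_star_tau_star {u w : Sym N} (h : Weighted u w) : Weighted (star w) (tau (star u)) := by
  rw [weighted_iff] at h ⊢
  intro i hi
  rw [ld_tau, ld_star] at hi
  rw [rd_star]
  exact fun hn => hi (h _ hn)

/-- The word of the inverse of the reversed word. -/
def cw : List (Sym N) → List (Sym N)
  | [] => []
  | w :: l => star w :: (cw l).map tau

lemma length_cw (l : List (Sym N)) : (cw l).length = l.length := by
  induction l with
  | nil => rfl
  | cons w l ih => simp [cw, ih]

lemma nf_cw [NeZero N] {l : List (Sym N)} (h : l.IsChain (flip Weighted)) (h1 : 1 ∉ l)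
    (h0 : w0 ∉ l) : NF (cw l) := by
  induction l with
  | nil => exact nf_nil
  | cons w l ih =>
    rw [List.mem_cons, not_or] at h1 h0
    refine nf_cons.2 ⟨fun e => h0.1 (star_eq_one e).symm, fun e => h1.1 ?_, ?_,
      (ih h.of_cons h1.2 h0.2).map_tau⟩
    · rw [star, mul_eq_right, inv_eq_one] at e
      exact e.symm
    · cases l with
      | nil => exact weighted_one _
      | cons x l => exact weighted_star_tau_star (List.isChain_cons_cons.1 h).1

lemma NF.cw_reverse [NeZero N] {l : List (Sym N)} (h : NF l) : NF (cw l.reverse) :=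
  nf_cw (List.isChain_reverse.2 h.1.1) (by simpa using h.1.2) (by simpa using h.2)

lemma br_inv (l : List (Sym N)) :
    (br l)⁻¹ = br (cw l.reverse) * delta ^ (-(l.length : ℤ)) := by
  induction l using List.reverseRecOn with
  | nil => simp [br_nil, cw]
  | append_singleton l w ih =>
    have : (lift w)⁻¹ = lift (star w) * delta⁻¹ := by
      rw [inv_eq_iff_mul_eq_one, ← mul_assoc, lift_mul_lift_star, mul_inv_cancel]
    rw [br_append, mul_inv_rev, ih, br_cons, br_nil, mul_one, this, List.reverse_append]
    simp only [List.reverse_singleton, List.singleton_append, cw, br_cons, List.length_append,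
      List.length_singleton, Nat.cast_add, Nat.cast_one, neg_add_rev]
    rw [zpow_add, zpow_neg_one, mul_assoc, mul_assoc, ← mul_assoc delta⁻¹, delta_inv_mul_br]
    simp only [mul_assoc]

lemma delta_zpow_invariant {β : Type} (f : BraidGroup (N + 1) → BraidGroup (N + 1) → β)
    (h : ∀ x y, f (delta * x) (delta * y) = f x y) (k : ℤ) (x y : BraidGroup (N + 1)) :
    f (delta ^ k * x) (delta ^ k * y) = f x y := by
  induction k generalizing x y with
  | zero => simp
  | succ k ih => rw [zpow_add_one, mul_assoc, mul_assoc, ih, h]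
  | pred k ih =>
    rw [← ih x y, ← h, ← mul_assoc, ← mul_assoc, ← zpow_one_add, add_sub_cancel]

/-- The canonical length. -/
noncomputable def len (g : BraidGroup (N + 1)) : ℕ := (nf g).length

/-- The left descent sets of the first letters are disjoint. -/
def D (x y : BraidGroup (N + 1)) : Prop := ∀ i, LD i (fst x) → ¬ LD i (fst y)

lemma D.symm {x y : BraidGroup (N + 1)} (h : D x y) : D y x := fun i hi hi' => h i hi' hi

lemma len_zpow_mul [NeZero N] (k : ℤ) (g : BraidGroup (N + 1)) : len (delta ^ k * g) = len g :=
  delta_zpow_invariant (fun x _ => len x) (fun x _ => by simp [len, nf_delta_mul]) k g g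

lemma d_zpow_mul [NeZero N] (k : ℤ) (x y : BraidGroup (N + 1)) :
    D (delta ^ k * x) (delta ^ k * y) ↔ D x y := by
  refine iff_of_eq (delta_zpow_invariant D (fun x y => ?_) k x y)
  simp only [D, fst_delta_mul, ld_tau]
  refine propext ⟨fun h i hi => ?_, fun h i => h _⟩
  have := h i.rev
  simp only [Fin.rev_rev] at this
  exact this hi

lemma len_inv [NeZero N] (g : BraidGroup (N + 1)) : len g⁻¹ = len g := by
  obtain ⟨h, k, e⟩ := nf_spec g
  conv_lhs => rw [e]
  rw [mul_inv_rev, ← zpow_neg, len_zpow_mul, br_inv, len, nf_eq h.cw_reverse, length_cw,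
    List.length_reverse, len]

lemma not_ld_one {i : Fin N} : ¬ LD i (1 : Sym N) := fun h =>
  s_ne_one i (eq_one_of_pre_one (pre_s_iff.2 h))

lemma nf_append [NeZero N] {l m : List (Sym N)} (hl : NF l) (hm : NF m) :
    NF (l ++ m) ↔ ∀ i, LD i (hd (cw l.reverse)) → ¬ LD i (hd m) := by
  rcases List.eq_nil_or_concat' l with rfl | ⟨l, w, rfl⟩
  · simpa [cw, hd, not_ld_one] using hm
  have : hd (cw (l ++ [w]).reverse) = star w := by simp [cw, hd]
  rw [this, ← weighted_iff_star]
  cases m with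
  | nil => simpa [hd, weighted_one] using hl
  | cons x m =>
    simp only [NF, WC, List.mem_append] at hl hm ⊢
    rw [List.isChain_append]
    simp only [hl.1.1, hm.1.1]
    simp only [List.mem_cons, not_or, List.not_mem_nil] at hl hm
    simp [hd]
    tauto

lemma d_inv_iff [NeZero N] (p z : BraidGroup (N + 1)) :
    D p⁻¹ (p⁻¹ * z) ↔ nf p <+: nf z := by
  obtain ⟨hl, k, e⟩ := nf_spec p
  obtain ⟨t, rfl⟩ : ∃ t, z = br (nf p) * t := ⟨(br (nf p))⁻¹ * z, by simp⟩
  have e1 : p⁻¹ = delta ^ (-k) * (br (nf p))⁻¹ := by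
    conv_lhs => rw [e]
    rw [mul_inv_rev, zpow_neg]
  have e2 : p⁻¹ * (br (nf p) * t) = delta ^ (-k) * t := by rw [e1]; group
  rw [e2, e1, d_zpow_mul]
  obtain ⟨hm, j, hj⟩ := nf_spec t
  have e3 : fst (br (nf p))⁻¹ = hd (cw (nf p).reverse) := by
    rw [br_inv, fst_mul_zpow, fst, nf_br hl.cw_reverse]
  rw [D, e3, fst, ← nf_append hl hm]
  constructor
  · intro h
    refine ⟨nf t, ?_⟩
    conv_rhs => rw [hj]
    rw [← mul_assoc, ← br_append, nf_eq h]
  · rintro ⟨m, h⟩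
    obtain ⟨hz, j', hj'⟩ := nf_spec (br (nf p) * t)
    rw [← h] at hz hj'
    rw [br_append, mul_assoc, mul_right_inj] at hj'
    have hm' : NF m := by
      refine ⟨⟨(List.isChain_append.1 hz.1.1).2.1, fun h1 => hz.1.2 ?_⟩, fun h1 => hz.2 ?_⟩ <;>
        exact List.mem_append_right _ h1
    rwa [hj', nf_eq hm']

/-- The braid `p` lies on the canonical geodesic from `y` to `z`. -/
def Bt (y p z : BraidGroup (N + 1)) : Prop := D (p⁻¹ * y) (p⁻¹ * z)

lemma Bt.symm {y p z : BraidGroup (N + 1)} (h : Bt y p z) : Bt z p y := D.symm h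

lemma ld_s {i b : Fin N} (h : LD i (s b)) : i = b := by
  rw [LD, s_inv] at h
  exact Fin.castSucc_injective _ (eq_of_s_lt Fin.castSucc_lt_succ h).1

lemma ld_s_self (b : Fin N) : LD b (s b) := pre_s_iff.1 (pre_refl _)

/-- The point `w` lies behind the wall of `x`. -/
def Bh (b : Fin N) (x w : BraidGroup (N + 1)) : Prop := ¬ LD b (fst (x⁻¹ * w))

lemma bh_mul_left {b : Fin N} {g x w : BraidGroup (N + 1)} : Bh b (g * x) (g * w) ↔ Bh b x w := by
  simp [Bh, mul_assoc]

lemma finite_len_le (c : ℕ) : {q : BraidGroup (N + 1) ⧸ Subgroup.zpowers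
    (delta * delta : BraidGroup (N + 1)) | ∃ g : BraidGroup (N + 1),
      (g : BraidGroup (N + 1) ⧸ Subgroup.zpowers (delta * delta : BraidGroup (N + 1))) = q ∧
      len g ≤ c}.Finite := by
  have h1 : ({l : List (Sym N) | l.length ≤ c} ×ˢ ({0, 1} : Set ℤ)).Finite :=
    (List.finite_length_le _ c).prod (by simp)
  refine (h1.image fun x => ((br x.1 * delta ^ x.2 : BraidGroup (N + 1)) :
    BraidGroup (N + 1) ⧸ Subgroup.zpowers (delta * delta : BraidGroup (N + 1)))).subset ?_
  rintro _ ⟨g, rfl, hg⟩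
  obtain ⟨_, k, e⟩ := nf_spec g
  refine ⟨(nf g, k % 2), ⟨hg, ?_⟩, ?_⟩
  · have := Int.emod_two_eq_zero_or_one k
    simpa using this
  · rw [QuotientGroup.eq, Subgroup.mem_zpowers_iff]
    refine ⟨k / 2, ?_⟩
    rw [← pow_two, ← zpow_natCast, ← zpow_mul]
    have h2 : ∀ l : List (Sym N), g = br l * delta ^ k →
        (br l * delta ^ (k % 2))⁻¹ * g = delta ^ (k - k % 2) := by
      rintro l rfl
      rw [mul_inv_rev, mul_assoc, inv_mul_cancel_left, ← zpow_neg, ← zpow_add, neg_add_eq_sub]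
    refine Eq.trans ?_ (h2 _ e).symm
    congr 1
    push_cast
    omega

section Distance

variable [NeZero N]

lemma bt_iff {y p z : BraidGroup (N + 1)} : Bt y p z ↔ nf (y⁻¹ * p) <+: nf (y⁻¹ * z) := by
  rw [← d_inv_iff, Bt, mul_inv_rev, inv_inv, mul_assoc, mul_inv_cancel_left]

lemma Bt.fst_eq {y p z : BraidGroup (N + 1)} (h : Bt y p z) (h1 : fst (y⁻¹ * p) ≠ 1) :
    fst (y⁻¹ * p) = fst (y⁻¹ * z) := by
  obtain ⟨l, hl⟩ := bt_iff.1 h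
  rw [ne_eq, fst_eq_one] at h1
  rw [fst, fst, ← hl]
  obtain ⟨w, m, e⟩ := List.exists_cons_of_ne_nil h1
  rw [e]
  rfl

lemma Bt.not_ld {y p z : BraidGroup (N + 1)} (h : Bt y p z) {b : Fin N}
    (hb : ¬ LD b (fst (y⁻¹ * z))) : ¬ LD b (fst (y⁻¹ * p)) := by
  by_cases h1 : fst (y⁻¹ * p) = 1
  · rw [h1]
    exact not_ld_one
  · rwa [h.fst_eq h1]

/-- The canonical distance. -/
noncomputable def dist (y z : BraidGroup (N + 1)) : ℕ := len (y⁻¹ * z)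

lemma dist_comm (y z : BraidGroup (N + 1)) : dist y z = dist z y := by
  rw [dist, ← len_inv, mul_inv_rev, inv_inv, dist]

lemma len_mul_of_prefix {p z : BraidGroup (N + 1)} (h : nf p <+: nf z) :
    len z = len p + len (p⁻¹ * z) := by
  obtain ⟨hl, k, e⟩ := nf_spec p
  obtain ⟨hz, k', e'⟩ := nf_spec z
  obtain ⟨m, hm⟩ := h
  have hm' : NF m := by
    rw [← hm] at hz
    refine ⟨⟨(List.isChain_append.1 hz.1.1).2.1, fun h1 => hz.1.2 ?_⟩, fun h1 => hz.2 ?_⟩ <;>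
      exact List.mem_append_right _ h1
  have h1 : p⁻¹ * z = delta ^ (-k) * (br m * delta ^ k') := by
    conv_lhs => rw [e, e', ← hm, br_append]
    group
  rw [h1, len_zpow_mul, len, ← hm, List.length_append, len, len, nf_eq hm']

lemma Bt.dist_add {y p z : BraidGroup (N + 1)} (h : Bt y p z) :
    dist y z = dist y p + dist p z := by
  have := len_mul_of_prefix (bt_iff.1 h)
  rwa [mul_inv_rev, inv_inv, mul_assoc, mul_inv_cancel_left] at this

lemma Bt.of_le_left {y p p' z : BraidGroup (N + 1)} (h : Bt y p z) (h' : Bt y p' z)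
    (hle : dist y p ≤ dist y p') : Bt y p p' :=
  bt_iff.2 (List.prefix_of_prefix_length_le (bt_iff.1 h) (bt_iff.1 h') hle)

lemma Bt.of_le_right {y p p' z : BraidGroup (N + 1)} (h : Bt y p z) (h' : Bt y p' z)
    (hle : dist y p ≤ dist y p') : Bt p p' z := by
  have h1 := h.dist_add
  have h2 := h'.dist_add
  refine (h'.symm.of_le_left h.symm ?_).symm
  rw [dist_comm z, dist_comm z]
  omega

lemma Bt.trans {y p q z : BraidGroup (N + 1)} (h : Bt y p q) (h' : Bt y q z) : Bt y p z :=
  bt_iff.2 ((bt_iff.1 h).trans (bt_iff.1 h'))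

section Wall

variable {F f : BraidGroup (N + 1)} {b : Fin N}

lemma bh_self (x : BraidGroup (N + 1)) : Bh b x x := by
  rw [Bh, inv_mul_cancel, show fst (1 : BraidGroup (N + 1)) = 1 by
    rw [← br_nil, fst, nf_br nf_nil]; rfl]
  exact not_ld_one

lemma bh_delta_sq {x w : BraidGroup (N + 1)} : Bh b (x * (delta * delta)) w ↔ Bh b x w := by
  have : (x * (delta * delta))⁻¹ * w = delta ^ (-2 : ℤ) * (x⁻¹ * w) := by
    simp [mul_inv_rev, zpow_neg, zpow_ofNat, pow_two, mul_assoc]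
  rw [Bh, Bh, this]
  have h2 : fst (delta * (delta * (delta ^ (-2 : ℤ) * (x⁻¹ * w)))) = fst (x⁻¹ * w) := by
    congr 1
    group
  rw [← h2, fst_delta_mul, fst_delta_mul, tau_tau]

variable (hF : F * F = delta * delta) (hb : fst F = s b)
include hF

lemma bh_mul_mul {x w : BraidGroup (N + 1)} : Bh b (x * F * F) w ↔ Bh b x w := by
  rw [mul_assoc, hF, bh_delta_sq]

include hb

lemma fst_inv_eq : fst F⁻¹ = s b := by
  have h : F = F⁻¹ * delta ^ (2 : ℤ) := by
    rw [zpow_ofNat, pow_two, ← hF, inv_mul_cancel_left]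
  rw [← hb]
  conv_rhs => rw [h]
  rw [fst_mul_zpow]

lemma fst_of_not_ld {z : BraidGroup (N + 1)} (h : ¬ LD b (fst (F⁻¹ * z))) : fst z = s b := by
  have h1 : Bt 1 F z := fun i hi => by
    rw [mul_one, fst_inv_eq hF hb] at hi
    rwa [ld_s hi]
  have := h1.fst_eq (by simpa [hb] using s_ne_one b)
  simpa [hb] using this.symm

lemma fst_of_bh {x w : BraidGroup (N + 1)} (h : Bh b (x * F) w) : fst (x⁻¹ * w) = s b :=
  fst_of_not_ld hF hb (by simpa [Bh, mul_assoc] using h)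

lemma not_bh_mul {x w : BraidGroup (N + 1)} (h : Bh b x w) : ¬ Bh b (x * F) w := fun h' => by
  rw [Bh, fst_of_bh hF hb h'] at h
  exact h (ld_s_self b)

lemma bt_of_bh {x y z : BraidGroup (N + 1)} (h : Bh b x y) (h' : Bh b (x * F) z) : Bt y x z := by
  refine Bt.symm fun i hi => ?_
  rw [fst_of_bh hF hb h'] at hi
  rwa [ld_s hi]

lemma bt_of_bh' {x y z : BraidGroup (N + 1)} (h : Bh b x y) (h' : Bh b (x * F) z) :
    Bt y (x * F) z :=
  (bt_of_bh hF hb h' ((bh_mul_mul hF).2 h)).symm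

lemma bh_of_bt {x y p z : BraidGroup (N + 1)} (h : Bh b x y) (hp : Bh b (x * F) p)
    (hbt : Bt y p z) : Bh b (x * F) z := by
  have h1 : Bt y (x * F) z := (bt_of_bh' hF hb h hp).trans hbt
  have h2 : fst ((x * F)⁻¹ * y) = s b := fst_of_bh hF hb ((bh_mul_mul hF).2 h)
  exact h1 b (by rw [h2]; exact ld_s_self b)

lemma bh_of_bh {r x p p' : BraidGroup (N + 1)} (h1 : Bh b r p) (h2 : Bh b x r)
    (h3 : Bh b (x * F) p) (h4 : Bh b (x * F) p') : Bh b r p' := by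
  have k1 := bt_of_bh hF hb h2 h3
  have k2 := bt_of_bh hF hb h2 h4
  by_cases h : fst (r⁻¹ * x) = 1
  · rw [fst_eq_one] at h
    obtain ⟨_, k, e⟩ := nf_spec (r⁻¹ * x)
    rw [h, br_nil, one_mul] at e
    have e1 : ∀ p, r⁻¹ * p = delta ^ k * (x⁻¹ * p) := fun p => by rw [← e]; group
    have e2 : fst (x⁻¹ * p) = fst (x⁻¹ * p') := by rw [fst_of_bh hF hb h3, fst_of_bh hF hb h4]
    have := delta_zpow_invariant (fun x y : BraidGroup (N + 1) => fst x = fst y) (fun x y => by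
      simp [fst_delta_mul, tau_injective.eq_iff]) k (x⁻¹ * p) (x⁻¹ * p')
    rw [Bh, e1, ← (iff_of_eq this).2 e2, ← e1]
    exact h1
  · rw [Bh, ← k2.fst_eq h, k1.fst_eq h]
    exact h1

lemma finite_separating (g : BraidGroup (N + 1)) :
    {q : BraidGroup (N + 1) ⧸ Subgroup.zpowers (F * F) | ∃ x : BraidGroup (N + 1),
      (x : BraidGroup (N + 1) ⧸ Subgroup.zpowers (F * F)) = q ∧ Bh b x 1 ∧
      Bh b (x * F) g}.Finite := by
  rw [hF]
  refine (finite_len_le (len g)).subset ?_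
  rintro _ ⟨x, rfl, h1, h2⟩
  refine ⟨x, rfl, ?_⟩
  have := (bt_of_bh hF hb h1 h2).dist_add
  simp only [dist, inv_one, one_mul] at this
  omega

variable (hf : ∀ x w : BraidGroup (N + 1), Bh b (x * F) w ∨ Bh b (x * f) w)
include hf

lemma bh_mul_pow {x w : BraidGroup (N + 1)} (h : Bh b x w) (k : ℕ) : Bh b (x * f ^ k) w := by
  induction k with
  | zero => simpa using h
  | succ k ih =>
    rw [pow_succ, ← mul_assoc]
    exact (hf _ _).resolve_left (not_bh_mul hF hb ih)

lemma bh_of_bh_mul_pow {x w : BraidGroup (N + 1)} {k : ℕ} (h : Bh b (x * f ^ k * F) w) :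
    Bh b (x * F) w := by
  induction k with
  | zero => simpa using h
  | succ k ih =>
    refine ih ((hf _ _).resolve_right fun h' => ?_)
    rw [pow_succ, ← mul_assoc] at h
    exact not_bh_mul hF hb h' h

lemma dist_le_dist {x y z : BraidGroup (N + 1)} {k : ℕ} (h : Bh b x y)
    (h' : Bh b (x * f ^ k * F) z) : dist y x ≤ dist y (x * f ^ k * F) := by
  by_contra hlt
  have h1 := bt_of_bh hF hb h (bh_of_bh_mul_pow hF hb hf h')
  have hy := bh_mul_pow hF hb hf h k
  have h2 := bt_of_bh' hF hb hy h'
  have h3 := h2.of_le_left h1 (not_le.1 hlt).le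
  have h4 : ∀ w, Bh b (x * f ^ k) w → fst ((x * f ^ k * F)⁻¹ * w) = s b := fun w hw =>
    fst_of_bh hF hb ((bh_mul_mul hF).2 hw)
  have h5 := h3 b
  rw [h4 _ hy, h4 _ (bh_mul_pow hF hb hf (bh_self x) k)] at h5
  exact h5 (ld_s_self b) (ld_s_self b)

lemma finite_crossing (k : ℕ) :
    ∃ M : Set (BraidGroup (N + 1) ⧸ Subgroup.zpowers (F * F)), M.Finite ∧
    ∀ x x' y z, Bh b x y → Bh b x' y → Bh b (x * f ^ k * F) z → Bh b (x' * f ^ k * F) z →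
      (Bh b (x * f ^ k * F) x' ∧ Bh b x' x) ∨ (Bh b (x' * f ^ k * F) x ∧ Bh b x x') ∨
      ((x⁻¹ * x' : BraidGroup (N + 1)) : BraidGroup (N + 1) ⧸ Subgroup.zpowers (F * F)) ∈ M := by
  have nested : ∀ x x' y z, Bh b x y → Bh b x' y → Bh b (x * f ^ k * F) z →
      Bh b (x' * f ^ k * F) z → dist y (x * f ^ k * F) ≤ dist y x' →
      Bh b (x * f ^ k * F) x' ∧ Bh b x' x := by
    intro x x' y z h1 h1' h2 h2' hle
    have k1 := bt_of_bh hF hb h1 (bh_of_bh_mul_pow hF hb hf h2)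
    have k1' := bt_of_bh hF hb h1' (bh_of_bh_mul_pow hF hb hf h2')
    have k2 := bt_of_bh' hF hb (bh_mul_pow hF hb hf h1 k) h2
    exact ⟨(k2.of_le_right k1' hle).not_ld h2,
      (k1.of_le_left k1' ((dist_le_dist hF hb hf h1 h2).trans hle)).symm.not_ld h1'⟩
  have between : ∀ x x' y z, Bh b x y → Bh b x' y → Bh b (x * f ^ k * F) z →
      Bh b (x' * f ^ k * F) z → dist y x' ≤ dist y (x * f ^ k * F) → dist y x ≤ dist y x' →
      len (x⁻¹ * x') ≤ len (f ^ k * F) := by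
    intro x x' y z h1 h1' h2 h2' hle hle'
    have k1 := bt_of_bh hF hb h1 (bh_of_bh_mul_pow hF hb hf h2)
    have k1' := bt_of_bh hF hb h1' (bh_of_bh_mul_pow hF hb hf h2')
    have k2 := bt_of_bh' hF hb (bh_mul_pow hF hb hf h1 k) h2
    have := ((k1.of_le_left k2 (hle'.trans hle)).of_le_right (k1'.of_le_left k2 hle) hle').dist_add
    simp only [dist, mul_assoc, inv_mul_cancel_left] at this
    omega
  refine ⟨_, hF ▸ finite_len_le (len (f ^ k * F)), fun x x' y z h1 h1' h2 h2' => ?_⟩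
  rcases le_total (dist y (x * f ^ k * F)) (dist y x') with h | h
  · exact Or.inl (nested x x' y z h1 h1' h2 h2' h)
  rcases le_total (dist y (x' * f ^ k * F)) (dist y x) with h' | h'
  · exact Or.inr (Or.inl (nested x' x y z h1' h1 h2' h2 h'))
  refine Or.inr (Or.inr ⟨x⁻¹ * x', rfl, ?_⟩)
  rcases le_total (dist y x) (dist y x') with hle | hle
  · exact between x x' y z h1 h1' h2 h2' h hle
  · have := between x' x y z h1' h1 h2' h2 h' hle
    rwa [← len_inv, mul_inv_rev, inv_inv] at this

end Wall

end Distance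

lemma exists_perm (f : ℕ → ℕ) (h : ∀ p ≤ N, f p ≤ N)
    (hinj : ∀ p ≤ N, ∀ q ≤ N, f p = f q → p = q) :
    ∃ w : Sym N, (∀ i, RD i w ↔ f (i + 1) < f i) ∧
      ∀ i : Fin N, ∃ p q, p ≤ N ∧ q ≤ N ∧ f p = i ∧ f q = i + 1 ∧ (LD i w ↔ q < p) := by
  let F : Fin (N + 1) → Fin (N + 1) := fun p => ⟨f p, Nat.lt_succ_of_le (h p (by omega))⟩
  have hF : Function.Injective F := fun p q hpq => Fin.ext
    (hinj p (by omega) q (by omega) (Fin.ext_iff.1 hpq))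
  let w : Sym N := Equiv.ofBijective F (Finite.injective_iff_bijective.1 hF)
  have hw : ∀ p, (w p : ℕ) = f p := fun p => rfl
  refine ⟨w, fun i => ?_, fun i => ?_⟩
  · rw [RD, Fin.lt_def, hw, hw, Fin.val_succ, Fin.val_castSucc]
  · refine ⟨w⁻¹ i.castSucc, w⁻¹ i.succ, by omega, by omega, ?_, ?_, Iff.rfl⟩
    · rw [← hw, apply_inv_apply, Fin.val_castSucc]
    · rw [← hw, apply_inv_apply, Fin.val_succ]

lemma exists_unshuffle : ∃ w : Sym N,
    (∀ i : Fin N, RD i w → (i : ℕ) = N / 2) ∧ ∀ i : Fin N, (i : ℕ) % 2 = 1 → LD i w := by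
  obtain ⟨w, h1, h2⟩ := exists_perm (N := N)
    (fun p => if p ≤ N / 2 then 2 * p else 2 * (p - (N / 2 + 1)) + 1)
    (fun p hp => by split_ifs <;> omega)
    (fun p hp q hq => by split_ifs <;> omega)
  refine ⟨w, fun i hi => ?_, fun i hi => ?_⟩
  · rw [h1] at hi
    split_ifs at hi <;> omega
  · obtain ⟨p, q, hp, hq, ep, eq, h⟩ := h2 i
    rw [h]
    split_ifs at ep eq <;> omega

lemma exists_shuffle (hN : 2 ≤ N) : ∃ w : Sym N,
    (∀ i : Fin N, RD i w → (i : ℕ) % 2 = 1) ∧ ∀ i : Fin N, (i : ℕ) ≠ N / 2 → LD i w := by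
  obtain ⟨w, h1, h2⟩ := exists_perm (N := N)
    (fun p => if p % 2 = 0 then N / 2 - p / 2 else N - p / 2)
    (fun p hp => by split_ifs <;> omega)
    (fun p hp q hq => by split_ifs <;> omega)
  refine ⟨w, fun i hi => ?_, fun i hi => ?_⟩
  · rw [h1] at hi
    split_ifs at hi <;> omega
  · obtain ⟨p, q, hp, hq, ep, eq, h⟩ := h2 i
    rw [h]
    split_ifs at ep eq <;> omega

lemma exists_cap : ∃ w : Sym N,
    (∀ i : Fin N, (i : ℕ) ≠ 0 → RD i w) ∧ ∀ i : Fin N, (i : ℕ) = N / 2 → ¬ LD i w := by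
  obtain ⟨w, h1, h2⟩ := exists_perm (N := N)
    (fun p => if p = 0 then N / 2 else if N / 2 < N + 1 - p then N + 1 - p else N - p)
    (fun p hp => by split_ifs <;> omega)
    (fun p hp q hq => by split_ifs <;> omega)
  refine ⟨w, fun i hi => ?_, fun i hi => ?_⟩
  · have hlt := i.isLt
    rw [h1]
    rw [if_neg hi, if_neg (by omega : ¬ (i : ℕ) + 1 = 0)]
    split_ifs <;> omega
  · obtain ⟨p, q, hp, hq, ep, eq, h⟩ := h2 i
    rw [h]
    split_ifs at ep eq <;> omega

lemma ld_inv {i : Fin N} {w : Sym N} : LD i w⁻¹ ↔ RD i w := by rw [LD, inv_inv, RD]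

lemma rd_inv {i : Fin N} {w : Sym N} : RD i w⁻¹ ↔ LD i w := Iff.rfl

lemma ld_w0 (i : Fin N) : LD i w0 := pre_s_iff.1 (pre_w0 _)

lemma not_ld_of_rd_star {u a : Sym N} (h : al u a = w0) {i : Fin N} (hi : ¬ RD i u) : LD i a := by
  have h1 : mt u a = star u := by
    rw [star, ← h, al, inv_mul_cancel_left]
  exact pre_s_iff.1 ((pre_s_iff.2 (ld_star.2 hi)).trans (h1 ▸ mt_pre u a))

lemma ld_al {i : Fin N} {u : Sym N} (h : LD i u) (a : Sym N) : LD i (al u a) := ld_mul h (red_mt u a)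

lemma ld_eq_of_adj {i j : Fin N} (h : (j : ℕ) = i + 1) :
    ¬ LD j (s i * s j) ∧ ¬ LD i (s j * s i) := by
  have h1 := castSucc_of_adj h
  constructor
  · rw [LD, mul_inv_rev, s_inv, s_inv, Equiv.Perm.mul_apply, Equiv.Perm.mul_apply,
      s_succ_of_adj h, s_succ, h1, s_succ, s_castSucc_of_adj h, ← h1, Fin.lt_def]
    simp
    omega
  · rw [LD, mul_inv_rev, s_inv, s_inv, Equiv.Perm.mul_apply, Equiv.Perm.mul_apply, ← h1,
      s_castSucc, s_succ_of_adj h, s_castSucc_of_adj h, s_castSucc, ← h1]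
    exact Fin.castSucc_lt_succ.not_gt

section Elements

variable [NeZero N]

lemma exists_flip (hN : 2 ≤ N) {b : Fin N} (hb : (b : ℕ) = N / 2) {w2 w3 : Sym N}
    (h3 : ∀ i : Fin N, RD i w3 → (i : ℕ) = N / 2) (h3' : ∀ i : Fin N, (i : ℕ) % 2 = 1 → LD i w3)
    (h2 : ∀ i : Fin N, RD i w2 → (i : ℕ) % 2 = 1) (h2' : ∀ i : Fin N, (i : ℕ) ≠ N / 2 → LD i w2) :
    ∃ g : BraidGroup (N + 1), fst (g * delta * g⁻¹) = s b := by
  obtain ⟨x, hx, hx'⟩ := exists_cap (N := N)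
  let i0 : Fin N := ⟨0, by omega⟩
  let i1 : Fin N := ⟨1, by omega⟩
  have hne : ∀ {i : Fin N} {w : Sym N}, LD i w → w ≠ 1 := fun h e => not_ld_one (e ▸ h)
  have hne0 : ∀ {i : Fin N} {w : Sym N}, ¬ LD i w → w ≠ w0 := fun h e => h (e ▸ ld_w0 _)
  have hnf : NF [s b, w3⁻¹, w2⁻¹, x] := by
    refine nf_cons.2 ⟨s_ne_one b, hne0 (i := i0) fun h => ?_, ?_, nf_cons.2 ⟨?_, ?_, ?_,
      nf_cons.2 ⟨?_, ?_, ?_, nf_cons.2 ⟨?_, ?_, weighted_one _, nf_nil⟩⟩⟩⟩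
    · have := congrArg Fin.val (ld_s h)
      simp only [i0] at this
      omega
    · refine weighted_iff.2 fun i hi => ?_
      have : i = b := Fin.ext ((h3 i (ld_inv.1 hi)).trans hb.symm)
      rw [this, ← ld_inv, s_inv]
      exact ld_s_self b
    · exact inv_ne_one.2 (hne (h3' i1 rfl))
    · refine hne0 (i := i0) fun h => ?_
      have := h3 _ (ld_inv.1 h)
      simp only [i0] at this
      omega
    · exact weighted_iff.2 fun i hi => rd_inv.2 (h3' i (h2 i (ld_inv.1 hi)))
    · exact inv_ne_one.2 (hne (h2' i0 (by simp only [i0]; omega)))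
    · refine hne0 (i := i0) fun h => ?_
      have := h2 _ (ld_inv.1 h)
      simp [i0] at this
    · exact weighted_iff.2 fun i hi => rd_inv.2 (h2' i fun e => hx' i e hi)
    · refine inv_ne_one.1 (hne (i := i1) (ld_inv.2 (hx i1 ?_)))
      simp [i1]
    · exact hne0 (hx' b hb)
  refine ⟨br [s b, w3⁻¹, w2⁻¹, x], ?_⟩
  set g := br [s b, w3⁻¹, w2⁻¹, x] with hg
  have h1 : fst g⁻¹ = star x := by
    rw [hg, br_inv, fst_mul_zpow, fst, nf_br hnf.cw_reverse]
    simp [cw, hd]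
  have h2 : fst g = s b := by rw [hg, fst, nf_br hnf]; rfl
  have h4 : Bt 1 g (g * delta * g⁻¹) := by
    intro i hi hi'
    rw [mul_one, h1, ld_star] at hi
    rw [mul_assoc, inv_mul_cancel_left, fst_delta_mul, h1, ld_tau, ld_star] at hi'
    have e1 : (i : ℕ) = 0 := by_contra fun h => hi (hx i h)
    have e2 : (i.rev : ℕ) = 0 := by_contra fun h => hi' (hx _ h)
    rw [Fin.val_rev] at e2
    omega
  have := h4.fst_eq (by simpa [h2] using s_ne_one b)
  simpa [h2] using this.symm

lemma not_ld_fst_lift_mul {b : Fin N} (hb : (b : ℕ) = N / 2) {w2 w3 : Sym N}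
    (h3 : ∀ i : Fin N, RD i w3 → (i : ℕ) = N / 2) (h3' : ∀ i : Fin N, (i : ℕ) % 2 = 1 → LD i w3)
    (h2 : ∀ i : Fin N, RD i w2 → (i : ℕ) % 2 = 1) (h2' : ∀ i : Fin N, (i : ℕ) ≠ N / 2 → LD i w2)
    {u : BraidGroup (N + 1)} (hu : LD b (fst u)) : ¬ LD b (fst (lift w2 * (lift w3 * u))) := by
  have c1 : al w3 (fst u) ≠ w0 := fun h => fst_ne_w0 u <| eq_w0_of_forall_ld fun i => by
    by_cases hi : (i : ℕ) = N / 2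
    · rwa [Fin.ext (hi.trans hb.symm)]
    · exact not_ld_of_rd_star h fun h' => hi (h3 i h')
  have c2 : al w2 (al w3 (fst u)) ≠ w0 := fun h => c1 <| eq_w0_of_forall_ld fun i => by
    by_cases hi : (i : ℕ) % 2 = 1
    · exact ld_al (h3' i hi) _
    · exact not_ld_of_rd_star h fun h' => hi (h2 i h')
  have e := fst_lift_mul c1
  have e' := fst_lift_mul (g := lift w3 * u) (u := w2) (by rwa [e])
  rw [e', e]
  refine fun hn => c2 <| eq_w0_of_forall_ld fun i => ?_
  by_cases hi : (i : ℕ) = N / 2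
  · rwa [Fin.ext (hi.trans hb.symm)]
  · exact ld_al (h2' i hi) _

lemma fst_lift {u : Sym N} (h : u ≠ w0) : fst (lift u) = u := by
  have h1 : fst (1 : BraidGroup (N + 1)) = 1 := by
    rw [← br_nil, fst, nf_br nf_nil]
    rfl
  have := fst_lift_mul (u := u) (g := 1) (by rwa [h1, al_one])
  rwa [mul_one, h1, al_one] at this

/-- Walls of braids carried by a conjugate of the Garside element. -/
theorem nonempty_barrierSystem (hN : 2 ≤ N) : Nonempty (BarrierSystem (BraidGroup (N + 1))) := by
  obtain ⟨w3, h3, h3'⟩ := exists_unshuffle (N := N)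
  obtain ⟨w2, h2, h2'⟩ := exists_shuffle hN
  obtain ⟨b, hb⟩ : ∃ b : Fin N, (b : ℕ) = N / 2 := ⟨⟨N / 2, by omega⟩, rfl⟩
  obtain ⟨a, ha⟩ : ∃ a : Fin N, (b : ℕ) = a + 1 := ⟨⟨N / 2 - 1, by omega⟩, by simp only; omega⟩
  obtain ⟨g, hg⟩ := exists_flip hN hb h3 h3' h2 h2'
  obtain ⟨φ, hφ⟩ := exists_weight (N := N)
  set F := g * delta * g⁻¹ with hFdef
  have hF : F * F = delta * delta := by
    rw [hFdef, show g * delta * g⁻¹ * (g * delta * g⁻¹) = g * (delta * delta) * g⁻¹ by group,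
      ← delta_sq_comm, mul_inv_cancel_right]
  set f := F * (lift w2 * lift w3) with hfdef
  have hf : ∀ x w : BraidGroup (N + 1), Bh b (x * F) w ∨ Bh b (x * f) w := by
    intro x w
    by_contra! h
    have h1 : ¬ Bh b (x * f) w := h.2
    rw [Bh, not_not] at h1
    refine h.1 ?_
    have := not_ld_fst_lift_mul hb h3 h3' h2 h2' h1
    rwa [show lift w2 * (lift w3 * ((x * f)⁻¹ * w)) = (x * F)⁻¹ * w by rw [hfdef]; group] at this
  have hab : a ≠ b := fun e => by rw [e] at ha; omega
  obtain ⟨hna, hnb⟩ := ld_eq_of_adj ha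
  have ne1 : s a * s b ≠ w0 := fun e => hna (e ▸ ld_w0 _)
  have ne2 : s b * s a ≠ w0 := fun e => hnb (e ▸ ld_w0 _)
  have hld : LD b (s b * s a) := ld_mul (ld_s_self b) (red_s_s hab.symm)
  have ne3 : s b * s a ≠ s b := fun e => s_ne_one a (mul_eq_left.1 e)
  set y : BraidGroup (N + 1) := lift (s b * s a) * lift (s a * s b) with hy
  have hsel : ∀ w, ¬ Bh b (y * f) w → fst w = s b * s a := by
    intro w hw
    have h1 := fst_of_bh hF hg ((hf y w).resolve_right hw)
    have m1 : Weighted (s a * s b) (s b) := weighted_iff.2 fun i hi => by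
      rw [ld_s hi, ← ld_inv, mul_inv_rev, s_inv, s_inv]
      exact hld
    have m2 : Weighted (s b * s a) (s a * s b) := weighted_iff.2 fun i hi => by
      rwa [← ld_inv, mul_inv_rev, s_inv, s_inv]
    have m1' : al (s a * s b) (s b) = s a * s b := by
      rw [al, show mt (s a * s b) (s b) = 1 from m1, mul_one]
    have m2' : al (s b * s a) (s a * s b) = s b * s a := by
      rw [al, show mt (s b * s a) (s a * s b) = 1 from m2, mul_one]
    have e1 : fst (lift (s a * s b) * (y⁻¹ * w)) = s a * s b := by
      rw [fst_lift_mul] <;> rw [h1, m1']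
      exact ne1
    have e2 : fst (lift (s b * s a) * (lift (s a * s b) * (y⁻¹ * w))) = s b * s a := by
      rw [fst_lift_mul] <;> rw [e1, m2']
      exact ne2
    rwa [← mul_assoc, ← hy, mul_inv_cancel_left] at e2
  have hsel0 : ∀ w, ¬ Bh b f w → fst w = s b := fun w hw => by
    have := fst_of_bh hF hg ((hf 1 w).resolve_right (by rwa [one_mul]))
    rwa [inv_one, one_mul] at this
  have hsel1 : ∀ w, ¬ Bh b (F * f) w → ¬ LD b (fst w) := fun w hw => by
    have := (hf F w).resolve_right hw
    rwa [hF, ← one_mul (delta * delta), bh_delta_sq, Bh, inv_one, one_mul] at this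
  have hsel' : ∀ {i j : Fin 3}, i ≠ j → ∀ w, Bh b (![f, F * f, y * f] i) w ∨
      Bh b (![f, F * f, y * f] j) w := by
    intro i j hij w
    by_contra! h
    obtain ⟨k1, k2⟩ := h
    fin_cases i <;> fin_cases j <;> simp at hij k1 k2
    · exact hsel1 w k2 (by rw [hsel0 w k1]; exact ld_s_self b)
    · exact ne3 ((hsel w k2).symm.trans (hsel0 w k1))
    · exact hsel1 w k1 (by rw [hsel0 w k2]; exact ld_s_self b)
    · exact hsel1 w k1 (by rw [hsel w k2]; exact hld)
    · exact ne3 ((hsel w k1).symm.trans (hsel0 w k2))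
    · exact hsel1 w k2 (by rw [hsel w k1]; exact hld)
  exact ⟨{
    Behind := Bh b
    Between := Bt
    flip := F
    shift := f
    selector := ![f, F * f, y * f]
    weight := φ
    flip_sq_comm := fun g => by rw [hF, delta_sq_comm]
    weight_flip_sq := fun h => by
      have h1 := (weight_lift hφ w0).2 w0_ne_one
      rw [hF, map_mul] at h
      have h4 := congrArg Multiplicative.toAdd h
      rw [toAdd_mul, toAdd_one, delta] at h4
      omega
    behind_mul_left := bh_mul_left
    behind_flip_sq := by
      intro s w
      rw [hF, bh_delta_sq]
    behind_self := bh_self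
    not_front := not_bh_mul hF hg
    between_of_separates := bt_of_bh hF hg
    between_symm := Bt.symm
    front_of_between := bh_of_bt hF hg
    front_or_behind_shift := hf
    behind_of_front := bh_of_bh hF hg
    behind_selector := fun {i j} hij s w => by
      have := hsel' hij (s⁻¹ * w)
      rwa [← bh_mul_left (g := s), ← bh_mul_left (g := s) (x := ![f, F * f, y * f] j),
        mul_inv_cancel_left] at this
    finite_separating := finite_separating hF hg
    finite_crossing := finite_crossing hF hg hf
    exists_not_behind := by
      refine ⟨lift (s b * s a), ?_, fun h => ?_⟩
      · rw [Bh, not_not, inv_one, one_mul, fst_lift ne2]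
        exact hld
      · have := fst_of_bh hF hg (x := 1) (by rwa [one_mul])
        rw [inv_one, one_mul, fst_lift ne2] at this
        exact ne3 this }⟩

end Elements

end Braid

/-- For every `n ≥ 3`, the braid group `Bₙ` satisfies the strong generic free group
property with respect to every finite generating set. -/
theorem braidGroup_hasStrongGenericFreeGroupProperty (n : ℕ) (hn : 3 ≤ n) :
    HasStrongGenericFreeGroupProperty (BraidGroup n) := by
  obtain ⟨N, rfl⟩ : ∃ N, n = N + 1 := ⟨n - 1, by omega⟩
  have : NeZero N := ⟨by omega⟩
  obtain ⟨b⟩ := Braid.nonempty_barrierSystem (N := N) (by omega)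
  exact b.hasStrongGenericFreeGroupProperty
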